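/- (Uniform interior Hölder estimate.) Let n ≥ 2, A > 0 and α ∈ (0,1). There exists a constant C = C(n, α, A) such that for every κ > 0 and every pair of smooth functions u, v on B₂(0) ⊂ ℝⁿ with u > 0, v > 0, u + v ≤ A, satisfying Δu = κ u v² and Δv = κ v u² in B₂(0), the C^α Hölder seminorms of u and v on B₁(0) are bounded by C: for all x, y ∈ B₁(0), |u(x) − u(y)| + |v(x) − v(y)| ≤ C |x − y|^α. -/

import Mathlib

open MeasureTheory Metric
open scoped RealInnerProductSpace

noncomputable section

/-- The Laplacian of a function on Euclidean space, as the trace of the second derivative. -/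
def lap {n : ℕ} (u : EuclideanSpace ℝ (Fin n) → ℝ) (x : EuclideanSpace ℝ (Fin n)) : ℝ :=
  ∑ i : Fin n, iteratedFDeriv ℝ 2 u x (fun _ => EuclideanSpace.single i 1)

/-- A (positive classical) solution of the system Δu = u v², Δv = v u², u,v > 0 on ℝⁿ. -/
def IsSolution {n : ℕ} (u v : EuclideanSpace ℝ (Fin n) → ℝ) : Prop :=
  ContDiff ℝ (⊤ : ℕ∞) u ∧ ContDiff ℝ (⊤ : ℕ∞) v ∧ (∀ x, 0 < u x) ∧ (∀ x, 0 < v x) ∧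
    (∀ x, lap u x = u x * v x ^ 2) ∧ (∀ x, lap v x = v x * u x ^ 2)

namespace UniformHolder

open Filter Topology Set
open scoped ContDiff

variable {n : ℕ}

/-! ### Weighted averages against `(1 - ‖y‖²)₊ ^ m` -/

section

/-- Euclidean space of dimension `n`. -/
abbrev E (n : ℕ) := EuclideanSpace ℝ (Fin n)

/-- The partial derivative in the `i`-th coordinate direction. -/
def pd (i : Fin n) (f : E n → ℝ) (x : E n) : ℝ := fderiv ℝ f x (EuclideanSpace.single i 1)

/-- The weight `(1 - ‖y‖²)₊ ^ m`. -/
def q (m : ℕ) (y : E n) : ℝ := (max (1 - ‖y‖ ^ 2) 0) ^ m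

lemma continuous_q (m : ℕ) : Continuous (q m : E n → ℝ) := by unfold q; fun_prop

lemma q_nonneg (m : ℕ) (y : E n) : 0 ≤ q m y := by unfold q; positivity

lemma q_le_one (m : ℕ) (y : E n) : q m y ≤ 1 := by
  unfold q
  apply pow_le_one₀ (le_max_right _ _)
  apply max_le _ zero_le_one
  nlinarith [sq_nonneg ‖y‖]

lemma q_eq_zero {m : ℕ} (hm : m ≠ 0) {y : E n} (hy : y ∉ ball (0 : E n) 1) : q m y = 0 := by
  have : 1 ≤ ‖y‖ := by simpa using hy
  unfold q
  rw [max_eq_right (by nlinarith), zero_pow hm]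

lemma q_pos (m : ℕ) {y : E n} (hy : y ∈ ball (0 : E n) 1) : 0 < q m y := by
  have : ‖y‖ < 1 := by simpa using hy
  unfold q
  apply pow_pos
  apply lt_max_of_lt_left
  nlinarith [norm_nonneg y]

lemma hasCompactSupport_q {m : ℕ} (hm : m ≠ 0) : HasCompactSupport (q m : E n → ℝ) := by
  apply HasCompactSupport.intro (isCompact_closedBall (0 : E n) 1)
  intro x hx
  exact q_eq_zero hm (fun h => hx (ball_subset_closedBall h))

lemma hasDerivAt_max_pow (m : ℕ) (hm : 1 ≤ m) (s : ℝ) :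
    HasDerivAt (fun s : ℝ => (max s 0) ^ (m + 1)) ((m + 1) * (max s 0) ^ m) s := by
  rcases lt_trichotomy s 0 with h | h | h
  · rw [max_eq_right h.le, zero_pow (by omega), mul_zero]
    refine (hasDerivAt_const s (0 : ℝ)).congr_of_eventuallyEq ?_
    filter_upwards [Iio_mem_nhds h] with x hx
    rw [max_eq_right (le_of_lt hx), zero_pow (by omega)]
  · subst h
    rw [max_self, zero_pow (by omega), mul_zero]
    rw [hasDerivAt_iff_isLittleO]
    have : (fun x : ℝ => x ^ 2) =o[𝓝 0] fun x : ℝ => x := by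
      simpa using Asymptotics.isLittleO_pow_pow (𝕜 := ℝ) (show 1 < 2 by norm_num)
    simp only [max_self, sub_zero, smul_zero, ne_eq, Nat.add_eq_zero_iff, one_ne_zero, and_false,
      not_false_eq_true, zero_pow]
    refine Asymptotics.IsBigO.trans_isLittleO ?_ this
    apply Asymptotics.IsBigO.of_bound 1
    have h1 : ∀ᶠ x : ℝ in 𝓝 0, x < 1 := Iio_mem_nhds one_pos
    filter_upwards [h1] with x hx
    rw [one_mul, Real.norm_of_nonneg (pow_nonneg (le_max_right x 0) _),
      Real.norm_of_nonneg (sq_nonneg x)]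
    calc (max x 0) ^ (m + 1) ≤ (max x 0) ^ 2 :=
          pow_le_pow_of_le_one (le_max_right _ _) (max_le hx.le zero_le_one) (by omega)
      _ ≤ x ^ 2 := by
          rcases le_total x 0 with h | h
          · rw [max_eq_right h, zero_pow (by norm_num)]; exact sq_nonneg x
          · rw [max_eq_left h]
  · rw [max_eq_left h.le]
    have := (hasDerivAt_pow (m + 1) s)
    rw [Nat.add_sub_cancel] at this
    push_cast at this
    refine this.congr_of_eventuallyEq ?_
    filter_upwards [Ioi_mem_nhds h] with x hx
    rw [max_eq_left (le_of_lt hx)]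

lemma hasFDerivAt_q (m : ℕ) (hm : 1 ≤ m) (y : E n) :
    HasFDerivAt (q (m + 1) : E n → ℝ) ((-(2 * (m + 1) * q m y)) • innerSL ℝ y) y := by
  have h1 : HasFDerivAt (fun y : E n => 1 - ‖y‖ ^ 2) (-(2 • innerSL ℝ y)) y :=
    ((hasStrictFDerivAt_norm_sq y).hasFDerivAt).const_sub 1
  have := (hasDerivAt_max_pow m hm (1 - ‖y‖ ^ 2)).comp_hasFDerivAt y h1
  have e : (-(2 * (m + 1) * q m y)) • innerSL ℝ y =
      ((m + 1) * max (1 - ‖y‖ ^ 2) 0 ^ m : ℝ) • (-(2 • innerSL ℝ y)) := by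
    ext w
    simp only [q, smul_apply, neg_apply, smul_eq_mul,
      nsmul_eq_mul]
    push_cast
    ring
  rw [e]
  exact this

lemma fderiv_q (m : ℕ) (hm : 1 ≤ m) (i : Fin n) (y : E n) :
    fderiv ℝ (q (m + 1) : E n → ℝ) y (EuclideanSpace.single i 1) = -(2 * (m + 1)) * (y i * q m y) := by
  rw [(hasFDerivAt_q m hm y).fderiv]
  simp [EuclideanSpace.inner_single_right]
  ring

/-- The weighted integral of `F` against `q m`. -/
def J (m : ℕ) (F : E n → ℝ) : ℝ := ∫ y, F y * q m y

lemma integrable_mul_q {m : ℕ} (hm : m ≠ 0) {F : E n → ℝ} (hF : Continuous F) :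
    Integrable fun y => F y * q m y :=
  (hF.mul (continuous_q m)).integrable_of_hasCompactSupport (hasCompactSupport_q hm).mul_left

lemma J_congr {m : ℕ} (hm : m ≠ 0) {F G : E n → ℝ} (h : ∀ y ∈ ball (0 : E n) 1, F y = G y) :
    J m F = J m G := by
  unfold J
  congr 1
  ext y
  by_cases hy : y ∈ ball (0 : E n) 1
  · rw [h y hy]
  · rw [q_eq_zero hm hy, mul_zero, mul_zero]

lemma J_mono {m : ℕ} (hm : m ≠ 0) {F G : E n → ℝ} (hF : Continuous F) (hG : Continuous G)
    (h : ∀ y ∈ ball (0 : E n) 1, F y ≤ G y) : J m F ≤ J m G := by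
  apply integral_mono (integrable_mul_q hm hF) (integrable_mul_q hm hG)
  intro y
  by_cases hy : y ∈ ball (0 : E n) 1
  · exact mul_le_mul_of_nonneg_right (h y hy) (q_nonneg _ _)
  · simp [q_eq_zero hm hy]

lemma J_nonneg {m : ℕ} (hm : m ≠ 0) {F : E n → ℝ} (h : ∀ y ∈ ball (0 : E n) 1, 0 ≤ F y) :
    0 ≤ J m F := by
  apply integral_nonneg
  intro y
  by_cases hy : y ∈ ball (0 : E n) 1
  · exact mul_nonneg (h y hy) (q_nonneg _ _)
  · simp [q_eq_zero hm hy]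

lemma J_add {m : ℕ} (hm : m ≠ 0) {F G : E n → ℝ} (hF : Continuous F) (hG : Continuous G) :
    J m (fun y => F y + G y) = J m F + J m G := by
  unfold J
  rw [← integral_add (integrable_mul_q hm hF) (integrable_mul_q hm hG)]
  simp only [add_mul]

lemma J_sub {m : ℕ} (hm : m ≠ 0) {F G : E n → ℝ} (hF : Continuous F) (hG : Continuous G) :
    J m (fun y => F y - G y) = J m F - J m G := by
  unfold J
  rw [← integral_sub (integrable_mul_q hm hF) (integrable_mul_q hm hG)]
  simp only [sub_mul]

lemma J_const_mul (m : ℕ) (c : ℝ) (F : E n → ℝ) : J m (fun y => c * F y) = c * J m F := by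
  unfold J
  rw [← integral_const_mul]
  simp only [mul_assoc]

lemma J_sum {m : ℕ} (hm : m ≠ 0) {F : Fin n → E n → ℝ} (hF : ∀ i, Continuous (F i)) :
    J m (fun y => ∑ i, F i y) = ∑ i, J m (F i) := by
  unfold J
  rw [← integral_finsetSum _ (fun i _ => integrable_mul_q hm (hF i))]
  simp only [Finset.sum_mul]

lemma J_one_pos {m : ℕ} (hm : m ≠ 0) : 0 < J m (fun _ : E n => 1) := by
  unfold J
  apply Continuous.integral_pos_of_hasCompactSupport_nonneg_nonzero (x := 0)
  · simpa using continuous_q m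
  · simpa using hasCompactSupport_q hm
  · intro y; simpa using q_nonneg m y
  · simpa using (q_pos m (mem_ball_self one_pos)).ne'

lemma J_const (m : ℕ) (c : ℝ) : J m (fun _ : E n => c) = c * J m (fun _ : E n => 1) := by
  rw [← J_const_mul]; simp

lemma J_pos {m : ℕ} (hm : m ≠ 0) {F : E n → ℝ} (hF : Continuous F)
    (h : ∀ y ∈ ball (0 : E n) 1, 0 ≤ F y) (h0 : 0 < F 0) : 0 < J m F := by
  unfold J
  apply Continuous.integral_pos_of_hasCompactSupport_nonneg_nonzero (x := 0)
  · exact hF.mul (continuous_q m)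
  · exact (hasCompactSupport_q hm).mul_left
  · intro y
    by_cases hy : y ∈ ball (0 : E n) 1
    · exact mul_nonneg (h y hy) (q_nonneg _ _)
    · simp [q_eq_zero hm hy]
  · exact (mul_pos h0 (q_pos m (mem_ball_self one_pos))).ne'

/-- Divergence theorem against the weights. -/
lemma J_div {m : ℕ} (hm : 1 ≤ m) (i : Fin n) {G : E n → ℝ} (hG : ContDiff ℝ 1 G) :
    J (m + 1) (pd i G) = 2 * (m + 1) * J m (fun y => G y * y i) := by
  have hq : ContDiff ℝ 1 (q (m + 1) : E n → ℝ) := by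
    have h2 : fderiv ℝ (q (m + 1) : E n → ℝ) = fun y => (-(2 * (m + 1) * q m y)) • innerSL ℝ y :=
      funext fun y => (hasFDerivAt_q m hm y).fderiv
    rw [contDiff_one_iff_fderiv]
    refine ⟨fun y => (hasFDerivAt_q m hm y).differentiableAt, ?_⟩
    rw [h2]
    have := continuous_q (n := n) m
    fun_prop
  have hpd : Continuous (pd i G) := (hG.continuous_fderiv (by norm_num)).clm_apply continuous_const
  have hqc := continuous_q (n := n) m
  have hyi : Continuous fun y : E n => y i := by fun_prop
  have key := integral_mul_fderiv_eq_neg_fderiv_mul_of_integrable (μ := (volume : Measure (E n)))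
    (f := G) (g := q (m + 1)) (v := EuclideanSpace.single i (1 : ℝ))
    (integrable_mul_q (by omega) hpd) ?_ (integrable_mul_q (by omega) hG.continuous)
    (fun x _ => hG.differentiable (by norm_num) x) (fun x _ => hq.differentiable (by norm_num) x)
  · have e : J (m + 1) (pd i G) =
        ∫ x, fderiv ℝ G x (EuclideanSpace.single i 1) * q (m + 1) x := rfl
    rw [e, ← neg_eq_iff_eq_neg.2 key, ← integral_neg, J, ← integral_const_mul]
    congr 1
    ext y
    rw [fderiv_q m hm i y]
    ring
  · have : (fun x => G x * fderiv ℝ (q (m + 1) : E n → ℝ) x (EuclideanSpace.single i 1)) =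
        fun x => (-(2 * (m + 1)) * (G x * x i)) * q m x := by
      ext y; rw [fderiv_q m hm i y]; ring
    rw [this]
    refine integrable_mul_q (by omega) ?_
    have := hG.continuous
    fun_prop

end

/-! ### Calculus of the Laplacian and of weighted averages -/

section

lemma contDiff_pd {f : E n → ℝ} (hf : ContDiff ℝ ∞ f) (i : Fin n) : ContDiff ℝ ∞ (pd i f) := by
  unfold pd
  exact (hf.fderiv_right (m := ∞) (by simp)).clm_apply contDiff_const

lemma lap_eq {f : E n → ℝ} (x : E n) (hf : ContDiffAt ℝ 2 f x) :
    lap f x = ∑ i, pd i (pd i f) x := by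
  unfold lap
  refine Finset.sum_congr rfl fun i _ => ?_
  rw [iteratedFDeriv_two_apply]
  have : DifferentiableAt ℝ (fderiv ℝ f) x :=
    (hf.fderiv_right (m := 1) (by norm_num)).differentiableAt (by norm_num)
  unfold pd
  rw [fderiv_clm_apply this (by fun_prop)]
  simp

lemma two_le_infty : (2 : WithTop ℕ∞) ≤ ∞ := WithTop.coe_le_coe.2 le_top

lemma lap_eq' {f : E n → ℝ} (hf : ContDiff ℝ ∞ f) (x : E n) :
    lap f x = ∑ i, pd i (pd i f) x :=
  lap_eq x (hf.of_le two_le_infty).contDiffAt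

lemma contDiff_lap {f : E n → ℝ} (hf : ContDiff ℝ ∞ f) : ContDiff ℝ ∞ (lap f) := by
  rw [show lap f = fun x => ∑ i, pd i (pd i f) x from funext (lap_eq' hf)]
  exact ContDiff.sum fun i _ => contDiff_pd (contDiff_pd hf i) i

lemma diff_of_smooth {f : E n → ℝ} (hf : ContDiff ℝ ∞ f) : Differentiable ℝ f :=
  hf.differentiable (by simp)

lemma sum_smul_single (w : E n) : ∑ i, w i • EuclideanSpace.single i (1 : ℝ) = w := by
  ext j
  simp [Finset.sum_apply, Pi.single_apply]

lemma fderiv_eq_sum (f : E n → ℝ) (x w : E n) : fderiv ℝ f x w = ∑ i, w i * pd i f x := by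
  conv_lhs => rw [← sum_smul_single w]
  simp [pd]

lemma pd_add {f g : E n → ℝ} {x : E n} (i : Fin n) (hf : DifferentiableAt ℝ f x)
    (hg : DifferentiableAt ℝ g x) : pd i (fun y => f y + g y) x = pd i f x + pd i g x := by
  unfold pd; rw [fderiv_fun_add hf hg]; rfl

lemma pd_mul {f g : E n → ℝ} {x : E n} (i : Fin n) (hf : DifferentiableAt ℝ f x)
    (hg : DifferentiableAt ℝ g x) :
    pd i (fun y => f y * g y) x = pd i f x * g x + f x * pd i g x := by
  unfold pd; rw [fderiv_fun_mul hf hg]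
  simp only [add_apply, smul_apply, smul_eq_mul]
  ring

lemma pd_const_mul {f : E n → ℝ} {x : E n} (i : Fin n) (c : ℝ) (hf : DifferentiableAt ℝ f x) :
    pd i (fun y => c * f y) x = c * pd i f x := by
  unfold pd; rw [fderiv_const_mul hf]; rfl

lemma pd_sum {ι : Type*} (s : Finset ι) {f : ι → E n → ℝ} {x : E n} (i : Fin n)
    (hf : ∀ j ∈ s, DifferentiableAt ℝ (f j) x) :
    pd i (fun y => ∑ j ∈ s, f j y) x = ∑ j ∈ s, pd i (f j) x := by
  unfold pd; rw [fderiv_fun_sum hf]; simp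

lemma pd_affine {f : E n → ℝ} (hf : Differentiable ℝ f) (i : Fin n) (x : E n) (r : ℝ) (y : E n) :
    pd i (fun y => f (x + r • y)) y = r * pd i f (x + r • y) := by
  unfold pd
  have h1 : HasFDerivAt (fun y : E n => x + r • y) (r • ContinuousLinearMap.id ℝ (E n)) y :=
    ((hasFDerivAt_id y).const_smul r).const_add x
  have := (hf (x + r • y)).hasFDerivAt.comp y h1
  rw [show (fun y => f (x + r • y)) = f ∘ fun y => x + r • y from rfl, this.fderiv]
  simp

lemma contDiff_affine {f : E n → ℝ} {k : WithTop ℕ∞} (hf : ContDiff ℝ k f) (c : ℝ) (x : E n) (r : ℝ) :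
    ContDiff ℝ k (fun y => c * f (x + r • y)) :=
  contDiff_const.mul (hf.comp (contDiff_const.add (contDiff_id.const_smul r)))

lemma contDiff_affine' {f : E n → ℝ} {k : WithTop ℕ∞} (hf : ContDiff ℝ k f) (x : E n) (r : ℝ) :
    ContDiff ℝ k (fun y => f (x + r • y)) :=
  (hf.comp (contDiff_const.add (contDiff_id.const_smul r)))

lemma pd_affine' {f : E n → ℝ} (hf : Differentiable ℝ f) (i : Fin n) (c : ℝ) (x : E n) (r : ℝ) :
    pd i (fun y => c * f (x + r • y)) = fun y => (c * r) * pd i f (x + r • y) := by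
  ext y
  rw [pd_const_mul, pd_affine hf]
  · ring
  · fun_prop

lemma lap_affine {f : E n → ℝ} (hf : ContDiff ℝ ∞ f) (c : ℝ) (x : E n) (r : ℝ) (y : E n) :
    lap (fun y => c * f (x + r • y)) y = c * r ^ 2 * lap f (x + r • y) := by
  rw [lap_eq' (contDiff_affine hf c x r), lap_eq' hf, Finset.mul_sum]
  refine Finset.sum_congr rfl fun i _ => ?_
  rw [pd_affine' (diff_of_smooth hf), pd_affine' (diff_of_smooth (contDiff_pd hf i))]
  ring

lemma lap_add {f g : E n → ℝ} (hf : ContDiff ℝ ∞ f) (hg : ContDiff ℝ ∞ g) (x : E n) :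
    lap (fun y => f y + g y) x = lap f x + lap g x := by
  rw [lap_eq' (hf.add hg), lap_eq' hf, lap_eq' hg, ← Finset.sum_add_distrib]
  refine Finset.sum_congr rfl fun i _ => ?_
  rw [show pd i (fun y => f y + g y) = fun y => pd i f y + pd i g y from
    funext fun y => pd_add i (diff_of_smooth hf y) (diff_of_smooth hg y)]
  exact pd_add i (diff_of_smooth (contDiff_pd hf i) x) (diff_of_smooth (contDiff_pd hg i) x)

lemma lap_const_mul {f : E n → ℝ} (hf : ContDiff ℝ ∞ f) (c : ℝ) (x : E n) :
    lap (fun y => c * f y) x = c * lap f x := by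
  simpa using lap_affine hf c 0 1 x

lemma lap_sub {f g : E n → ℝ} (hf : ContDiff ℝ ∞ f) (hg : ContDiff ℝ ∞ g) (x : E n) :
    lap (fun y => f y - g y) x = lap f x - lap g x := by
  have := lap_add hf (contDiff_const.mul hg : ContDiff ℝ ∞ fun y => (-1 : ℝ) * g y) x
  rw [lap_const_mul hg] at this
  simpa [sub_eq_add_neg] using this

/-- The squared length of the gradient. -/
def gs (f : E n → ℝ) (x : E n) : ℝ := ∑ i, pd i f x ^ 2

lemma gs_nonneg (f : E n → ℝ) (x : E n) : 0 ≤ gs f x := Finset.sum_nonneg fun _ _ => sq_nonneg _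

lemma contDiff_gs {f : E n → ℝ} (hf : ContDiff ℝ ∞ f) : ContDiff ℝ ∞ (gs f) :=
  ContDiff.sum fun i _ => (contDiff_pd hf i).pow 2

lemma pd_sq {f : E n → ℝ} {x : E n} (i : Fin n) (hf : DifferentiableAt ℝ f x) :
    pd i (fun y => f y ^ 2) x = 2 * f x * pd i f x := by
  simp only [sq]
  rw [pd_mul i hf hf]; ring

lemma lap_mul {f g : E n → ℝ} (hf : ContDiff ℝ ∞ f) (hg : ContDiff ℝ ∞ g) (x : E n) :
    lap (fun y => f y * g y) x = lap f x * g x + f x * lap g x + 2 * ∑ i, pd i f x * pd i g x := by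
  rw [lap_eq' (hf.mul hg), lap_eq' hf, lap_eq' hg, Finset.sum_mul, Finset.mul_sum, Finset.mul_sum,
    ← Finset.sum_add_distrib, ← Finset.sum_add_distrib]
  refine Finset.sum_congr rfl fun i _ => ?_
  have df := diff_of_smooth hf
  have dg := diff_of_smooth hg
  have dpf := diff_of_smooth (contDiff_pd hf i)
  have dpg := diff_of_smooth (contDiff_pd hg i)
  rw [show pd i (fun y => f y * g y) = fun y => pd i f y * g y + f y * pd i g y from
    funext fun y => pd_mul i (df y) (dg y)]
  rw [pd_add i ((dpf x).fun_mul (dg x)) ((df x).fun_mul (dpg x)), pd_mul i (dpf x) (dg x),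
    pd_mul i (df x) (dpg x)]
  ring

lemma lap_sq {f : E n → ℝ} (hf : ContDiff ℝ ∞ f) (x : E n) :
    lap (fun y => f y ^ 2) x = 2 * (gs f x + f x * lap f x) := by
  simp only [sq]
  rw [lap_mul hf hf]
  simp only [gs, sq]
  ring

lemma pd_comm {f : E n → ℝ} (hf : ContDiff ℝ ∞ f) (i j : Fin n) (x : E n) :
    pd i (pd j f) x = pd j (pd i f) x := by
  have h2 : ContDiffAt ℝ 2 f x := (hf.of_le two_le_infty).contDiffAt
  have hsymm := h2.isSymmSndFDerivAt (by simp)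
  have : DifferentiableAt ℝ (fderiv ℝ f) x :=
    (h2.fderiv_right (m := 1) (by norm_num)).differentiableAt (by norm_num)
  have e : ∀ i j : Fin n, pd i (pd j f) x =
      fderiv ℝ (fderiv ℝ f) x (EuclideanSpace.single i 1) (EuclideanSpace.single j 1) := by
    intro i j
    unfold pd
    rw [fderiv_clm_apply this (by fun_prop)]
    simp
  rw [e, e]
  exact hsymm _ _

lemma lap_pd {f : E n → ℝ} (hf : ContDiff ℝ ∞ f) (i : Fin n) (x : E n) :
    lap (pd i f) x = pd i (lap f) x := by
  rw [lap_eq' (contDiff_pd hf i), show lap f = fun x => ∑ i, pd i (pd i f) x from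
    funext (lap_eq' hf), pd_sum _ _ fun j _ => diff_of_smooth (contDiff_pd (contDiff_pd hf j) j) x]
  refine Finset.sum_congr rfl fun j _ => ?_
  rw [pd_comm (contDiff_pd hf j) i j, show pd j (pd i f) = pd i (pd j f) from
    funext fun y => pd_comm hf j i y]

lemma continuous_affine {f : E n → ℝ} (hf : Continuous f) (x : E n) (r : ℝ) :
    Continuous fun y => f (x + r • y) := hf.comp (by fun_prop)

lemma hasDerivAt_J_mul {m : ℕ} (hm : m ≠ 0) {f g : E n → ℝ} (hf : ContDiff ℝ 1 f)
    (hg : Continuous g) (x : E n) (r : ℝ) :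
    HasDerivAt (fun r => J m (fun y => f (x + r • y) * g y))
      (J m (fun y => fderiv ℝ f (x + r • y) y * g y)) r := by
  have hfd : Continuous (fderiv ℝ f) := hf.continuous_fderiv (by norm_num)
  obtain ⟨C, hC⟩ := (isCompact_closedBall x (|r| + 1)).exists_bound_of_continuousOn hfd.continuousOn
  unfold J
  have hc : ∀ r : ℝ, Continuous fun y : E n => fderiv ℝ f (x + r • y) y * g y := fun r =>
    ((hfd.comp (by fun_prop : Continuous fun y : E n => x + r • y)).clm_apply continuous_id).mul hg
  have hc' : ∀ r : ℝ, Continuous fun y : E n => f (x + r • y) * g y := fun r =>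
    (continuous_affine hf.continuous x r).mul hg
  refine (hasDerivAt_integral_of_dominated_loc_of_deriv_le (s := ball r 1) (ball_mem_nhds r one_pos)
    (bound := fun y => (|C| * |g y|) * q m y)
    (F' := fun r y => fderiv ℝ f (x + r • y) y * g y * q m y) ?_ ?_ ?_ ?_ ?_ ?_).2
  · exact Eventually.of_forall fun r => (integrable_mul_q hm (hc' r)).aestronglyMeasurable
  · exact integrable_mul_q hm (hc' r)
  · exact (integrable_mul_q hm (hc r)).aestronglyMeasurable
  · refine Eventually.of_forall fun y s hs => ?_
    by_cases hy : y ∈ ball (0 : E n) 1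
    · rw [norm_mul, norm_mul, Real.norm_of_nonneg (q_nonneg m y), Real.norm_eq_abs (g y)]
      have hy1 : ‖y‖ < 1 := by simpa using hy
      have hs1 : |s| < |r| + 1 := by
        have : |s - r| < 1 := by simpa [Real.dist_eq] using hs
        have := abs_sub_abs_le_abs_sub s r
        linarith
      have hin : x + s • y ∈ closedBall x (|r| + 1) := by
        rw [mem_closedBall, dist_eq_norm, add_sub_cancel_left, norm_smul, Real.norm_eq_abs]
        nlinarith [norm_nonneg y, abs_nonneg s]
      have h1 : ‖fderiv ℝ f (x + s • y) y‖ ≤ |C| := calc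
        ‖fderiv ℝ f (x + s • y) y‖ ≤ ‖fderiv ℝ f (x + s • y)‖ * ‖y‖ :=
            ContinuousLinearMap.le_opNorm _ _
        _ ≤ |C| * 1 := by
            have := (hC _ hin).trans (le_abs_self C)
            gcongr
        _ = |C| := mul_one _
      have := q_nonneg m y
      gcongr
    · simp [q_eq_zero hm hy]
  · exact integrable_mul_q (n := n) hm (by fun_prop)
  · refine Eventually.of_forall fun y s _ => ?_
    have h1 : HasDerivAt (fun s : ℝ => x + s • y) y s := by
      simpa using ((hasDerivAt_id s).smul_const y).const_add x
    have := ((hf.differentiable (by norm_num) (x + s • y)).hasFDerivAt.comp_hasDerivAt s h1)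
    exact (this.mul_const _).mul_const _

lemma hasDerivAt_J {m : ℕ} (hm : m ≠ 0) {f : E n → ℝ} (hf : ContDiff ℝ 1 f) (x : E n) (r : ℝ) :
    HasDerivAt (fun r => J m (fun y => f (x + r • y)))
      (J m (fun y => fderiv ℝ f (x + r • y) y)) r := by
  simpa using hasDerivAt_J_mul hm hf (continuous_const (y := (1 : ℝ))) x r

lemma J_div_field {m : ℕ} (hm : 1 ≤ m) {G : Fin n → E n → ℝ} (hG : ∀ i, ContDiff ℝ ∞ (G i))
    (x : E n) (r : ℝ) :
    r * J (m + 1) (fun y => ∑ i, pd i (G i) (x + r • y)) =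
      2 * (m + 1) * J m (fun y => ∑ i, G i (x + r • y) * y i) := by
  have c1 : ∀ i, Continuous fun y => pd i (G i) (x + r • y) := fun i =>
    continuous_affine (contDiff_pd (hG i) i).continuous x r
  have c2 : ∀ i, Continuous fun y : E n => G i (x + r • y) * y i := fun i =>
    (continuous_affine (hG i).continuous x r).mul (by fun_prop)
  rw [J_sum (by omega) c1, J_sum (by omega) c2, Finset.mul_sum, Finset.mul_sum]
  refine Finset.sum_congr rfl fun i _ => ?_
  have := J_div hm i ((contDiff_affine' (hG i) x r).of_le (m := 1) (by exact_mod_cast le_top))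
  rw [← this, ← J_const_mul]
  congr 1
  ext y
  rw [pd_affine (diff_of_smooth (hG i))]

lemma J_fderiv {m : ℕ} (hm : 1 ≤ m) {f : E n → ℝ} (hf : ContDiff ℝ ∞ f) (x : E n) (r : ℝ) :
    J m (fun y => fderiv ℝ f (x + r • y) y) =
      r / (2 * (m + 1)) * J (m + 1) (fun y => lap f (x + r • y)) := by
  have := J_div_field hm (fun i => contDiff_pd hf i) x r
  have e : (fun y => fderiv ℝ f (x + r • y) y) = fun y => ∑ i, pd i f (x + r • y) * y i := by
    ext y; rw [fderiv_eq_sum]; simp only [mul_comm]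
  rw [e, div_mul_eq_mul_div, eq_div_iff (by positivity)]
  simp only [lap_eq' hf]
  linarith

lemma hasDerivAt_J_lap {m : ℕ} (hm : 1 ≤ m) {f : E n → ℝ} (hf : ContDiff ℝ ∞ f) (x : E n) (r : ℝ) :
    HasDerivAt (fun r => J m (fun y => f (x + r • y)))
      (r / (2 * (m + 1)) * J (m + 1) (fun y => lap f (x + r • y))) r := by
  rw [← J_fderiv hm hf]
  exact hasDerivAt_J (by omega) (hf.of_le (by exact_mod_cast le_top)) x r

end

/-! ### Mean value inequalities -/

section

/-- The total mass of the weight `q m`. -/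
def cw (n m : ℕ) : ℝ := J m (fun _ : E n => 1)

lemma cw_pos {m : ℕ} (hm : m ≠ 0) : 0 < cw n m := J_one_pos hm

lemma J_const' (m : ℕ) (c : ℝ) : J m (fun _ : E n => c) = c * cw n m := J_const m c

lemma J_le {m : ℕ} (hm : m ≠ 0) {F : E n → ℝ} (hF : Continuous F) {M : ℝ}
    (h : ∀ y ∈ ball (0 : E n) 1, F y ≤ M) : J m F ≤ M * cw n m := by
  rw [← J_const']
  exact J_mono hm hF continuous_const h

lemma le_J {m : ℕ} (hm : m ≠ 0) {F : E n → ℝ} (hF : Continuous F) {M : ℝ}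
    (h : ∀ y ∈ ball (0 : E n) 1, M ≤ F y) : M * cw n m ≤ J m F := by
  rw [← J_const']
  exact J_mono hm continuous_const hF h

lemma abs_J_le {m : ℕ} (hm : m ≠ 0) {F : E n → ℝ} (hF : Continuous F) {M : ℝ}
    (h : ∀ y ∈ ball (0 : E n) 1, |F y| ≤ M) : |J m F| ≤ M * cw n m := by
  rw [abs_le]
  constructor
  · rw [← neg_mul]
    exact le_J hm hF fun y hy => (abs_le.1 (h y hy)).1
  · exact J_le hm hF fun y hy => (abs_le.1 (h y hy)).2

lemma add_smul_mem_ball {x y : E n} {r R : ℝ} (hr : 0 ≤ r) (hR : 0 < R) (h : r ≤ R)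
    (hy : y ∈ ball (0 : E n) 1) : x + r • y ∈ ball x R := by
  have : ‖y‖ < 1 := by simpa using hy
  rw [mem_ball, dist_eq_norm, add_sub_cancel_left, norm_smul, Real.norm_of_nonneg hr]
  nlinarith [norm_nonneg y]

/-- Mean value inequality, with a lower bound on the averages of the Laplacian. -/
lemma mean_value_gen {m : ℕ} (hm : 1 ≤ m) {f : E n → ℝ} (hf : ContDiff ℝ ∞ f) {x : E n} {R A : ℝ}
    (hR : 0 ≤ R) (h : ∀ r ∈ Ioo 0 R, A ≤ J (m + 1) (fun y => lap f (x + r • y))) :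
    f x * cw n m + A * R ^ 2 / (4 * (m + 1)) ≤ J m (fun y => f (x + R • y)) := by
  have hd : ∀ r, HasDerivAt (fun r => J m (fun y => f (x + r • y)) - A * r ^ 2 / (4 * (m + 1)))
      (r / (2 * (m + 1)) * J (m + 1) (fun y => lap f (x + r • y)) -
        A * (2 * r) / (4 * (m + 1))) r := by
    intro r
    refine (hasDerivAt_J_lap hm hf x r).sub ?_
    have := ((hasDerivAt_pow 2 r).const_mul A).div_const (4 * (m + 1))
    simpa using this
  have hmono : MonotoneOn
      (fun r => J m (fun y => f (x + r • y)) - A * r ^ 2 / (4 * (m + 1))) (Icc 0 R) := by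
    apply monotoneOn_of_deriv_nonneg (convex_Icc _ _)
    · exact fun r _ => (hd r).continuousAt.continuousWithinAt
    · exact fun r _ => (hd r).differentiableAt.differentiableWithinAt
    · intro r hr
      rw [interior_Icc] at hr
      rw [(hd r).deriv]
      have h1 := h r hr
      have : r / (2 * (m + 1)) * J (m + 1) (fun y => lap f (x + r • y)) -
        A * (2 * r) / (4 * (m + 1)) =
        r / (2 * (m + 1)) * (J (m + 1) (fun y => lap f (x + r • y)) - A) := by
        field_simp; ring
      rw [this]
      have := hr.1
      apply mul_nonneg (by positivity) (sub_nonneg.2 h1)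
  have := hmono (left_mem_Icc.2 hR) (right_mem_Icc.2 hR) hR
  simp only [zero_smul, add_zero, J_const'] at this
  simp at this
  linarith

lemma mean_value {m : ℕ} (hm : 1 ≤ m) {f : E n → ℝ} (hf : ContDiff ℝ ∞ f) {x : E n} {R L : ℝ}
    (hR : 0 ≤ R) (h : ∀ z ∈ ball x R, L ≤ lap f z) :
    f x * cw n m + L * cw n (m + 1) * R ^ 2 / (4 * (m + 1)) ≤ J m (fun y => f (x + R • y)) := by
  apply mean_value_gen hm hf hR
  intro r hr
  apply le_J (by omega) (continuous_affine (contDiff_lap hf).continuous x r)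
  exact fun y hy => h _ (add_smul_mem_ball hr.1.le (hr.1.trans hr.2) hr.2.le hy)

lemma mean_value_zero {m : ℕ} (hm : 1 ≤ m) {f : E n → ℝ} (hf : ContDiff ℝ ∞ f) {x : E n} {R : ℝ}
    (hR : 0 ≤ R) (h : ∀ z ∈ ball x R, 0 ≤ lap f z) :
    f x * cw n m ≤ J m (fun y => f (x + R • y)) := by
  simpa using mean_value hm hf hR h

lemma abs_coord_le (y : E n) (i : Fin n) : |y i| ≤ ‖y‖ := by
  simpa using PiLp.norm_apply_le y i

/-- Interior gradient estimate. -/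
lemma gradient_estimate {f : E n → ℝ} (hf : ContDiff ℝ ∞ f) {x : E n} {R M L : ℝ} (hR : 0 < R)
    (hM : ∀ z ∈ ball x R, |f z| ≤ M) (hL : ∀ z ∈ ball x R, |lap f z| ≤ L) (i : Fin n) :
    |pd i f x| * cw n 2 ≤ 4 * M * cw n 1 / R + R * (L * cw n 2) := by
  have hpd := contDiff_pd hf i
  have hlap := contDiff_lap hf
  have hd : ∀ r : ℝ, 0 < r → HasDerivAt (fun r : ℝ => J 2 (fun y => pd i f (x + r • y)))
      (J 2 (fun y => lap f (x + r • y) * y i)) r := by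
    intro r hr
    have h1 := hasDerivAt_J_lap (m := 2) (by norm_num) hpd x r
    have h2 := J_div (m := 2) (by norm_num) i
      ((contDiff_affine' hlap x r).of_le (m := 1) (by exact_mod_cast le_top))
    rw [show pd i (fun y => lap f (x + r • y)) = fun y => r * pd i (lap f) (x + r • y) from
      funext fun y => pd_affine (diff_of_smooth hlap) i x r y, J_const_mul] at h2
    convert h1 using 1
    simp only [lap_pd hf]
    push_cast at h2 ⊢
    linarith
  have hcont : Continuous fun r => J 2 (fun y => pd i f (x + r • y)) :=
    continuous_iff_continuousAt.2 fun r => (hasDerivAt_J_lap (m := 2) (by norm_num) hpd x r).continuousAt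
  have hbound : ∀ r ∈ Ioo 0 R, |J 2 (fun y => lap f (x + r • y) * y i)| ≤ L * cw n 2 := by
    intro r hr
    apply abs_J_le (by norm_num)
      ((continuous_affine hlap.continuous x r).fun_mul (by fun_prop))
    intro y hy
    have hy1 : ‖y‖ < 1 := by simpa using hy
    rw [abs_mul]
    have h1 := hL _ (add_smul_mem_ball hr.1.le (hr.1.trans hr.2) hr.2.le hy)
    have h2 := (abs_coord_le y i).trans hy1.le
    have h3 := abs_nonneg (lap f (x + r • y))
    have h4 := abs_nonneg (y i)
    nlinarith
  obtain ⟨s, hs, hs'⟩ := exists_hasDerivAt_eq_slope (fun r => J 2 (fun y => pd i f (x + r • y)))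
    (fun r => J 2 (fun y => lap f (x + r • y) * y i)) hR hcont.continuousOn
    (fun r hr => hd r hr.1)
  have h0 := hbound s hs
  rw [hs'] at h0
  simp only [zero_smul, add_zero, J_const', sub_zero] at h0
  have h3 := J_div (m := 1) le_rfl i
      ((contDiff_affine' hf x R).of_le (m := 1) (by exact_mod_cast le_top))
  rw [show pd i (fun y => f (x + R • y)) = fun y => R * pd i f (x + R • y) from
      funext fun y => pd_affine (diff_of_smooth hf) i x R y, J_const_mul] at h3
  have h4 : |J 1 (fun y => f (x + R • y) * y i)| ≤ M * cw n 1 := by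
    apply abs_J_le (by norm_num)
      ((continuous_affine hf.continuous x R).fun_mul (by fun_prop))
    intro y hy
    have hy1 : ‖y‖ < 1 := by simpa using hy
    rw [abs_mul]
    have h1 := hM _ (add_smul_mem_ball hR.le hR le_rfl hy)
    have h2 := (abs_coord_le y i).trans hy1.le
    have h3 := abs_nonneg (f (x + R • y))
    have h4 := abs_nonneg (y i)
    nlinarith
  have h5 : |J 2 (fun y => pd i f (x + R • y))| ≤ 4 * M * cw n 1 / R := by
    rw [le_div_iff₀ hR]
    rw [show (1 : ℕ) + 1 = 2 from rfl] at h3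
    have : |J 2 (fun y => pd i f (x + R • y))| * R = |R * J 2 (fun y => pd i f (x + R • y))| := by
      rw [abs_mul, abs_of_pos hR, mul_comm]
    rw [this, h3, abs_mul]
    norm_num
    linarith
  have h6 : |J 2 (fun y => pd i f (x + R • y)) - pd i f x * cw n 2| ≤ R * (L * cw n 2) := by
    rw [abs_div, abs_of_pos hR, div_le_iff₀ hR] at h0
    linarith
  have h7 := abs_sub_abs_le_abs_sub (pd i f x * cw n 2) (J 2 (fun y => pd i f (x + R • y)))
  rw [abs_sub_comm, abs_mul, abs_of_pos (cw_pos (n := n) (m := 2) two_ne_zero)] at h7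
  linarith

/-- Interior Lipschitz estimate in terms of sup bounds for `f` and its Laplacian. -/
lemma lipschitz_estimate (n : ℕ) : ∃ C : ℝ, 0 < C ∧ ∀ (f : E n → ℝ), ContDiff ℝ ∞ f →
    ∀ (x : E n) (R M L : ℝ), 0 < R → (∀ z ∈ ball x R, |f z| ≤ M) →
    (∀ z ∈ ball x R, |lap f z| ≤ L) → ∀ y ∈ ball x (R / 2), ∀ z ∈ ball x (R / 2),
      |f y - f z| ≤ C * (M / R + R * L) * ‖y - z‖ := by
  have c1 := cw_pos (n := n) (m := 1) one_ne_zero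
  have c2 := cw_pos (n := n) (m := 2) two_ne_zero
  refine ⟨(n + 1) * (8 * cw n 1 / cw n 2 + 1), by positivity, ?_⟩
  intro f hf x R M L hR hM hL y hy z hz
  have hM0 : 0 ≤ M := (abs_nonneg _).trans (hM x (mem_ball_self hR))
  have hL0 : 0 ≤ L := (abs_nonneg _).trans (hL x (mem_ball_self hR))
  have hb : ∀ w ∈ ball x (R / 2),
      ‖fderiv ℝ f w‖ ≤ (n + 1) * (8 * cw n 1 / cw n 2 + 1) * (M / R + R * L) := by
    intro w hw
    have hsub : ball w (R / 2) ⊆ ball x R := by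
      apply ball_subset_ball'
      have := mem_ball.1 hw
      linarith
    have hpd : ∀ i, |pd i f w| ≤ (8 * cw n 1 / cw n 2 + 1) * (M / R + R * L) := by
      intro i
      have := gradient_estimate hf (half_pos hR) (fun z hz => hM z (hsub hz))
        (fun z hz => hL z (hsub hz)) i
      rw [← le_div_iff₀ c2] at this
      refine this.trans ?_
      have e : (4 * M * cw n 1 / (R / 2) + R / 2 * (L * cw n 2)) / cw n 2 =
        8 * cw n 1 / cw n 2 * (M / R) + R * L / 2 := by field_simp; ring
      rw [e]
      have h1 : 0 ≤ 8 * cw n 1 / cw n 2 * (R * L) := by positivity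
      have h2 : 0 ≤ R * L := by positivity
      have h3 : 0 ≤ M / R := by positivity
      nlinarith
    apply ContinuousLinearMap.opNorm_le_bound _ (by positivity)
    intro v
    rw [fderiv_eq_sum, Real.norm_eq_abs]
    calc |∑ i, v i * pd i f w| ≤ ∑ i, |v i * pd i f w| := Finset.abs_sum_le_sum_abs _ _
      _ ≤ ∑ i : Fin n, ‖v‖ * ((8 * cw n 1 / cw n 2 + 1) * (M / R + R * L)) := by
          apply Finset.sum_le_sum
          intro i _
          rw [abs_mul]
          exact mul_le_mul (abs_coord_le v i) (hpd i) (abs_nonneg _) (norm_nonneg _)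
      _ = n * (8 * cw n 1 / cw n 2 + 1) * (M / R + R * L) * ‖v‖ := by
          simp; ring
      _ ≤ (n + 1) * (8 * cw n 1 / cw n 2 + 1) * (M / R + R * L) * ‖v‖ := by
          gcongr; linarith
  have := (convex_ball x (R / 2)).norm_image_sub_le_of_norm_fderiv_le (𝕜 := ℝ)
    (fun w _ => diff_of_smooth hf w) hb hz hy
  simpa using this

/-- Decay of subsolutions of `Δ v = K v`. -/
lemma decay_estimate (n : ℕ) : ∃ C : ℝ, 0 < C ∧ ∀ (v : E n → ℝ), ContDiff ℝ ∞ v →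
    ∀ (x : E n) (R M K : ℝ), 0 < R → 0 < K → (∀ z ∈ ball x R, 0 ≤ v z) → (∀ z ∈ ball x R, v z ≤ M) →
    (∀ z ∈ ball x R, K * v z ≤ lap v z) → v x ≤ C * M / (K * R ^ 2) := by
  have c2 := cw_pos (n := n) (m := 2) two_ne_zero
  have c3 := cw_pos (n := n) (m := 3) three_ne_zero
  refine ⟨12 * cw n 2 / cw n 3, by positivity, ?_⟩
  intro v hv x R M K hR hK h0 hM hl
  have h1 := mean_value_gen (m := 2) (A := K * (v x * cw n 3)) (by norm_num) hv hR.le (x := x) ?_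
  · have h2 : J 2 (fun y => v (x + R • y)) ≤ M * cw n 2 :=
      J_le two_ne_zero (continuous_affine hv.continuous x R) fun y hy =>
        hM _ (add_smul_mem_ball hR.le hR le_rfl hy)
    have h3 : 0 ≤ v x * cw n 2 := mul_nonneg (h0 x (mem_ball_self hR)) c2.le
    rw [div_mul_eq_mul_div, div_div, le_div_iff₀ (by positivity)]
    norm_num at h1
    nlinarith
  · intro r hr
    have h2 : v x * cw n 3 ≤ J 3 (fun y => v (x + r • y)) := by
      apply mean_value_zero (by norm_num) hv hr.1.le
      intro z hz
      have hz' := ball_subset_ball hr.2.le hz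
      exact (mul_nonneg hK.le (h0 z hz')).trans (hl z hz')
    calc K * (v x * cw n 3) ≤ K * J 3 (fun y => v (x + r • y)) := by gcongr
      _ = J 3 (fun y => K * v (x + r • y)) := (J_const_mul _ _ _).symm
      _ ≤ _ := J_mono three_ne_zero
        (continuous_const.mul (continuous_affine hv.continuous x r))
        (continuous_affine (contDiff_lap hv).continuous x r)
        fun y hy => hl _ (add_smul_mem_ball hr.1.le hR hr.2.le hy)

lemma J_eq_integral (m : ℕ) (F : E n → ℝ) (x : E n) {s : ℝ} (hs : 0 < s) :
    J m (fun y => F (x + s • y)) = (s ^ n)⁻¹ * ∫ w, F w * q m (s⁻¹ • (w - x)) := by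
  have h1 := Measure.integral_comp_smul (volume : Measure (E n))
    (fun w => F (x + w) * q m (s⁻¹ • w)) s
  simp only [smul_smul, inv_mul_cancel₀ hs.ne', one_smul] at h1
  unfold J
  rw [h1, finrank_euclideanSpace_fin, abs_of_pos (by positivity), smul_eq_mul]
  congr 1
  have := integral_add_left_eq_self (μ := (volume : Measure (E n)))
    (fun w => F w * q m (s⁻¹ • (w - x))) x
  rw [← this]
  simp

/-- Comparison of weighted averages over nested balls. -/
lemma J_comp {m : ℕ} (hm : m ≠ 0) {F : E n → ℝ} (hF : Continuous F) {x z : E n} {r s : ℝ}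
    (hr : 0 < r) (hs : 0 < s) (hF0 : ∀ w ∈ ball x s, 0 ≤ F w) (h : dist z x + r ≤ 3 / 4 * s) :
    J m (fun y => F (z + r • y)) ≤
      (s / r) ^ n * (16 / 7) ^ m * J m (fun y => F (x + s • y)) := by
  rw [J_eq_integral m F z hr, J_eq_integral m F x hs]
  have key : ∫ w, F w * q m (r⁻¹ • (w - z)) ≤
      (16 / 7) ^ m * ∫ w, F w * q m (s⁻¹ • (w - x)) := by
    rw [← integral_const_mul]
    have hI : ∀ (z : E n) {r : ℝ}, 0 < r → Integrable fun w => F w * q m (r⁻¹ • (w - z)) := by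
      intro z r hr
      apply Continuous.integrable_of_hasCompactSupport
      · exact hF.mul ((continuous_q m).comp (by fun_prop))
      · apply HasCompactSupport.intro (isCompact_closedBall z r)
        intro w hw
        rw [q_eq_zero hm, mul_zero]
        intro h
        apply hw
        rw [mem_ball_zero_iff, norm_smul, norm_inv, Real.norm_of_nonneg hr.le,
          inv_mul_lt_iff₀ hr, mul_one] at h
        rw [mem_closedBall, dist_eq_norm]
        exact h.le
    apply integral_mono (hI z hr) ((hI x hs).const_mul _)
    intro w
    by_cases hw : r⁻¹ • (w - z) ∈ ball (0 : E n) 1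
    · rw [mem_ball_zero_iff, norm_smul, norm_inv, Real.norm_of_nonneg hr.le,
          inv_mul_lt_iff₀ hr, mul_one] at hw
      have hd : dist w x < 3 / 4 * s := by
        calc dist w x ≤ dist w z + dist z x := dist_triangle _ _ _
          _ < 3 / 4 * s := by rw [dist_eq_norm w z]; linarith
      have hwF : 0 ≤ F w := hF0 w (by rw [mem_ball]; linarith)
      have hn : ‖s⁻¹ • (w - x)‖ ≤ 3 / 4 := by
        rw [norm_smul, norm_inv, Real.norm_of_nonneg hs.le, inv_mul_le_iff₀ hs, ← dist_eq_norm]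
        linarith
      have h1 : 1 ≤ (16 / 7) ^ m * q m (s⁻¹ • (w - x)) := by
        unfold q
        rw [← mul_pow]
        apply one_le_pow₀
        have : 7 / 16 ≤ 1 - ‖s⁻¹ • (w - x)‖ ^ 2 := by nlinarith [norm_nonneg (s⁻¹ • (w - x))]
        have := this.trans (le_max_left _ 0)
        linarith
      have h2 := q_le_one m (r⁻¹ • (w - z))
      calc F w * q m (r⁻¹ • (w - z)) ≤ F w * 1 := by gcongr
        _ ≤ F w * ((16 / 7) ^ m * q m (s⁻¹ • (w - x))) := by gcongr
        _ = _ := by ring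
    · simp only [q_eq_zero hm hw, mul_zero]
      by_cases hw' : s⁻¹ • (w - x) ∈ ball (0 : E n) 1
      · have : w ∈ ball x s := by
          rw [mem_ball_zero_iff, norm_smul, norm_inv, Real.norm_of_nonneg hs.le,
            inv_mul_lt_iff₀ hs, mul_one] at hw'
          rwa [mem_ball, dist_eq_norm]
        have h1 := hF0 w this
        have h2 := q_nonneg m (s⁻¹ • (w - x))
        positivity
      · simp [q_eq_zero hm hw']
  calc (r ^ n)⁻¹ * ∫ w, F w * q m (r⁻¹ • (w - z)) ≤
      (r ^ n)⁻¹ * ((16 / 7) ^ m * ∫ w, F w * q m (s⁻¹ • (w - x))) := by gcongr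
    _ = _ := by
      rw [div_pow s r]
      have : (s ^ n) ≠ 0 := by positivity
      generalize (∫ w, F w * q m (s⁻¹ • (w - x))) = I
      field_simp

/-- Local boundedness of nonnegative subharmonic functions. -/
lemma sup_estimate (n : ℕ) : ∃ C : ℝ, 0 < C ∧ ∀ (u : E n → ℝ), ContDiff ℝ ∞ u →
    ∀ (x : E n) (R : ℝ), 0 < R → (∀ z ∈ ball x R, 0 ≤ u z) → (∀ z ∈ ball x R, 0 ≤ lap u z) →
    ∀ z ∈ closedBall x (R / 2), u z ^ 2 ≤ C * J 2 (fun y => u (x + R • y) ^ 2) := by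
  have c2 := cw_pos (n := n) (m := 2) two_ne_zero
  refine ⟨4 ^ n * (16 / 7) ^ 2 / cw n 2, by positivity, ?_⟩
  intro u hu x R hR h0 hl z hz
  have hz' : dist z x ≤ R / 2 := hz
  have hsub : ball z (R / 4) ⊆ ball x R := by
    apply ball_subset_ball'; linarith
  have h1 := mean_value_zero (m := 2) (by norm_num) (hu.pow 2) (x := z) (R := R / 4)
    (by positivity) (fun w hw => by
      rw [lap_sq hu]
      have := mul_nonneg (h0 w (hsub hw)) (hl w (hsub hw))
      have := gs_nonneg u w
      linarith)
  have h2 := J_comp (m := 2) two_ne_zero (hu.pow 2).continuous (x := x) (z := z) (r := R / 4)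
    (s := R) (by positivity) hR (fun w _ => sq_nonneg _) (by linarith)
  have e : R / (R / 4) = 4 := by field_simp
  rw [e] at h2
  rw [div_mul_eq_mul_div, le_div_iff₀ c2]
  exact h1.trans h2

end

/-! ### Solutions and the Almgren quantities -/

section

/-- `(u, v)` is a smooth positive solution of the system with parameter `κ` on `ball x R`
(both functions being globally smooth). -/
structure Sol (κ : ℝ) (u v : E n → ℝ) (x : E n) (R : ℝ) : Prop where
  hu : ContDiff ℝ ∞ u
  hv : ContDiff ℝ ∞ v
  hκ : 0 < κ
  u_pos : ∀ z ∈ ball x R, 0 < u z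
  v_pos : ∀ z ∈ ball x R, 0 < v z
  lap_u : ∀ z ∈ ball x R, lap u z = κ * (u z * v z ^ 2)
  lap_v : ∀ z ∈ ball x R, lap v z = κ * (v z * u z ^ 2)

variable {κ R : ℝ} {u v : E n → ℝ} {x : E n}

lemma Sol.symm (S : Sol κ u v x R) : Sol κ v u x R :=
  ⟨S.hv, S.hu, S.hκ, S.v_pos, S.u_pos, S.lap_v, S.lap_u⟩

lemma Sol.mono (S : Sol κ u v x R) {z : E n} {s : ℝ} (h : ball z s ⊆ ball x R) : Sol κ u v z s :=
  ⟨S.hu, S.hv, S.hκ, fun w hw => S.u_pos w (h hw), fun w hw => S.v_pos w (h hw),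
    fun w hw => S.lap_u w (h hw), fun w hw => S.lap_v w (h hw)⟩

lemma Sol.affine (S : Sol κ u v x R) {c r : ℝ} (hc : 0 < c) (hr : 0 < r) {z w : E n} {s : ℝ}
    (h : dist (z + r • w) x + r * s ≤ R) :
    Sol (κ * r ^ 2 / c ^ 2) (fun y => c * u (z + r • y)) (fun y => c * v (z + r • y)) w s := by
  have hm : ∀ y ∈ ball w s, z + r • y ∈ ball x R := by
    intro y hy
    rw [mem_ball] at hy ⊢
    have h1 : dist (z + r • y) (z + r • w) = r * dist y w := by
      rw [dist_add_left, dist_smul₀, Real.norm_of_nonneg hr.le]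
    have := dist_triangle (z + r • y) (z + r • w) x
    nlinarith
  refine ⟨contDiff_affine S.hu _ _ _, contDiff_affine S.hv _ _ _, ?_, ?_, ?_, ?_, ?_⟩
  · have := S.hκ; positivity
  · exact fun y hy => mul_pos hc (S.u_pos _ (hm y hy))
  · exact fun y hy => mul_pos hc (S.v_pos _ (hm y hy))
  · intro y hy
    rw [lap_affine S.hu, S.lap_u _ (hm y hy)]
    field_simp
  · intro y hy
    rw [lap_affine S.hv, S.lap_v _ (hm y hy)]
    field_simp

lemma Sol.lap_u_nonneg (S : Sol κ u v x R) : ∀ z ∈ ball x R, 0 ≤ lap u z := by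
  intro z hz
  rw [S.lap_u z hz]
  have := S.hκ
  have := S.u_pos z hz
  positivity

/-- Weighted `L²` average of `(u, v)` at scale `r`. -/
def H (u v : E n → ℝ) (x : E n) (r : ℝ) : ℝ :=
  6 * J 2 (fun y => u (x + r • y) ^ 2 + v (x + r • y) ^ 2)

/-- Weighted energy of `(u, v)` at scale `r`. -/
def D (κ : ℝ) (u v : E n → ℝ) (x : E n) (r : ℝ) : ℝ :=
  r ^ 2 * J 3 (fun y => gs u (x + r • y) + gs v (x + r • y) +
    κ * (u (x + r • y) ^ 2 * v (x + r • y) ^ 2))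

/-- Weighted interaction energy of `(u, v)` at scale `r`. -/
def P (κ : ℝ) (u v : E n → ℝ) (x : E n) (r : ℝ) : ℝ :=
  r ^ 2 * J 3 (fun y => κ * (u (x + r • y) ^ 2 * v (x + r • y) ^ 2))

/-- Weighted radial energy of `(u, v)` at scale `r`. -/
def B (u v : E n → ℝ) (x : E n) (r : ℝ) : ℝ :=
  6 * r ^ 2 * J 2 (fun y => fderiv ℝ u (x + r • y) y ^ 2 + fderiv ℝ v (x + r • y) y ^ 2)

lemma H_affine (c : ℝ) (z w : E n) (ρ r : ℝ) :
    H (fun y => c * u (z + ρ • y)) (fun y => c * v (z + ρ • y)) w r =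
      c ^ 2 * H u v (z + ρ • w) (ρ * r) := by
  unfold H
  rw [mul_left_comm (c ^ 2), ← J_const_mul 2 (c ^ 2)]
  congr 2
  ext y
  simp only [smul_add, smul_smul, add_assoc]
  ring

lemma gs_affine {f : E n → ℝ} (hf : ContDiff ℝ ∞ f) (c : ℝ) (x : E n) (r : ℝ) (y : E n) :
    gs (fun y => c * f (x + r • y)) y = c ^ 2 * r ^ 2 * gs f (x + r • y) := by
  unfold gs
  rw [Finset.mul_sum]
  refine Finset.sum_congr rfl fun i _ => ?_
  rw [pd_affine' (diff_of_smooth hf)]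
  ring

lemma D_affine (hu : ContDiff ℝ ∞ u) (hv : ContDiff ℝ ∞ v) (κ : ℝ) {c : ℝ} (hc : c ≠ 0)
    (z w : E n) (ρ r : ℝ) :
    D (κ * ρ ^ 2 / c ^ 2) (fun y => c * u (z + ρ • y)) (fun y => c * v (z + ρ • y)) w r =
      c ^ 2 * D κ u v (z + ρ • w) (ρ * r) := by
  unfold D
  rw [← J_const_mul, ← J_const_mul, ← J_const_mul]
  congr 1
  ext y
  rw [gs_affine hu, gs_affine hv]
  simp only [smul_add, smul_smul, add_assoc]
  field_simp

lemma Sol.hasDerivAt_H (S : Sol κ u v x R) {r : ℝ} (hr : 0 < r) (hrR : r ≤ R) :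
    HasDerivAt (H u v x) (2 * (D κ u v x r + P κ u v x r) / r) r := by
  have hu := S.hu
  have hv := S.hv
  have h1 := (hasDerivAt_J_lap (m := 2) (by norm_num) ((hu.pow 2).add (hv.pow 2)) x r).const_mul 6
  have e : J 3 (fun y => lap (fun z => u z ^ 2 + v z ^ 2) (x + r • y)) =
      2 * (J 3 (fun y => gs u (x + r • y) + gs v (x + r • y) +
    κ * (u (x + r • y) ^ 2 * v (x + r • y) ^ 2)) +
      J 3 (fun y => κ * (u (x + r • y) ^ 2 * v (x + r • y) ^ 2))) := by
    have cgu := continuous_affine (contDiff_gs hu).continuous x r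
    have cgv := continuous_affine (contDiff_gs hv).continuous x r
    have cu := continuous_affine hu.continuous x r
    have cv := continuous_affine hv.continuous x r
    rw [← J_add three_ne_zero (by fun_prop) (by fun_prop), ← J_const_mul]
    apply J_congr three_ne_zero
    intro y hy
    have hm := add_smul_mem_ball (x := x) hr.le (hr.trans_le hrR) hrR hy
    rw [lap_add (hu.pow 2) (hv.pow 2), lap_sq hu, lap_sq hv, S.lap_u _ hm, S.lap_v _ hm]
    ring
  refine h1.congr_deriv ?_
  rw [show 2 + 1 = 3 from rfl, e]
  unfold D P
  push_cast
  field_simp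
  ring

lemma Sol.DP_eq (S : Sol κ u v x R) {r : ℝ} (hr : 0 < r) (hrR : r ≤ R) :
    D κ u v x r + P κ u v x r = 6 * r * J 2 (fun y => u (x + r • y) * fderiv ℝ u (x + r • y) y +
      v (x + r • y) * fderiv ℝ v (x + r • y) y) := by
  have hu := S.hu
  have hv := S.hv
  have h1 := S.hasDerivAt_H hr hrR
  have h2 := (hasDerivAt_J (m := 2) (by norm_num) (((hu.pow 2).add (hv.pow 2)).of_le
    (m := 1) (by exact_mod_cast le_top)) x r).const_mul 6
  have h3 := h1.unique h2
  have e : (fun y => fderiv ℝ (fun z => u z ^ 2 + v z ^ 2) (x + r • y) y) =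
      fun y => 2 * (u (x + r • y) * fderiv ℝ u (x + r • y) y +
      v (x + r • y) * fderiv ℝ v (x + r • y) y) := by
    ext y
    rw [fderiv_eq_sum, fderiv_eq_sum, fderiv_eq_sum, Finset.mul_sum, Finset.mul_sum,
      ← Finset.sum_add_distrib, Finset.mul_sum]
    refine Finset.sum_congr rfl fun i _ => ?_
    rw [pd_add i ((diff_of_smooth (hu.pow 2)) _) ((diff_of_smooth (hv.pow 2)) _),
      pd_sq i (diff_of_smooth hu _), pd_sq i (diff_of_smooth hv _)]
    ring
  rw [e, J_const_mul, div_eq_iff hr.ne'] at h3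
  linarith

lemma continuous_fderiv_apply {f : E n → ℝ} (hf : ContDiff ℝ ∞ f) (x : E n) (r : ℝ) :
    Continuous fun y : E n => fderiv ℝ f (x + r • y) y :=
  ((hf.continuous_fderiv (by simp)).comp (by fun_prop : Continuous fun y : E n => x + r • y)).clm_apply
    continuous_id

lemma Sol.quad_nonneg (S : Sol κ u v x R) {r : ℝ} (hr : 0 < r) (hrR : r ≤ R) (t : ℝ) :
    0 ≤ t ^ 2 * H u v x r - 2 * t * (D κ u v x r + P κ u v x r) + B u v x r := by
  have hu := S.hu
  have hv := S.hv
  have cu := continuous_affine hu.continuous x r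
  have cv := continuous_affine hv.continuous x r
  have cgu := continuous_fderiv_apply hu x r
  have cgv := continuous_fderiv_apply hv x r
  have : t ^ 2 * H u v x r - 2 * t * (D κ u v x r + P κ u v x r) + B u v x r =
      6 * J 2 (fun y => (t * u (x + r • y) - r * fderiv ℝ u (x + r • y) y) ^ 2 +
        (t * v (x + r • y) - r * fderiv ℝ v (x + r • y) y) ^ 2) := by
    rw [S.DP_eq hr hrR]
    unfold H B
    have e : (fun y => (t * u (x + r • y) - r * fderiv ℝ u (x + r • y) y) ^ 2 +
        (t * v (x + r • y) - r * fderiv ℝ v (x + r • y) y) ^ 2) =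
        fun y => (t ^ 2 * (u (x + r • y) ^ 2 + v (x + r • y) ^ 2) -
          (2 * t * r) * (u (x + r • y) * fderiv ℝ u (x + r • y) y +
      v (x + r • y) * fderiv ℝ v (x + r • y) y)) +
          r ^ 2 * (fderiv ℝ u (x + r • y) y ^ 2 + fderiv ℝ v (x + r • y) y ^ 2) := by
      ext y; ring
    have e' : J 2 (fun y => (t ^ 2 * (u (x + r • y) ^ 2 + v (x + r • y) ^ 2) -
          (2 * t * r) * (u (x + r • y) * fderiv ℝ u (x + r • y) y +
      v (x + r • y) * fderiv ℝ v (x + r • y) y)) +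
          r ^ 2 * (fderiv ℝ u (x + r • y) y ^ 2 + fderiv ℝ v (x + r • y) y ^ 2)) =
        t ^ 2 * J 2 (fun y => u (x + r • y) ^ 2 + v (x + r • y) ^ 2) -
          (2 * t * r) * J 2 (fun y => u (x + r • y) * fderiv ℝ u (x + r • y) y +
      v (x + r • y) * fderiv ℝ v (x + r • y) y) +
          r ^ 2 * J 2 (fun y => fderiv ℝ u (x + r • y) y ^ 2 + fderiv ℝ v (x + r • y) y ^ 2) := by
      rw [← J_const_mul, ← J_const_mul, ← J_const_mul, ← J_sub two_ne_zero (by fun_prop)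
        (by fun_prop), ← J_add two_ne_zero (by fun_prop) (by fun_prop)]
    rw [e, e']
    ring
  rw [this]
  have := J_nonneg (m := 2) two_ne_zero (F := fun y =>
    (t * u (x + r • y) - r * fderiv ℝ u (x + r • y) y) ^ 2 +
        (t * v (x + r • y) - r * fderiv ℝ v (x + r • y) y) ^ 2) (fun y _ => by positivity)
  linarith

lemma Sol.P_nonneg (S : Sol κ u v x R) (r : ℝ) : 0 ≤ P κ u v x r := by
  have := S.hκ
  exact mul_nonneg (sq_nonneg r) (J_nonneg three_ne_zero fun y _ => by positivity)

lemma Sol.P_le_D (S : Sol κ u v x R) (r : ℝ) : P κ u v x r ≤ D κ u v x r := by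
  have cgu := (contDiff_gs S.hu).continuous
  have cgv := (contDiff_gs S.hv).continuous
  have cu := S.hu.continuous
  have cv := S.hv.continuous
  apply mul_le_mul_of_nonneg_left _ (sq_nonneg r)
  apply J_mono three_ne_zero (by fun_prop) (by fun_prop)
  intro y _
  have := gs_nonneg u (x + r • y)
  have := gs_nonneg v (x + r • y)
  linarith

lemma Sol.H_pos (S : Sol κ u v x R) (hR : 0 < R) (r : ℝ) : 0 < H u v x r := by
  have cu := S.hu.continuous
  have cv := S.hv.continuous
  apply mul_pos (by norm_num)
  apply J_pos two_ne_zero (by fun_prop)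
  · intro y _; positivity
  · have := S.u_pos x (mem_ball_self hR)
    simp only [smul_zero, add_zero]
    positivity

lemma Sol.div_identity (S : Sol κ u v x R) {z : E n} (hz : z ∈ ball x R) :
    fderiv ℝ (fun z => gs u z + gs v z + κ * (u z ^ 2 * v z ^ 2)) z (z - x) =
      2 * ∑ j, pd j (fun z => pd j u z * fderiv ℝ u z (z - x) + pd j v z * fderiv ℝ v z (z - x)) z -
        2 * (gs u z + gs v z) := by
  have hu := S.hu
  have hv := S.hv
  have main : ∀ {f : E n → ℝ}, ContDiff ℝ ∞ f →
      ∑ j, pd j (fun z => pd j f z * fderiv ℝ f z (z - x)) z =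
        lap f z * fderiv ℝ f z (z - x) + gs f z +
          ∑ j, ∑ k, pd j f z * ((z - x) k * pd j (pd k f) z) := by
    intro f hf
    have d1 := fun j => diff_of_smooth (contDiff_pd hf j)
    rw [lap_eq' hf, Finset.sum_mul, gs, ← Finset.sum_add_distrib, ← Finset.sum_add_distrib]
    refine Finset.sum_congr rfl fun j _ => ?_
    have d2 : ∀ k : Fin n, Differentiable ℝ fun z : E n => (z - x) k := by
      intro k; simp only [PiLp.sub_apply]; fun_prop
    have d3 : ∀ k j : Fin n, pd j (fun z : E n => (z - x) k) z = if k = j then 1 else 0 := by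
      intro k j
      have : (fun z : E n => (z - x) k) = fun z => (EuclideanSpace.proj k : E n →L[ℝ] ℝ) z - x k := by
        ext z; simp
      unfold pd
      rw [this, fderiv_sub_const, ContinuousLinearMap.fderiv]
      simp
    have e : (fun z => fderiv ℝ f z (z - x)) = fun z => ∑ k, (z - x) k * pd k f z := by
      ext z; rw [fderiv_eq_sum]
    have d4 : Differentiable ℝ (fun z => fderiv ℝ f z (z - x)) := by
      rw [e]
      exact Differentiable.fun_sum fun k _ => (d2 k).mul (d1 k)
    rw [pd_mul j (d1 j z) (d4 z), e, pd_sum _ _ fun k _ => ((d2 k).fun_mul (d1 k)) z]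
    have : ∑ k, pd j (fun y => (y - x) k * pd k f y) z =
        pd j f z + ∑ k, (z - x) k * pd j (pd k f) z := by
      rw [Finset.sum_congr rfl fun k _ => pd_mul j (d2 k z) (d1 k z), Finset.sum_add_distrib]
      congr 1
      simp only [d3, ite_mul, one_mul, zero_mul, Finset.sum_ite_eq', Finset.mem_univ, if_true]
    rw [this, mul_add, Finset.mul_sum]
    ring
  have dgs : ∀ {f : E n → ℝ}, ContDiff ℝ ∞ f → ∀ k, pd k (gs f) z =
      2 * ∑ j, pd j f z * pd k (pd j f) z := by
    intro f hf k
    have d1 := fun j => diff_of_smooth (contDiff_pd hf j)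
    unfold gs
    rw [pd_sum _ _ fun j _ => ((d1 j).fun_pow 2) z, Finset.mul_sum]
    refine Finset.sum_congr rfl fun j _ => ?_
    rw [pd_sq k (d1 j z)]; ring
  have hsum : ∀ {f : E n → ℝ}, ContDiff ℝ ∞ f →
      ∑ k, (z - x) k * pd k (gs f) z =
        2 * ∑ j, ∑ k, pd j f z * ((z - x) k * pd j (pd k f) z) := by
    intro f hf
    rw [Finset.sum_comm, Finset.mul_sum]
    refine Finset.sum_congr rfl fun k _ => ?_
    rw [dgs hf, Finset.mul_sum, Finset.mul_sum, Finset.mul_sum]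
    refine Finset.sum_congr rfl fun j _ => ?_
    rw [pd_comm hf j k]; ring
  have split : ∑ j, pd j (fun z => pd j u z * fderiv ℝ u z (z - x) +
      pd j v z * fderiv ℝ v z (z - x)) z =
      ∑ j, pd j (fun z => pd j u z * fderiv ℝ u z (z - x)) z +
      ∑ j, pd j (fun z => pd j v z * fderiv ℝ v z (z - x)) z := by
    rw [← Finset.sum_add_distrib]
    refine Finset.sum_congr rfl fun j _ => ?_
    have : ∀ {f : E n → ℝ}, ContDiff ℝ ∞ f →
        ContDiff ℝ ∞ fun z => pd j f z * fderiv ℝ f z (z - x) := fun hf =>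
      (contDiff_pd hf j).mul ((hf.fderiv_right (m := ∞) (by simp)).clm_apply
        (contDiff_id.sub contDiff_const))
    exact pd_add j (diff_of_smooth (this hu) z) (diff_of_smooth (this hv) z)
  have lhs : fderiv ℝ (fun z => gs u z + gs v z + κ * (u z ^ 2 * v z ^ 2)) z (z - x) =
      ∑ k, (z - x) k * pd k (gs u) z + ∑ k, (z - x) k * pd k (gs v) z +
        2 * (lap u z * fderiv ℝ u z (z - x) + lap v z * fderiv ℝ v z (z - x)) := by
    rw [fderiv_eq_sum, fderiv_eq_sum, fderiv_eq_sum, Finset.mul_sum, Finset.mul_sum, mul_add,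
      Finset.mul_sum, Finset.mul_sum, ← Finset.sum_add_distrib, ← Finset.sum_add_distrib,
      ← Finset.sum_add_distrib]
    refine Finset.sum_congr rfl fun k _ => ?_
    have du := diff_of_smooth hu
    have dv := diff_of_smooth hv
    have dgu := diff_of_smooth (contDiff_gs hu)
    have dgv := diff_of_smooth (contDiff_gs hv)
    rw [pd_add k (by fun_prop) (by fun_prop), pd_add k (by fun_prop) (by fun_prop),
      pd_const_mul k _ (by fun_prop), pd_mul k (by fun_prop) (by fun_prop), pd_sq k (du z),
      pd_sq k (dv z), S.lap_u z hz, S.lap_v z hz]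
    ring
  rw [lhs, hsum hu, hsum hv, split, main hu, main hv]
  ring

lemma Sol.hasDerivAt_D (S : Sol κ u v x R) {r : ℝ} (hr : 0 < r) (hrR : r ≤ R) :
    HasDerivAt (D κ u v x) ((2 * B u v x r + 2 * P κ u v x r) / r) r := by
  have hu := S.hu
  have hv := S.hv
  have cgu := continuous_affine (contDiff_gs hu).continuous x r
  have cgv := continuous_affine (contDiff_gs hv).continuous x r
  have cu := continuous_affine hu.continuous x r
  have cv := continuous_affine hv.continuous x r
  have cbu := continuous_fderiv_apply hu x r
  have cbv := continuous_fderiv_apply hv x r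
  have hG : ∀ j, ContDiff ℝ ∞ (fun z => pd j u z * fderiv ℝ u z (z - x) +
      pd j v z * fderiv ℝ v z (z - x)) := by
    intro j
    have : ∀ {f : E n → ℝ}, ContDiff ℝ ∞ f →
        ContDiff ℝ ∞ fun z => pd j f z * fderiv ℝ f z (z - x) := fun hf =>
      (contDiff_pd hf j).mul ((hf.fderiv_right (m := ∞) (by simp)).clm_apply
        (contDiff_id.sub contDiff_const))
    exact (this hu).add (this hv)
  have he2 : ContDiff ℝ ∞ (fun z => gs u z + gs v z + κ * (u z ^ 2 * v z ^ 2)) :=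
    ((contDiff_gs hu).add (contDiff_gs hv)).add (contDiff_const.mul ((hu.pow 2).mul (hv.pow 2)))
  have h1 := hasDerivAt_J (m := 3) three_ne_zero (he2.of_le (m := 1) (by exact_mod_cast le_top)) x r
  have h2 := ((hasDerivAt_pow 2 r).mul h1)
  have cdiv : Continuous fun y => ∑ j, pd j (fun z => pd j u z * fderiv ℝ u z (z - x) +
      pd j v z * fderiv ℝ v z (z - x)) (x + r • y) :=
    continuous_finsetSum _ fun j _ => continuous_affine (contDiff_pd (hG j) j).continuous x r
  have e1 : r * J 3 (fun y => fderiv ℝ (fun z => gs u z + gs v z + κ * (u z ^ 2 * v z ^ 2))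
      (x + r • y) y) = 2 * J 3 (fun y => ∑ j, pd j (fun z => pd j u z * fderiv ℝ u z (z - x) +
      pd j v z * fderiv ℝ v z (z - x)) (x + r • y)) -
        2 * J 3 (fun y => gs u (x + r • y) + gs v (x + r • y)) := by
    rw [← J_const_mul, ← J_const_mul, ← J_const_mul, ← J_sub three_ne_zero (by fun_prop) (by fun_prop)]
    apply J_congr three_ne_zero
    intro y hy
    have hm := add_smul_mem_ball (x := x) hr.le (hr.trans_le hrR) hrR hy
    rw [← S.div_identity hm, add_sub_cancel_left, map_smul, smul_eq_mul]
  have e2 := J_div_field (m := 2) (by norm_num) hG x r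
  have e3 : (fun y => ∑ i, (pd i u (x + r • y) * fderiv ℝ u (x + r • y) (x + r • y - x) +
      pd i v (x + r • y) * fderiv ℝ v (x + r • y) (x + r • y - x)) * y i) =
      fun y => r * (fderiv ℝ u (x + r • y) y ^ 2 + fderiv ℝ v (x + r • y) y ^ 2) := by
    ext y
    have : ∀ f : E n → ℝ, fderiv ℝ f (x + r • y) y ^ 2 =
        ∑ i, pd i f (x + r • y) * fderiv ℝ f (x + r • y) y * y i := by
      intro f
      rw [sq]
      nth_rewrite 1 [fderiv_eq_sum]
      rw [Finset.sum_mul]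
      exact Finset.sum_congr rfl fun i _ => by ring
    rw [this, this, ← Finset.sum_add_distrib, Finset.mul_sum]
    refine Finset.sum_congr rfl fun i _ => ?_
    rw [add_sub_cancel_left, map_smul, map_smul, smul_eq_mul, smul_eq_mul]
    ring
  rw [e3, J_const_mul] at e2
  refine (h2.congr_of_eventuallyEq (f₁ := D κ u v x) (Eventually.of_forall fun s => rfl)).congr_deriv ?_
  unfold B P
  have e4 : J 3 (fun y => gs u (x + r • y) + gs v (x + r • y) +
    κ * (u (x + r • y) ^ 2 * v (x + r • y) ^ 2)) = J 3 (fun y => gs u (x + r • y) + gs v (x + r • y)) +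
      J 3 (fun y => κ * (u (x + r • y) ^ 2 * v (x + r • y) ^ 2)) :=
    J_add three_ne_zero (by fun_prop) (by fun_prop)
  rw [e4, eq_div_iff hr.ne']
  rw [show 2 + 1 = 3 from rfl] at e2
  push_cast at e2 ⊢
  linear_combination r ^ 2 * e1 + 2 * r * e2

end

/-! ### Almgren monotonicity -/

section

/-- The differential relations behind Almgren's monotonicity formula. -/
structure Alm (R : ℝ) (h d p b : ℝ → ℝ) : Prop where
  h_pos : ∀ r ∈ Ioc 0 R, 0 < h r
  p_nonneg : ∀ r ∈ Ioc 0 R, 0 ≤ p r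
  p_le : ∀ r ∈ Ioc 0 R, p r ≤ d r
  quad : ∀ r ∈ Ioc 0 R, ∀ t : ℝ, 0 ≤ t ^ 2 * h r - 2 * t * (d r + p r) + b r
  hasDeriv_h : ∀ r ∈ Ioc 0 R, HasDerivAt h (2 * (d r + p r) / r) r
  hasDeriv_d : ∀ r ∈ Ioc 0 R, HasDerivAt d ((2 * b r + 2 * p r) / r) r

lemma Sol.alm {κ R : ℝ} {u v : E n → ℝ} {x : E n} (S : Sol κ u v x R) :
    Alm R (H u v x) (D κ u v x) (P κ u v x) (B u v x) :=
  ⟨fun r hr => S.H_pos (hr.1.trans_le hr.2) r, fun r _ => S.P_nonneg r, fun r _ => S.P_le_D r,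
    fun _ hr t => S.quad_nonneg hr.1 hr.2 t, fun _ hr => S.hasDerivAt_H hr.1 hr.2,
    fun _ hr => S.hasDerivAt_D hr.1 hr.2⟩

namespace Alm

variable {R : ℝ} {h d p b : ℝ → ℝ}

lemma d_nonneg (A : Alm R h d p b) : ∀ r ∈ Ioc 0 R, 0 ≤ d r := fun r hr =>
  (A.p_nonneg r hr).trans (A.p_le r hr)

lemma Icc_sub {r s : ℝ} (hr : 0 < r) (hs : s ≤ R) : Icc r s ⊆ Ioc 0 R :=
  fun _ hx => ⟨hr.trans_le hx.1, hx.2.trans hs⟩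

lemma hasDeriv_rpow (A : Alm R h d p b) (k : ℝ) {r : ℝ} (hr : r ∈ Ioc 0 R) :
    HasDerivAt (fun r => r ^ (-k) * h r) (r ^ (-k - 1) * (2 * (d r + p r) - k * h r)) r := by
  have h1 := (Real.hasDerivAt_rpow_const (x := r) (p := -k) (Or.inl hr.1.ne')).mul
    (A.hasDeriv_h r hr)
  refine h1.congr_deriv ?_
  have : r ^ (-k) = r ^ (-k - 1) * r := by
    rw [← Real.rpow_add_one hr.1.ne']; congr 1; ring
  rw [this]
  have := hr.1.ne'
  field_simp
  ring

lemma rpow_transform {r s k x y : ℝ} (hr : 0 < r) (hs : 0 < s) (h : r ^ (-k) * x ≤ s ^ (-k) * y) :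
    x * (s / r) ^ k ≤ y := by
  rw [Real.div_rpow hs.le hr.le, mul_div_assoc', div_le_iff₀ (by positivity)]
  rw [Real.rpow_neg hr.le, Real.rpow_neg hs.le] at h
  have h1 : 0 < r ^ k := by positivity
  have h2 : 0 < s ^ k := by positivity
  rw [inv_mul_le_iff₀ h1, ← mul_assoc, mul_comm (r ^ k), mul_assoc, le_inv_mul_iff₀ h2] at h
  linarith

lemma rpow_transform' {r s k x y : ℝ} (hr : 0 < r) (hs : 0 < s) (h : s ^ (-k) * y ≤ r ^ (-k) * x) :
    y ≤ x * (s / r) ^ k := by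
  have := rpow_transform hs hr h
  have e : (s / r) ^ k = ((r / s) ^ k)⁻¹ := by
    rw [← Real.inv_rpow (by positivity), inv_div]
  rw [e, ← div_eq_mul_inv, le_div_iff₀ (by positivity)]
  exact this

lemma growth_lower (A : Alm R h d p b) {k r s : ℝ} (hr : 0 < r) (hrs : r ≤ s) (hs : s ≤ R)
    (hk : ∀ ρ ∈ Icc r s, k * h ρ ≤ 2 * (d ρ + p ρ)) : h r * (s / r) ^ k ≤ h s := by
  have hm : MonotoneOn (fun r => r ^ (-k) * h r) (Icc r s) := by
    apply monotoneOn_of_deriv_nonneg (convex_Icc _ _)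
    · exact fun ρ hρ => (A.hasDeriv_rpow k (Icc_sub hr hs hρ)).continuousAt.continuousWithinAt
    · intro ρ hρ
      exact (A.hasDeriv_rpow k (Icc_sub hr hs (interior_subset hρ))).differentiableAt.differentiableWithinAt
    · intro ρ hρ
      have hρ := interior_subset hρ
      rw [(A.hasDeriv_rpow k (Icc_sub hr hs hρ)).deriv]
      have := hr.trans_le hρ.1
      exact mul_nonneg (by positivity) (sub_nonneg.2 (hk ρ hρ))
  exact rpow_transform hr (hr.trans_le hrs) (hm (left_mem_Icc.2 hrs) (right_mem_Icc.2 hrs) hrs)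

lemma growth_upper (A : Alm R h d p b) {k r s : ℝ} (hr : 0 < r) (hrs : r ≤ s) (hs : s ≤ R)
    (hk : ∀ ρ ∈ Icc r s, 2 * (d ρ + p ρ) ≤ k * h ρ) : h s ≤ h r * (s / r) ^ k := by
  have hm : AntitoneOn (fun r => r ^ (-k) * h r) (Icc r s) := by
    apply antitoneOn_of_deriv_nonpos (convex_Icc _ _)
    · exact fun ρ hρ => (A.hasDeriv_rpow k (Icc_sub hr hs hρ)).continuousAt.continuousWithinAt
    · intro ρ hρ
      exact (A.hasDeriv_rpow k (Icc_sub hr hs (interior_subset hρ))).differentiableAt.differentiableWithinAt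
    · intro ρ hρ
      have hρ := interior_subset hρ
      rw [(A.hasDeriv_rpow k (Icc_sub hr hs hρ)).deriv]
      have := hr.trans_le hρ.1
      exact mul_nonpos_of_nonneg_of_nonpos (by positivity) (sub_nonpos.2 (hk ρ hρ))
  exact rpow_transform' hr (hr.trans_le hrs) (hm (left_mem_Icc.2 hrs) (right_mem_Icc.2 hrs) hrs)

lemma h_mono (A : Alm R h d p b) {r s : ℝ} (hr : 0 < r) (hrs : r ≤ s) (hs : s ≤ R) : h r ≤ h s := by
  simpa using A.growth_lower (k := 0) hr hrs hs fun ρ hρ => by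
    have := A.d_nonneg ρ (Icc_sub hr hs hρ)
    have := A.p_nonneg ρ (Icc_sub hr hs hρ)
    linarith

lemma freq_mono (A : Alm R h d p b) {r s : ℝ} (hr : 0 < r) (hrs : r ≤ s) (hs : s ≤ R) :
    d r / h r ≤ d s / h s := by
  have hd : ∀ ρ ∈ Icc r s, HasDerivAt (fun r => d r / h r)
      (((2 * b ρ + 2 * p ρ) / ρ * h ρ - d ρ * (2 * (d ρ + p ρ) / ρ)) / h ρ ^ 2) ρ := fun ρ hρ =>
    (A.hasDeriv_d ρ (Icc_sub hr hs hρ)).div (A.hasDeriv_h ρ (Icc_sub hr hs hρ))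
      (A.h_pos ρ (Icc_sub hr hs hρ)).ne'
  have hm : MonotoneOn (fun r => d r / h r) (Icc r s) := by
    apply monotoneOn_of_deriv_nonneg (convex_Icc _ _)
    · exact fun ρ hρ => (hd ρ hρ).continuousAt.continuousWithinAt
    · exact fun ρ hρ => (hd ρ (interior_subset hρ)).differentiableAt.differentiableWithinAt
    · intro ρ hρ
      have hρ := interior_subset hρ
      have hρ' := Icc_sub hr hs hρ
      rw [(hd ρ hρ).deriv]
      have h1 := hr.trans_le hρ.1
      have h2 := A.h_pos ρ hρ'
      have h3 := A.p_nonneg ρ hρ'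
      have h4 := A.d_nonneg ρ hρ'
      have h5 := A.quad ρ hρ' ((d ρ + p ρ) / h ρ)
      have h6 : (d ρ + p ρ) ^ 2 ≤ b ρ * h ρ := by
        have e : ((d ρ + p ρ) / h ρ) ^ 2 * h ρ - 2 * ((d ρ + p ρ) / h ρ) * (d ρ + p ρ) + b ρ =
          (b ρ * h ρ - (d ρ + p ρ) ^ 2) / h ρ := by field_simp; ring
        rw [e] at h5
        have := (div_nonneg_iff.1 h5)
        rcases this with h | h <;> linarith
      apply div_nonneg _ (by positivity)
      have e : (2 * b ρ + 2 * p ρ) / ρ * h ρ - d ρ * (2 * (d ρ + p ρ) / ρ) =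
        2 * (b ρ * h ρ + p ρ * h ρ - d ρ * (d ρ + p ρ)) / ρ := by field_simp
      rw [e]
      apply div_nonneg _ h1.le
      have h7 : 0 ≤ p ρ * h ρ := by positivity
      have h8 : 0 ≤ d ρ * p ρ := by positivity
      nlinarith [sq_nonneg (p ρ)]
  exact hm (left_mem_Icc.2 hrs) (right_mem_Icc.2 hrs) hrs

lemma freq_nonneg (A : Alm R h d p b) {r : ℝ} (hr : r ∈ Ioc 0 R) : 0 ≤ d r / h r :=
  div_nonneg (A.d_nonneg r hr) (A.h_pos r hr).le

lemma h_lower (A : Alm R h d p b) {r s : ℝ} (hr : 0 < r) (hrs : r ≤ s) (hs : s ≤ R) :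
    h r * (s / r) ^ (2 * (d r / h r)) ≤ h s := by
  apply A.growth_lower hr hrs hs
  intro ρ hρ
  have h1 := A.freq_mono hr hρ.1 (hρ.2.trans hs)
  have h2 := A.h_pos ρ (Icc_sub hr hs hρ)
  have h3 := A.p_nonneg ρ (Icc_sub hr hs hρ)
  rw [le_div_iff₀ h2] at h1
  linarith

lemma h_upper (A : Alm R h d p b) {r s : ℝ} (hr : 0 < r) (hrs : r ≤ s) (hs : s ≤ R) :
    h s ≤ h r * (s / r) ^ (4 * (d s / h s)) := by
  apply A.growth_upper hr hrs hs
  intro ρ hρ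
  have h1 := A.freq_mono (hr.trans_le hρ.1) hρ.2 hs
  have h2 := A.h_pos ρ (Icc_sub hr hs hρ)
  have h3 := A.p_le ρ (Icc_sub hr hs hρ)
  rw [div_le_iff₀ h2] at h1
  linarith

lemma h_upper_of_p_le (A : Alm R h d p b) {r s ε : ℝ} (hr : 0 < r) (hrs : r ≤ s) (hs : s ≤ R)
    (hp : ∀ ρ ∈ Icc r s, p ρ ≤ ε) : h s ≤ h r * (s / r) ^ (2 * (d s / h s + ε / h r)) := by
  apply A.growth_upper hr hrs hs
  intro ρ hρ
  have h1 := A.freq_mono (hr.trans_le hρ.1) hρ.2 hs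
  have h2 := A.h_pos ρ (Icc_sub hr hs hρ)
  have h3 := hp ρ hρ
  have h4 := A.h_mono hr hρ.1 (hρ.2.trans hs)
  have h5 := A.h_pos r (Icc_sub hr hs (left_mem_Icc.2 hrs))
  have h6 := A.p_nonneg r (Icc_sub hr hs (left_mem_Icc.2 hrs))
  have h7 := h6.trans (hp r (left_mem_Icc.2 hrs))
  rw [div_le_iff₀ h2] at h1
  have h8 : ε ≤ ε / h r * h ρ := by
    rw [div_mul_eq_mul_div, le_div_iff₀ h5]
    gcongr
  linarith

/-- Weiss-type energy. -/
lemma hasDeriv_weiss (A : Alm R h d p b) (a : ℝ) {r : ℝ} (hr : r ∈ Ioc 0 R) :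
    HasDerivAt (fun r => r ^ (-(2 * a)) * (d r - a * h r))
      (2 * r ^ (-(2 * a) - 1) * ((a ^ 2 * h r - 2 * a * (d r + p r) + b r) + (1 + a) * p r)) r := by
  have h1 := (Real.hasDerivAt_rpow_const (x := r) (p := -(2 * a)) (Or.inl hr.1.ne')).mul
    ((A.hasDeriv_d r hr).sub ((A.hasDeriv_h r hr).const_mul a))
  refine h1.congr_deriv ?_
  have : r ^ (-(2 * a)) = r ^ (-(2 * a) - 1) * r := by
    rw [← Real.rpow_add_one hr.1.ne']; congr 1; ring
  rw [this]
  have := hr.1.ne'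
  simp only [Pi.sub_apply]
  field_simp
  ring

end Alm

end

/-! ### Growth of rescaled energies -/

section

variable {κ R : ℝ} {u v : E n → ℝ} {x : E n}

lemma J_sq_expand {m : ℕ} (hm : m ≠ 0) {f f₁ g k k₁ l : E n → ℝ} (hf : Continuous f)
    (hf₁ : Continuous f₁) (hg : Continuous g) (hk : Continuous k) (hk₁ : Continuous k₁)
    (hl : Continuous l) (a b c : ℝ) :
    J m (fun y => (a * f y - b * f₁ y - c * g y) ^ 2 + (a * k y - b * k₁ y - c * l y) ^ 2) =
      a ^ 2 * J m (fun y => f y ^ 2 + k y ^ 2) + b ^ 2 * J m (fun y => f₁ y ^ 2 + k₁ y ^ 2) +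
      c ^ 2 * J m (fun y => g y ^ 2 + l y ^ 2) +
      (-2 * a * b) * J m (fun y => f y * f₁ y + k y * k₁ y) +
      (-2 * a * c) * J m (fun y => f y * g y + k y * l y) +
      (2 * b * c) * J m (fun y => g y * f₁ y + l y * k₁ y) := by
  simp only [← J_const_mul]
  rw [← J_add hm (by fun_prop) (by fun_prop), ← J_add hm (by fun_prop) (by fun_prop),
    ← J_add hm (by fun_prop) (by fun_prop), ← J_add hm (by fun_prop) (by fun_prop),
    ← J_add hm (by fun_prop) (by fun_prop)]
  congr 1
  ext y
  ring

/-- Weighted `L²` distance between the `a`-homogeneous rescalings at scales `r₁` and `r`. -/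
def X (u v : E n → ℝ) (x : E n) (a r₁ r : ℝ) : ℝ :=
  6 * J 2 (fun y => (r ^ (-a) * u (x + r • y) - r₁ ^ (-a) * u (x + r₁ • y)) ^ 2 +
    (r ^ (-a) * v (x + r • y) - r₁ ^ (-a) * v (x + r₁ • y)) ^ 2)

/-- Weiss-type energy. -/
def W (κ : ℝ) (u v : E n → ℝ) (x : E n) (a r : ℝ) : ℝ :=
  r ^ (-(2 * a)) * (D κ u v x r - a * H u v x r)

lemma Sol.X_le (S : Sol κ u v x R) {a r₁ r₂ : ℝ} (ha : 0 ≤ a) (hr₁ : 0 < r₁) (h12 : r₁ ≤ r₂)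
    (hR : r₂ ≤ R) :
    X u v x a r₁ r₂ ≤ Real.exp r₂ * ((W κ u v x a r₂ - W κ u v x a r₁) / (2 * r₁)) := by
  have hu := S.hu
  have hv := S.hv
  have cu := hu.continuous
  have cv := hv.continuous
  set C : ℝ → ℝ := fun r => J 2 (fun y => u (x + r • y) * u (x + r₁ • y)) +
    J 2 (fun y => v (x + r • y) * v (x + r₁ • y)) with hC
  set C' : ℝ → ℝ := fun r => J 2 (fun y => fderiv ℝ u (x + r • y) y * u (x + r₁ • y)) +
    J 2 (fun y => fderiv ℝ v (x + r • y) y * v (x + r₁ • y)) with hC'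
  have hCd : ∀ r, HasDerivAt C (C' r) r := fun r =>
    (hasDerivAt_J_mul two_ne_zero (hu.of_le (m := 1) (by exact_mod_cast le_top))
      (continuous_affine cu x r₁) x r).add
    (hasDerivAt_J_mul two_ne_zero (hv.of_le (m := 1) (by exact_mod_cast le_top))
      (continuous_affine cv x r₁) x r)
  have hX : ∀ r : ℝ, 0 < r → X u v x a r₁ r = r ^ (-(2 * a)) * H u v x r +
      (r₁ ^ (-a)) ^ 2 * H u v x r₁ - 12 * r₁ ^ (-a) * (r ^ (-a) * C r) := by
    intro r hr
    have := J_sq_expand (m := 2) two_ne_zero (f := fun y => u (x + r • y))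
      (f₁ := fun y => u (x + r₁ • y)) (g := fun _ => 0) (k := fun y => v (x + r • y))
      (k₁ := fun y => v (x + r₁ • y)) (l := fun _ => 0) (by fun_prop) (by fun_prop) (by fun_prop)
      (by fun_prop) (by fun_prop) (by fun_prop) (r ^ (-a)) (r₁ ^ (-a)) 0
    simp only [mul_zero, sub_zero] at this
    unfold X
    rw [this, J_add two_ne_zero (F := fun y => u (x + r • y) * u (x + r₁ • y)) (by fun_prop)
      (by fun_prop), show -(2 * a) = -a + -a by ring, Real.rpow_add hr]
    simp only [hC, H]
    ring
  have hXd : ∀ r ∈ Ioc 0 R, HasDerivAt (X u v x a r₁)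
      (r ^ (-(2 * a) - 1) * (2 * (D κ u v x r + P κ u v x r) - (2 * a) * H u v x r) -
        12 * r₁ ^ (-a) * ((-a) * r ^ (-a - 1) * C r + r ^ (-a) * C' r)) r := by
    intro r hr
    have h1 := ((S.alm.hasDeriv_rpow (2 * a) hr).add_const ((r₁ ^ (-a)) ^ 2 * H u v x r₁)).sub
      ((((Real.hasDerivAt_rpow_const (x := r) (p := -a) (Or.inl hr.1.ne')).mul
        (hCd r))).const_mul (12 * r₁ ^ (-a)))
    refine h1.congr_of_eventuallyEq ?_
    filter_upwards [lt_mem_nhds hr.1] with t ht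
    exact hX t ht
  have key : ∀ r ∈ Ioc 0 R, r ^ (-(2 * a) - 1) * (2 * (D κ u v x r + P κ u v x r) -
      (2 * a) * H u v x r) - 12 * r₁ ^ (-a) * ((-a) * r ^ (-a - 1) * C r + r ^ (-a) * C' r) -
      X u v x a r₁ r ≤ (r ^ (-(2 * a) - 1) / r) *
        (a ^ 2 * H u v x r - 2 * a * (D κ u v x r + P κ u v x r) + B u v x r) := by
    intro r hr
    have hr0 := hr.1
    have cgu := continuous_fderiv_apply hu x r
    have cgv := continuous_fderiv_apply hv x r
    have e := J_sq_expand (m := 2) two_ne_zero (f := fun y => u (x + r • y))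
      (f₁ := fun y => u (x + r₁ • y)) (g := fun y => fderiv ℝ u (x + r • y) y)
      (k := fun y => v (x + r • y))
      (k₁ := fun y => v (x + r₁ • y)) (l := fun y => fderiv ℝ v (x + r • y) y)
      (by fun_prop) (by fun_prop) cgu
      (by fun_prop) (by fun_prop) cgv (r ^ (-a) * (1 + a / r)) (r₁ ^ (-a)) (r ^ (-a))
    have nn := J_nonneg (m := 2) two_ne_zero (F := fun y => (r ^ (-a) * (1 + a / r) * u (x + r • y) -
      r₁ ^ (-a) * u (x + r₁ • y) - r ^ (-a) * fderiv ℝ u (x + r • y) y) ^ 2 +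
      (r ^ (-a) * (1 + a / r) * v (x + r • y) -
      r₁ ^ (-a) * v (x + r₁ • y) - r ^ (-a) * fderiv ℝ v (x + r • y) y) ^ 2)
      (fun y _ => by positivity)
    rw [J_add two_ne_zero (F := fun y => u (x + r • y) * u (x + r₁ • y)) (by fun_prop)
      (by fun_prop), J_add two_ne_zero (F := fun y => fderiv ℝ u (x + r • y) y * u (x + r₁ • y))
      (by fun_prop) (by fun_prop)] at e
    rw [e] at nn
    rw [hX r hr0]
    have hDP := S.DP_eq hr0 hr.2
    have e1 : r ^ (-(2 * a)) = (r ^ (-a)) ^ 2 := by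
      rw [show -(2 * a) = -a + -a by ring, Real.rpow_add hr0]; ring
    have e2 : r ^ (-(2 * a) - 1) = (r ^ (-a)) ^ 2 / r := by rw [Real.rpow_sub_one hr0.ne', e1]
    have e3 : r ^ (-a - 1) = r ^ (-a) / r := by rw [Real.rpow_sub_one hr0.ne']
    rw [e1, e2, e3, hDP]
    simp only [H, B, hC, hC'] at nn ⊢
    rw [← sub_nonneg]
    refine (mul_nonneg (by norm_num : (0:ℝ) ≤ 6) nn).trans_eq ?_
    field_simp
    ring
  have hW := fun r (hr : r ∈ Ioc 0 R) => S.alm.hasDeriv_weiss a hr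
  have hG : ∀ r ∈ Ioc 0 R, HasDerivAt (fun r => Real.exp (-r) * X u v x a r₁ r -
      W κ u v x a r / (2 * r₁)) _ r := fun r hr =>
    ((((hasDerivAt_id r).neg).exp).mul (hXd r hr)).sub ((hW r hr).div_const (2 * r₁))
  have hm : AntitoneOn (fun r => Real.exp (-r) * X u v x a r₁ r -
      W κ u v x a r / (2 * r₁)) (Icc r₁ r₂) := by
    apply antitoneOn_of_deriv_nonpos (convex_Icc _ _)
    · exact fun ρ hρ => (hG ρ (Alm.Icc_sub hr₁ hR hρ)).continuousAt.continuousWithinAt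
    · exact fun ρ hρ => (hG ρ (Alm.Icc_sub hr₁ hR (interior_subset hρ))).differentiableAt.differentiableWithinAt
    · intro ρ hρ
      have hρ := interior_subset hρ
      have hρ' := Alm.Icc_sub hr₁ hR hρ
      rw [(hG ρ hρ').deriv]
      have hρ0 := hρ'.1
      have k1 := key ρ hρ'
      have k2 := S.quad_nonneg hρ'.1 hρ'.2 a
      have k3 := S.P_nonneg ρ
      set df := a ^ 2 * H u v x ρ - 2 * a * (D κ u v x ρ + P κ u v x ρ) + B u v x ρ
      have k4 : ρ ^ (-(2 * a) - 1) / ρ * df ≤ 2 * ρ ^ (-(2 * a) - 1) * (df + (1 + a) * P κ u v x ρ)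
          / (2 * r₁) := by
        have q1 : ρ ^ (-(2 * a) - 1) / ρ * df ≤ ρ ^ (-(2 * a) - 1) / r₁ * df := by
          have := hρ.1
          gcongr
        have q2 : 2 * ρ ^ (-(2 * a) - 1) * (df + (1 + a) * P κ u v x ρ) / (2 * r₁) =
          ρ ^ (-(2 * a) - 1) / r₁ * df + ρ ^ (-(2 * a) - 1) / r₁ * ((1 + a) * P κ u v x ρ) := by
          field_simp
        rw [q2]
        have : 0 ≤ ρ ^ (-(2 * a) - 1) / r₁ * ((1 + a) * P κ u v x ρ) := by positivity
        linarith
      have k5 : Real.exp (-ρ) ≤ 1 := Real.exp_le_one_iff.2 (by linarith)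
      have k6 : Real.exp (-ρ) * (ρ ^ (-(2 * a) - 1) / ρ * df) ≤ ρ ^ (-(2 * a) - 1) / ρ * df :=
        mul_le_of_le_one_left (by positivity) k5
      have k7 := mul_le_mul_of_nonneg_left k1 (Real.exp_pos (-ρ)).le
      refine sub_nonpos.2 (le_trans (le_of_eq ?_) (k7.trans (k6.trans k4)))
      simp only [Pi.neg_apply, id]
      ring
  have := hm (left_mem_Icc.2 h12) (right_mem_Icc.2 h12) h12
  have hX1 : X u v x a r₁ r₁ = 0 := by
    unfold X
    simp [J]
  simp only [hX1, mul_zero, zero_sub] at this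
  have e : X u v x a r₁ r₂ = Real.exp r₂ * (Real.exp (-r₂) * X u v x a r₁ r₂) := by
    rw [← mul_assoc, ← Real.exp_add]; simp
  rw [e]
  gcongr
  rw [sub_div]
  linarith

end

/-! ### From decay of the energy to Hölder estimates -/

section

variable {κ R : ℝ} {u v : E n → ℝ} {x : E n}

lemma Sol.sup_sq_le (n : ℕ) : ∃ C : ℝ, 0 < C ∧ ∀ (κ : ℝ) (u v : E n → ℝ) (x : E n) (R : ℝ),
    Sol κ u v x R → 0 < R → ∀ z ∈ closedBall x (R / 2),
      u z ^ 2 ≤ C * H u v x R ∧ v z ^ 2 ≤ C * H u v x R := by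
  obtain ⟨C, hC, h⟩ := sup_estimate n
  refine ⟨C, hC, fun κ u v x R S hR z hz => ?_⟩
  have cu := S.hu.continuous
  have cv := S.hv.continuous
  have n1 := J_nonneg (m := 2) two_ne_zero (F := fun y => u (x + R • y) ^ 2) fun y _ => by positivity
  have n2 := J_nonneg (m := 2) two_ne_zero (F := fun y => v (x + R • y) ^ 2) fun y _ => by positivity
  unfold H
  rw [J_add two_ne_zero (by fun_prop) (by fun_prop)]
  have h1 := h u S.hu x R hR (fun z hz => (S.u_pos z hz).le) S.lap_u_nonneg z hz
  have h2 := h v S.hv x R hR (fun z hz => (S.v_pos z hz).le) S.symm.lap_u_nonneg z hz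
  constructor <;> nlinarith

lemma Sol.sup_le (n : ℕ) : ∃ C : ℝ, 0 < C ∧ ∀ (κ : ℝ) (u v : E n → ℝ) (x : E n) (R : ℝ),
    Sol κ u v x R → 0 < R → ∀ z ∈ closedBall x (R / 2),
      u z ≤ C * √(H u v x R) ∧ v z ≤ C * √(H u v x R) := by
  obtain ⟨C, hC, h⟩ := Sol.sup_sq_le n
  refine ⟨√C, by positivity, fun κ u v x R S hR z hz => ?_⟩
  rw [← Real.sqrt_mul hC.le]
  exact ⟨Real.le_sqrt_of_sq_le (h κ u v x R S hR z hz).1,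
    Real.le_sqrt_of_sq_le (h κ u v x R S hR z hz).2⟩

/-- The uniform Hölder estimate of exponent `β` at the centre of the unit ball. -/
def HolderP (n : ℕ) (β : ℝ) : Prop :=
  ∃ C : ℝ, 0 < C ∧ ∀ (κ : ℝ) (u v : E n → ℝ), Sol κ u v 0 1 →
    (∀ y ∈ ball (0 : E n) 1, u y ≤ 1 ∧ v y ≤ 1) →
    ∀ y ∈ ball (0 : E n) 1, |u y - u 0| + |v y - v 0| ≤ C * ‖y‖ ^ β

/-- The uniform Lipschitz estimate at the centre for solutions of frequency almost at most `a`. -/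
def Reg (n : ℕ) (a : ℝ) : Prop :=
  ∃ ε δ C : ℝ, 0 < ε ∧ 0 < δ ∧ δ ≤ 1 / 2 ∧ 0 < C ∧ ∀ (κ : ℝ) (u v : E n → ℝ), Sol κ u v 0 1 →
    H u v 0 1 = 1 → D κ u v 0 1 ≤ a + ε →
    ∀ y ∈ ball (0 : E n) δ, |u y - u 0| + |v y - v 0| ≤ C * ‖y‖

lemma Sol.osc_le_two (S : Sol κ u v x R) {M : ℝ}
    (hM : ∀ y ∈ ball x R, u y ≤ M ∧ v y ≤ M) {y z : E n} (hy : y ∈ ball x R) (hz : z ∈ ball x R) :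
    |u y - u z| + |v y - v z| ≤ 2 * M := by
  have key : ∀ {f : E n → ℝ}, (∀ w ∈ ball x R, 0 < f w) → (∀ w ∈ ball x R, f w ≤ M) →
      |f y - f z| ≤ M := fun h1 h2 => abs_le.2
    ⟨by linarith [h1 y hy, h2 z hz], by linarith [h1 z hz, h2 y hy]⟩
  linarith [key S.u_pos fun w hw => (hM w hw).1, key S.v_pos fun w hw => (hM w hw).2]

lemma holderP_zero (n : ℕ) : HolderP n 0 := by
  refine ⟨2, by norm_num, fun κ u v S hM y hy => ?_⟩
  rw [Real.rpow_zero]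
  exact S.osc_le_two hM hy (mem_ball_self one_pos)

lemma HolderP.mono {β β' : ℝ} (hβ : 0 ≤ β) (h : β ≤ β') (P : HolderP n β') : HolderP n β := by
  obtain ⟨C, hC, P⟩ := P
  refine ⟨C, hC, fun κ u v S hM y hy => (P κ u v S hM y hy).trans ?_⟩
  have : ‖y‖ < 1 := by simpa using hy
  gcongr ?_ * ?_
  exact Real.rpow_le_rpow_of_exponent_ge' (norm_nonneg _) this.le hβ h

lemma HolderP.scaled {β : ℝ} (P : HolderP n β) : ∃ C : ℝ, 0 < C ∧
    ∀ (κ : ℝ) (u v : E n → ℝ) (x : E n) (R M : ℝ), Sol κ u v x R → 0 < R → 0 < M →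
    (∀ y ∈ ball x R, u y ≤ M ∧ v y ≤ M) →
    ∀ y ∈ ball x R, |u y - u x| + |v y - v x| ≤ C * M * (‖y - x‖ / R) ^ β := by
  obtain ⟨C, hC, P⟩ := P
  refine ⟨C, hC, fun κ u v x R M S hR hM hb y hy => ?_⟩
  have S' : Sol _ _ _ (0 : E n) 1 := S.affine (c := M⁻¹) (by positivity) hR (z := x) (w := 0) (s := 1) (by simp)
  have h1 := P _ _ _ S' (by
    intro w hw
    have := hb _ (add_smul_mem_ball (x := x) hR.le hR le_rfl hw)
    constructor
    · rw [inv_mul_le_one₀ hM]; exact this.1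
    · rw [inv_mul_le_one₀ hM]; exact this.2) (R⁻¹ • (y - x)) (by
      rw [mem_ball_zero_iff, norm_smul, norm_inv, Real.norm_of_nonneg hR.le, inv_mul_lt_one₀ hR]
      simpa [dist_eq_norm] using hy)
  simp only [smul_inv_smul₀ hR.ne', add_sub_cancel, smul_zero, add_zero, ← mul_sub, abs_mul,
    abs_inv, abs_of_pos hM, ← mul_add, norm_smul, norm_inv, Real.norm_of_nonneg hR.le] at h1
  rw [inv_mul_le_iff₀ hM] at h1
  rw [div_eq_inv_mul]
  linarith

lemma Reg.exists_scaled {a : ℝ} (P : Reg n a) : ∃ ε δ C : ℝ, 0 < ε ∧ 0 < δ ∧ δ ≤ 1 / 2 ∧ 0 < C ∧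
    ∀ (κ : ℝ) (u v : E n → ℝ) (x : E n) (R : ℝ), Sol κ u v x R → 0 < R →
    D κ u v x R ≤ (a + ε) * H u v x R →
    ∀ y ∈ ball x (δ * R), |u y - u x| + |v y - v x| ≤ C * √(H u v x R) * (‖y - x‖ / R) := by
  obtain ⟨ε, δ, C, hε, hδ, hδ', hC, P⟩ := P
  refine ⟨ε, δ, C, hε, hδ, hδ', hC, fun κ u v x R S hR hD y hy => ?_⟩
  have hH := S.H_pos hR R
  set M := √(H u v x R)
  have hM : 0 < M := by positivity
  have hM2 : (M⁻¹) ^ 2 * H u v x R = 1 := by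
    rw [inv_pow, Real.sq_sqrt hH.le, inv_mul_cancel₀ hH.ne']
  have S' : Sol _ _ _ (0 : E n) 1 := S.affine (c := M⁻¹) (by positivity) hR (z := x) (w := 0) (s := 1) (by simp)
  have h1 := P _ _ _ S' (by
    rw [H_affine]
    simpa using hM2) (by
    rw [D_affine S.hu S.hv _ (by positivity), smul_zero, add_zero, mul_one]
    calc M⁻¹ ^ 2 * D κ u v x R ≤ M⁻¹ ^ 2 * ((a + ε) * H u v x R) := by gcongr
      _ = (a + ε) * (M⁻¹ ^ 2 * H u v x R) := by ring
      _ = _ := by rw [hM2, mul_one]) (R⁻¹ • (y - x)) (by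
      rw [mem_ball_zero_iff, norm_smul, norm_inv, Real.norm_of_nonneg hR.le, inv_mul_lt_iff₀ hR, mul_comm]
      simpa [dist_eq_norm] using hy)
  simp only [smul_inv_smul₀ hR.ne', add_sub_cancel, smul_zero, add_zero, ← mul_sub, abs_mul,
    abs_inv, abs_of_pos hM, ← mul_add, norm_smul, norm_inv, Real.norm_of_nonneg hR.le] at h1
  rw [inv_mul_le_iff₀ hM] at h1
  rw [div_eq_inv_mul]
  linarith

lemma Sol.H_le (S : Sol κ u v x R) (hR : 0 < R) {M : ℝ} (hM : ∀ y ∈ ball x R, u y ≤ M ∧ v y ≤ M) {r : ℝ}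
    (hr : 0 ≤ r) (hrR : r ≤ R) : H u v x r ≤ 12 * cw n 2 * M ^ 2 := by
  have cu := S.hu.continuous
  have cv := S.hv.continuous
  have : J 2 (fun y => u (x + r • y) ^ 2 + v (x + r • y) ^ 2) ≤ 2 * M ^ 2 * cw n 2 := by
    apply J_le two_ne_zero (by fun_prop)
    intro y hy
    have hm := add_smul_mem_ball (x := x) hr hR hrR hy
    have := hM _ hm
    have h1 := pow_le_pow_left₀ (S.u_pos _ hm).le this.1 2
    have h2 := pow_le_pow_left₀ (S.v_pos _ hm).le this.2 2
    linarith
  unfold H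
  linarith

lemma sqrt_mul_rpow {c ρ α : ℝ} (hc : 0 ≤ c) (hρ : 0 ≤ ρ) : √(c * ρ ^ (2 * α)) = √c * ρ ^ α := by
  rw [Real.sqrt_mul hc, mul_comm 2 α, Real.rpow_mul hρ, show (2 : ℝ) = (2 : ℕ) by norm_num,
    Real.rpow_natCast, Real.sqrt_sq (by positivity)]

lemma Sol.h_le_of_freq (S : Sol κ u v 0 1) (hM : ∀ y ∈ ball (0 : E n) 1, u y ≤ 1 ∧ v y ≤ 1)
    {ρ α : ℝ} (hρ : 0 < ρ) (hρ1 : ρ ≤ 1)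
    (hN : α ≤ D κ u v 0 ρ / H u v 0 ρ) : H u v 0 ρ ≤ 12 * cw n 2 * ρ ^ (2 * α) := by
  have h1 := S.alm.h_lower hρ hρ1 le_rfl
  have h2 := S.H_le one_pos hM zero_le_one le_rfl
  have h3 := S.H_pos one_pos ρ
  have h4 : (1 / ρ) ^ (2 * α) ≤ (1 / ρ) ^ (2 * (D κ u v 0 ρ / H u v 0 ρ)) := by
    apply Real.rpow_le_rpow_of_exponent_le
    · rw [le_div_iff₀ hρ]; linarith
    · linarith
  have h5 : H u v 0 ρ * (1 / ρ) ^ (2 * α) ≤ 12 * cw n 2 := by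
    have := mul_le_mul_of_nonneg_left h4 h3.le
    linarith
  rw [one_div, Real.inv_rpow hρ.le, ← div_eq_mul_inv, div_le_iff₀ (by positivity)] at h5
  exact h5

lemma Reg.holderP {a : ℝ} (ha : 0 ≤ a) (ha1 : a < 1) (P : Reg n a) : ∃ α, a < α ∧ HolderP n α := by
  obtain ⟨ε, δ, C, hε, hδ, hδ', hC, P⟩ := P.exists_scaled
  obtain ⟨C₁, hC₁, hsup⟩ := Sol.sup_le n
  set α := min (a + ε) 1 with hα
  have haα : a < α := lt_min (by linarith) ha1
  have hα0 : 0 < α := ha.trans_lt haα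
  have hα1 : α ≤ 1 := min_le_right _ _
  have c2 := cw_pos (n := n) (m := 2) two_ne_zero
  set K := √(12 * cw n 2)
  have hK : 0 < K := by positivity
  refine ⟨α, haα, max (4 / δ) (max (4 * C₁ * K * (2 / δ) ^ α) (C * K)), by positivity, ?_⟩
  intro κ u v S hM y hy
  have hy1 : ‖y‖ < 1 := by simpa using hy
  rcases (norm_nonneg y).eq_or_lt with hy0 | hy0
  · have : y = 0 := norm_eq_zero.1 hy0.symm
    subst this
    simp only [sub_self, abs_zero, add_zero]
    positivity
  set r := ‖y‖ with hr
  have hb : 2 / δ * r = 2 * r / δ := by ring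
  set ρ := 2 * r / δ with hρ
  have hρ0 : 0 < ρ := by positivity
  have hrρ : r = δ * ρ / 2 := by rw [hρ]; field_simp
  have hrle : r ≤ ρ / 2 := by nlinarith
  rcases le_or_gt 1 ρ with h1 | h1
  · have h2 := S.osc_le_two hM hy (mem_ball_self one_pos)
    have h3 : r ≤ r ^ α := by
      simpa using Real.rpow_le_rpow_of_exponent_ge hy0 hy1.le hα1
    have h4 : 1 ≤ 2 / δ * r ^ α := h1.trans (by rw [← hb]; gcongr)
    calc _ ≤ 2 * 1 := h2
      _ ≤ 2 * (2 / δ * r ^ α) := by gcongr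
      _ = 4 / δ * r ^ α := by ring
      _ ≤ _ := by gcongr; exact le_max_left _ _
  rcases le_or_gt α (D κ u v 0 ρ / H u v 0 ρ) with hN | hN
  · have h2 := S.h_le_of_freq hM hρ0 h1.le hN
    have h3 : √(H u v 0 ρ) ≤ K * ρ ^ α := by
      rw [← sqrt_mul_rpow (by positivity) hρ0.le]
      exact Real.sqrt_le_sqrt h2
    have Sρ : Sol κ u v 0 ρ := S.mono (ball_subset_ball h1.le)
    have hb' : ∀ z ∈ closedBall (0 : E n) (ρ / 2), |u z| ≤ C₁ * (K * ρ ^ α) ∧ |v z| ≤ C₁ * (K * ρ ^ α) := by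
      intro z hz
      have hz' : z ∈ ball (0 : E n) 1 := by
        rw [mem_closedBall] at hz
        rw [mem_ball]; linarith
      have h4 := hsup κ u v 0 ρ Sρ hρ0 z hz
      have h5 : C₁ * √(H u v 0 ρ) ≤ C₁ * (K * ρ ^ α) := by gcongr
      rw [abs_of_pos (S.u_pos z hz'), abs_of_pos (S.v_pos z hz')]
      exact ⟨h4.1.trans h5, h4.2.trans h5⟩
    have hy' := hb' y (by simpa using hrle)
    have h0' := hb' 0 (mem_closedBall_self (by positivity))
    calc _ ≤ (|u y| + |u 0|) + (|v y| + |v 0|) := by gcongr <;> exact abs_sub _ _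
      _ ≤ 4 * (C₁ * (K * ρ ^ α)) := by linarith [hy'.1, hy'.2, h0'.1, h0'.2]
      _ = 4 * C₁ * K * (2 / δ) ^ α * r ^ α := by
        rw [← hb, Real.mul_rpow (by positivity) hy0.le]; ring
      _ ≤ _ := by gcongr; exact (le_max_left _ _).trans (le_max_right _ _)
  · have ⟨ρ₀, h2, h3, h4, h5⟩ : ∃ ρ₀, ρ ≤ ρ₀ ∧ ρ₀ ≤ 1 ∧ D κ u v 0 ρ₀ / H u v 0 ρ₀ ≤ α ∧
        H u v 0 ρ₀ ≤ 12 * cw n 2 * ρ₀ ^ (2 * α) := by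
      rcases le_or_gt (D κ u v 0 1 / H u v 0 1) α with h | h
      · refine ⟨1, h1.le, le_rfl, h, ?_⟩
        have := S.H_le one_pos hM zero_le_one le_rfl
        simpa using this
      · have hc : ContinuousOn (fun r => D κ u v 0 r / H u v 0 r) (Icc ρ 1) := by
          intro t ht
          have ht' := Alm.Icc_sub hρ0 le_rfl ht
          exact ((S.alm.hasDeriv_d t ht').continuousAt.div (S.alm.hasDeriv_h t ht').continuousAt
            (S.H_pos one_pos t).ne').continuousWithinAt
        obtain ⟨t, ht, hte⟩ := intermediate_value_Icc h1.le hc (show α ∈ Icc _ _ from ⟨hN.le, h.le⟩)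
        exact ⟨t, ht.1, ht.2, hte.le, S.h_le_of_freq hM (hρ0.trans_le ht.1) ht.2 hte.ge⟩
    have hρ₀ : 0 < ρ₀ := hρ0.trans_le h2
    have Sρ : Sol κ u v 0 ρ₀ := S.mono (ball_subset_ball h3)
    have h6 := P κ u v 0 ρ₀ Sρ hρ₀ (by
      rw [div_le_iff₀ (S.H_pos one_pos _)] at h4
      refine h4.trans ?_
      have := S.H_pos one_pos ρ₀
      gcongr
      exact min_le_left _ _) y (by
        rw [mem_ball_zero_iff, ← hr]; nlinarith)
    have h7 : √(H u v 0 ρ₀) ≤ K * ρ₀ ^ α := by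
      rw [← sqrt_mul_rpow (by positivity) hρ₀.le]
      exact Real.sqrt_le_sqrt h5
    rw [sub_zero, ← hr] at h6
    have h8 : ρ₀ ^ α * (r / ρ₀) ≤ r ^ α := by
      have : (r / ρ₀) ^ (1:ℝ) ≤ (r / ρ₀) ^ α := by
        apply Real.rpow_le_rpow_of_exponent_ge (by positivity) _ hα1
        rw [div_le_one hρ₀]; linarith
      rw [Real.rpow_one] at this
      calc ρ₀ ^ α * (r / ρ₀) ≤ ρ₀ ^ α * (r / ρ₀) ^ α := by gcongr
        _ = r ^ α := by rw [← Real.mul_rpow hρ₀.le (by positivity), mul_div_cancel₀ _ hρ₀.ne']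
    calc _ ≤ C * √(H u v 0 ρ₀) * (r / ρ₀) := h6
      _ ≤ C * (K * ρ₀ ^ α) * (r / ρ₀) := by gcongr
      _ = C * K * (ρ₀ ^ α * (r / ρ₀)) := by ring
      _ ≤ C * K * r ^ α := by gcongr
      _ ≤ _ := by gcongr; exact (le_max_right _ _).trans (le_max_right _ _)

lemma holderP_of_reg (hstep : ∀ a : ℝ, 0 ≤ a → a < 1 → (∀ β : ℝ, 0 ≤ β → β < a → HolderP n β) →
    Reg n a) {α : ℝ} (h0 : 0 ≤ α) (h1 : α < 1) : HolderP n α := by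
  by_contra hn
  set T := {β : ℝ | 0 ≤ β ∧ β ≤ α ∧ HolderP n β}
  have hT0 : (0 : ℝ) ∈ T := ⟨le_rfl, h0, holderP_zero n⟩
  have hTb : BddAbove T := ⟨α, fun β hβ => hβ.2.1⟩
  have ha0 : 0 ≤ sSup T := le_csSup hTb hT0
  have ha1 : sSup T ≤ α := csSup_le ⟨0, hT0⟩ fun β hβ => hβ.2.1
  have hr := hstep (sSup T) ha0 (ha1.trans_lt h1) (by
    intro β hβ hlt
    obtain ⟨γ, hγ, hlt⟩ := exists_lt_of_lt_csSup ⟨0, hT0⟩ hlt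
    exact hγ.2.2.mono hβ hlt.le)
  obtain ⟨γ, hγ, hP⟩ := hr.holderP ha0 (ha1.trans_lt h1)
  rcases le_or_gt γ α with h | h
  · exact absurd (le_csSup hTb ⟨ha0.trans hγ.le, h, hP⟩) (not_le.2 hγ)
  · exact hn (hP.mono h0 h.le)

/-- Lipschitz bound for bounded parameters. -/
lemma lipschitz_of_bounded (n : ℕ) (K : ℝ) : ∃ C : ℝ, 0 < C ∧ ∀ (κ : ℝ) (u v : E n → ℝ),
    Sol κ u v 0 1 → κ ≤ K → H u v 0 1 ≤ 1 →
    ∀ y ∈ ball (0 : E n) (1 / 4), |u y - u 0| + |v y - v 0| ≤ C * ‖y‖ := by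
  obtain ⟨C₁, hC₁, hsup⟩ := Sol.sup_le n
  obtain ⟨C₂, hC₂, hlip⟩ := lipschitz_estimate n
  have hn : 0 ≤ C₁ / (1 / 2) + 1 / 2 * (|K| * (C₁ * C₁ ^ 2)) := by positivity
  refine ⟨2 * (C₂ * (C₁ / (1 / 2) + 1 / 2 * (|K| * (C₁ * C₁ ^ 2)))), by positivity, ?_⟩
  intro κ u v S hκ hH y hy
  have key : ∀ {u v : E n → ℝ}, Sol κ u v 0 1 → H u v 0 1 ≤ 1 → |u y - u 0| ≤
      C₂ * (C₁ / (1 / 2) + 1 / 2 * (|K| * (C₁ * C₁ ^ 2))) * ‖y‖ := by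
    intro u v S hH
    have hb : ∀ z ∈ ball (0 : E n) (1 / 2), 0 < u z ∧ 0 < v z ∧ u z ≤ C₁ ∧ v z ≤ C₁ := by
      intro z hz
      have hz' : z ∈ ball (0 : E n) 1 := ball_subset_ball (by norm_num) hz
      have h := hsup κ u v 0 1 S one_pos z (ball_subset_closedBall hz)
      have : √(H u v 0 1) ≤ 1 := by simpa using hH
      refine ⟨S.u_pos z hz', S.v_pos z hz', h.1.trans ?_, h.2.trans ?_⟩ <;>
        exact mul_le_of_le_one_right hC₁.le this
    have := hlip u S.hu 0 (1 / 2) C₁ (|K| * (C₁ * C₁ ^ 2)) (by norm_num) (by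
      intro z hz
      obtain ⟨h1, h2, h3, h4⟩ := hb z hz
      rwa [abs_of_pos h1]) (by
      intro z hz
      have hz' : z ∈ ball (0 : E n) 1 := ball_subset_ball (by norm_num) hz
      obtain ⟨h1, h2, h3, h4⟩ := hb z hz
      have h5 := S.hκ
      rw [S.lap_u z hz', abs_of_pos (by positivity)]
      have h6 := hκ.trans (le_abs_self K)
      gcongr) y (by norm_num; simpa using hy) 0 (by norm_num)
    simpa using this
  have h1 := key S hH
  have h2 := key S.symm (by unfold H at hH ⊢; simpa only [add_comm] using hH)
  linarith

end

/-! ### Decay with exponent zero -/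

section

variable {κ R : ℝ} {u v : E n → ℝ} {x : E n}

lemma H_symm (u v : E n → ℝ) (x : E n) (r : ℝ) : H v u x r = H u v x r := by
  unfold H; simp only [add_comm]

/-- Quadratic decay of the small component where the other one is large. -/
lemma Sol.decay (n : ℕ) : ∃ C : ℝ, 0 < C ∧ ∀ (κ : ℝ) (u v : E n → ℝ) (x : E n) (R M K : ℝ),
    Sol κ u v x R → 0 < R → 0 < K → (∀ z ∈ ball x R, v z ≤ M) →
    (∀ z ∈ ball x R, K ≤ κ * u z ^ 2) →
    ∀ z ∈ ball x (R / 4), v z ≤ C * M / (K * R ^ 2) ^ 2 := by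
  obtain ⟨C, hC, h⟩ := decay_estimate n
  refine ⟨64 * C ^ 2, by positivity, ?_⟩
  intro κ u v x R M K S hR hK hM hK' z hz
  have hl : ∀ z ∈ ball x R, K * v z ≤ lap v z := by
    intro z hz
    rw [S.lap_v z hz]
    nlinarith [S.v_pos z hz, hK' z hz]
  have step : ∀ z ∈ ball x (R / 2), v z ≤ C * M / (K * (R / 2) ^ 2) := by
    intro z hz
    have hs : ball z (R / 2) ⊆ ball x R := ball_subset_ball' (by rw [mem_ball] at hz; linarith)
    exact h v S.hv z (R / 2) M K (by positivity) hK (fun w hw => (S.v_pos w (hs hw)).le)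
      (fun w hw => hM w (hs hw)) (fun w hw => hl w (hs hw))
  have hs : ball z (R / 4) ⊆ ball x (R / 2) := ball_subset_ball' (by rw [mem_ball] at hz; linarith)
  have hs' : ball x (R / 2) ⊆ ball x R := ball_subset_ball (by linarith)
  refine (h v S.hv z (R / 4) _ K (by positivity) hK (fun w hw => (S.v_pos w (hs' (hs hw))).le)
      (fun w hw => step w (hs hw)) (fun w hw => hl w (hs' (hs hw)))).trans_eq ?_
  field_simp
  ring

lemma sq_le_of_abs_sub_le {a b c : ℝ} (h : |a - b| ≤ c) : a ^ 2 ≤ 2 * b ^ 2 + 2 * c ^ 2 := by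
  have h1 : (a - b) ^ 2 ≤ c ^ 2 := sq_le_sq' (by linarith [(abs_le.1 h).1]) (abs_le.1 h).2
  nlinarith [sq_nonneg (a - 2 * b)]

/-- Nondegeneracy at unit parameter and small frequency. -/
lemma nondegenerate (n : ℕ) : ∃ ε c : ℝ, 0 < ε ∧ 0 < c ∧ ∀ (u v : E n → ℝ), Sol 1 u v 0 1 →
    H u v 0 1 = 1 → D 1 u v 0 1 ≤ ε → c ≤ u 0 ^ 2 + v 0 ^ 2 ∧ u 0 ≠ v 0 := by
  obtain ⟨L, hL, hlip⟩ := lipschitz_of_bounded n 1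
  have c2 := cw_pos (n := n) (m := 2) two_ne_zero
  have c3 := cw_pos (n := n) (m := 3) three_ne_zero
  set s := min (1 / 8) (1 / (48 * cw n 2 * L ^ 2)) with hs
  have hs0 : 0 < s := by positivity
  have hs1 : s ≤ 1 / 8 := min_le_left _ _
  have hs2 : s * (48 * cw n 2 * L ^ 2) ≤ 1 := by
    rw [← le_div_iff₀ (by positivity)]; exact min_le_right _ _
  set c := s / (24 * cw n 2) with hc
  have hc0 : 0 < c := by positivity
  set m := √(c / 2) with hm
  have hm0 : 0 < m := by positivity
  set t := min (1 / 8) (m / (2 * L)) with ht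
  have ht0 : 0 < t := by positivity
  have ht1 : t ≤ 1 / 8 := min_le_left _ _
  have ht2 : L * t ≤ m / 2 := by
    have : t ≤ m / (2 * L) := min_le_right _ _
    rw [le_div_iff₀ (by positivity)] at this
    linarith
  set c' := t ^ 2 * (((m / 2) ^ 2 * (m / 2) ^ 2) * cw n 3)
  have hc' : 0 < c' := by positivity
  refine ⟨min (1 / 4) (c' / 2), c, by positivity, hc0, ?_⟩
  intro u v S hH hD
  have cu := S.hu.continuous
  have cv := S.hv.continuous
  have hD1 := hD.trans (min_le_left _ _)
  have hD2 := hD.trans (min_le_right _ _)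
  have hlip := hlip 1 u v S le_rfl hH.le
  have first : c ≤ u 0 ^ 2 + v 0 ^ 2 := by
    have h1 := S.alm.h_upper hs0 (by linarith : s ≤ 1) le_rfl
    rw [hH, div_one] at h1
    have h2 : (1 / s) ^ (4 * D 1 u v 0 1) ≤ 1 / s := by
      conv_rhs => rw [← Real.rpow_one (1 / s)]
      apply Real.rpow_le_rpow_of_exponent_le
      · rw [le_div_iff₀ hs0]; linarith
      · linarith
    have h3 : s ≤ H u v 0 s := by
      have h4 := mul_le_mul_of_nonneg_left h2 (S.H_pos one_pos s).le
      have h5 := h1.trans h4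
      rw [mul_one_div, le_div_iff₀ hs0] at h5
      linarith
    have h4 : H u v 0 s ≤ 6 * ((2 * (u 0 ^ 2 + v 0 ^ 2) + 4 * (L * s) ^ 2) * cw n 2) := by
      unfold H
      gcongr
      apply J_le two_ne_zero (by fun_prop)
      intro y hy
      have hm := add_smul_mem_ball (x := (0 : E n)) hs0.le hs0 le_rfl hy
      have h5 := hlip _ (ball_subset_ball (by linarith) hm)
      have h6 : L * ‖0 + s • y‖ ≤ L * s := by
        have : ‖0 + s • y‖ < s := by simpa using hm
        gcongr
      have h7 := sq_le_of_abs_sub_le ((le_add_of_nonneg_right (abs_nonneg _)).trans (h5.trans h6))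
      have h8 := sq_le_of_abs_sub_le ((le_add_of_nonneg_left (abs_nonneg _)).trans (h5.trans h6))
      linarith
    rw [hc, div_le_iff₀ (by positivity)]
    have h5 : 24 * (L * s) ^ 2 * cw n 2 ≤ s / 2 := by nlinarith
    linarith
  refine ⟨first, fun heq => ?_⟩
  have hm2 : m ^ 2 = c / 2 := Real.sq_sqrt (by positivity)
  have hu0 : m ≤ u 0 := by
    have := S.u_pos 0 (mem_ball_self one_pos)
    rw [← heq] at first
    exact le_of_sq_le_sq (by linarith) this.le
  have h1 : c' ≤ P 1 u v 0 t := by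
    refine mul_le_mul_of_nonneg_left ?_ (sq_nonneg t)
    apply le_J three_ne_zero (by fun_prop)
    intro y hy
    have hm := add_smul_mem_ball (x := (0 : E n)) ht0.le ht0 le_rfl hy
    have h5 := hlip _ (ball_subset_ball (by linarith) hm)
    have h6 : L * ‖0 + t • y‖ ≤ L * t := by
      have : ‖0 + t • y‖ < t := by simpa using hm
      gcongr
    have h7 := (abs_le.1 ((le_add_of_nonneg_right (abs_nonneg _)).trans (h5.trans h6))).1
    have h8 := (abs_le.1 ((le_add_of_nonneg_left (abs_nonneg _)).trans (h5.trans h6))).1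
    have h9 : m / 2 ≤ u (0 + t • y) := by linarith
    have h10 : m / 2 ≤ v (0 + t • y) := by linarith
    rw [one_mul]
    gcongr
  have h2 := S.alm.freq_mono ht0 (by linarith : t ≤ 1) le_rfl
  have h3 := S.alm.h_mono ht0 (by linarith : t ≤ 1) le_rfl
  rw [hH, div_one, div_le_iff₀ (S.H_pos one_pos t)] at h2
  rw [hH] at h3
  have h4 := S.P_le_D t
  have h5 := S.alm.d_nonneg 1 ⟨one_pos, le_rfl⟩
  have h6 : D 1 u v 0 1 * H u v 0 t ≤ D 1 u v 0 1 := mul_le_of_le_one_right h5 h3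
  linarith

lemma Sol.continuous_H (S : Sol κ u v x R) (x : E n) : Continuous (H u v x) := by
  have : ContDiff ℝ 1 fun z => u z ^ 2 + v z ^ 2 :=
    ((S.hu.pow 2).add (S.hv.pow 2)).of_le (by exact_mod_cast le_top)
  exact continuous_iff_continuousAt.2 fun r =>
    ((hasDerivAt_J two_ne_zero this x r).const_mul 6).continuousAt

lemma Sol.H_le_of_dist (S : Sol κ u v x R) {z : E n} {r s : ℝ} (hr : 0 < r) (hs : 0 < s)
    (h : dist z x + r ≤ 3 / 4 * s) :
    H u v z r ≤ (s / r) ^ n * (16 / 7) ^ 2 * H u v x s := by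
  have cu := S.hu.continuous
  have cv := S.hv.continuous
  have := J_comp (m := 2) two_ne_zero (F := fun z => u z ^ 2 + v z ^ 2) (by fun_prop) hr hs
    (fun w _ => by positivity) h
  unfold H
  linarith

lemma Sol.D_le_of_dist (S : Sol κ u v x R) {z : E n} {r s : ℝ} (hr : 0 < r) (hs : 0 < s)
    (h : dist z x + r ≤ 3 / 4 * s) :
    D κ u v z r ≤ (r / s) ^ 2 * ((s / r) ^ n * (16 / 7) ^ 3) * D κ u v x s := by
  have cu := S.hu.continuous
  have cv := S.hv.continuous
  have cgu := (contDiff_gs S.hu).continuous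
  have cgv := (contDiff_gs S.hv).continuous
  have hκ := S.hκ
  have := J_comp (m := 3) three_ne_zero (F := fun z => gs u z + gs v z + κ * (u z ^ 2 * v z ^ 2))
    (by fun_prop) hr hs (fun w _ => by
      have := gs_nonneg u w
      have := gs_nonneg v w
      positivity) h
  unfold D
  refine (mul_le_mul_of_nonneg_left this (sq_nonneg r)).trans_eq ?_
  field_simp

/-- Pointwise nondegeneracy when the frequency is small and the parameter is large. -/
lemma pointwise_nondegenerate (n : ℕ) : ∃ ε K c : ℝ, 0 < ε ∧ 0 < K ∧ 0 < c ∧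
    ∀ (κ : ℝ) (u v : E n → ℝ), Sol κ u v 0 1 → H u v 0 1 = 1 → D κ u v 0 1 ≤ ε → K < κ →
    ∀ x ∈ closedBall (0 : E n) (1 / 16), u x ≠ v x ∧ c * √κ ≤ κ * (u x ^ 2 + v x ^ 2) := by
  obtain ⟨ε', c₀, hε', hc₀, hnd⟩ := nondegenerate n
  set c₁ : ℝ := ((1 / 4) / 1) ^ 2 * ((1 / (1 / 4)) ^ n * (16 / 7) ^ 3) with hc₁
  set c₂ : ℝ := (16 * (((1 / 4) / (1 / 16)) ^ n * (16 / 7) ^ 2))⁻¹ with hc₂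
  have h1 : 0 < c₁ := by positivity
  have h2 : 0 < c₂ := by positivity
  set ε := min (1 / 4) (min (c₂ / (2 * c₁)) (c₂ / c₁ * ε')) with hε
  refine ⟨ε, 16 / c₂, 4 * c₀ * √c₂, by positivity, by positivity, by positivity, ?_⟩
  intro κ u v S hH hD hκ x hx
  have hx' : dist x 0 ≤ 1 / 16 := hx
  have hκ0 := S.hκ
  have hε1 : ε ≤ 1 / 4 := min_le_left _ _
  have hε2 : ε ≤ c₂ / (2 * c₁) := (min_le_right _ _).trans (min_le_left _ _)
  have hε3 : ε ≤ c₂ / c₁ * ε' := (min_le_right _ _).trans (min_le_right _ _)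
  have Sx : Sol κ u v x (1 / 4) := S.mono (ball_subset_ball' (by linarith))
  have hDx : D κ u v x (1 / 4) ≤ c₁ * ε :=
    (S.D_le_of_dist (by norm_num) one_pos (by linarith)).trans (by gcongr)
  have hHx : c₂ ≤ H u v x (1 / 4) := by
    have h3 := Sx.H_le_of_dist (z := 0) (r := 1 / 16) (s := 1 / 4) (by norm_num) (by norm_num)
      (by rw [dist_comm]; linarith)
    have h4 := S.alm.h_upper (r := 1 / 16) (by norm_num) (by norm_num) le_rfl
    rw [hH, div_one] at h4
    have h5 : (1 / (1 / 16) : ℝ) ^ (4 * D κ u v 0 1) ≤ 16 := by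
      calc (1 / (1 / 16) : ℝ) ^ (4 * D κ u v 0 1) ≤ (1 / (1 / 16) : ℝ) ^ (1 : ℝ) := by
            apply Real.rpow_le_rpow_of_exponent_le (by norm_num) (by linarith)
        _ = 16 := by norm_num
    have h6 := S.H_pos one_pos (1 / 16)
    have h7 := mul_le_mul_of_nonneg_left h5 h6.le
    rw [hc₂, inv_le_iff_one_le_mul₀ (by positivity)]
    linarith
  have hHx0 : 0 < H u v x (1 / 4) := h2.trans_le hHx
  have hN : D κ u v x (1 / 4) / H u v x (1 / 4) ≤ c₁ * ε / c₂ := by gcongr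
  have hN1 : D κ u v x (1 / 4) / H u v x (1 / 4) ≤ 1 / 2 := by
    refine hN.trans ?_
    rw [le_div_iff₀ (by positivity)] at hε2
    rw [div_le_iff₀ h2]
    linarith
  have hN2 : D κ u v x (1 / 4) / H u v x (1 / 4) ≤ ε' := by
    refine hN.trans ?_
    rw [div_mul_eq_mul_div, le_div_iff₀ (by positivity)] at hε3
    rw [div_le_iff₀ h2]
    linarith
  obtain ⟨r, hr, hr1⟩ : ∃ r ∈ Icc (0 : ℝ) (1 / 4), κ * r ^ 2 * H u v x r = 1 := by
    have hc : ContinuousOn (fun r => κ * r ^ 2 * H u v x r) (Icc 0 (1 / 4)) := by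
      have := S.continuous_H x
      exact Continuous.continuousOn (by fun_prop)
    apply intermediate_value_Icc (by norm_num) hc
    constructor
    · norm_num
    · rw [div_lt_iff₀ h2] at hκ
      show 1 ≤ κ * (1 / 4) ^ 2 * H u v x (1 / 4)
      nlinarith
  have hr0 : 0 < r := by
    refine hr.1.lt_of_ne' ?_
    rintro rfl
    norm_num at hr1
  have hHr := Sx.H_pos (by norm_num) r
  have hlow : c₂ * 16 * r ^ 2 ≤ H u v x r := by
    have h3 := Sx.alm.h_upper hr0 hr.2 le_rfl
    have h4 : (1 / 4 / r) ^ (4 * (D κ u v x (1 / 4) / H u v x (1 / 4))) ≤ (1 / 4 / r) ^ 2 := by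
      rw [← Real.rpow_natCast]
      apply Real.rpow_le_rpow_of_exponent_le
      · rw [le_div_iff₀ hr0]; linarith [hr.2]
      · push_cast; linarith
    have h5 := hHx.trans (h3.trans (mul_le_mul_of_nonneg_left h4 hHr.le))
    rw [div_pow, mul_div_assoc', le_div_iff₀ (by positivity)] at h5
    linarith
  set M := √(H u v x r)
  have hM : 0 < M := by positivity
  have hM2 : M ^ 2 = H u v x r := Real.sq_sqrt hHr.le
  have hM3 : (M⁻¹) ^ 2 * H u v x r = 1 := by
    rw [inv_pow, hM2, inv_mul_cancel₀ hHr.ne']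
  have Sr : Sol κ u v x r := Sx.mono (ball_subset_ball hr.2)
  have S' := Sr.affine (c := M⁻¹) (by positivity) hr0 (z := x) (w := 0) (s := 1) (by simp)
  have hD' := D_affine (c := M⁻¹) S.hu S.hv κ (by positivity) x 0 r 1
  have e : κ * r ^ 2 / M⁻¹ ^ 2 = 1 := by
    rw [inv_pow, div_inv_eq_mul, hM2, hr1]
  rw [e] at S' hD'
  obtain ⟨h3, h4⟩ := hnd _ _ S' (by rw [H_affine]; simpa using hM3) (by
    rw [hD', smul_zero, add_zero, mul_one]
    have h5 := Sx.alm.freq_mono hr0 hr.2 le_rfl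
    rw [div_le_iff₀ hHr] at h5
    calc M⁻¹ ^ 2 * D κ u v x r ≤ M⁻¹ ^ 2 * (ε' * H u v x r) := by
          gcongr
          refine h5.trans ?_
          gcongr
      _ = ε' * (M⁻¹ ^ 2 * H u v x r) := by ring
      _ = _ := by rw [hM3, mul_one])
  simp only [smul_zero, add_zero] at h3 h4
  refine ⟨fun h => h4 (by rw [h]), ?_⟩
  have h5 : c₀ * H u v x r ≤ u x ^ 2 + v x ^ 2 := by
    rw [← hM2]
    have : (M⁻¹ * u x) ^ 2 + (M⁻¹ * v x) ^ 2 = (u x ^ 2 + v x ^ 2) / M ^ 2 := by field_simp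
    rw [this, le_div_iff₀ (by positivity)] at h3
    exact h3
  have h6 : 4 * √c₂ * √κ ≤ κ * H u v x r := by
    rw [mul_assoc, ← Real.sqrt_mul h2.le, ← abs_of_pos (show 0 < κ * H u v x r by positivity),
      ← Real.sqrt_sq_eq_abs, show (4 : ℝ) = √(16) by
        rw [show (16 : ℝ) = 4 ^ 2 by norm_num, Real.sqrt_sq (by norm_num)],
      ← Real.sqrt_mul (by norm_num)]
    apply Real.sqrt_le_sqrt
    have h7 : κ * H u v x r = 1 / r ^ 2 := by
      rw [eq_div_iff (by positivity)]; linarith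
    have h8 : 16 * c₂ ≤ H u v x r / r ^ 2 := by
      rw [le_div_iff₀ (by positivity)]; linarith
    calc 16 * (c₂ * κ) = κ * (16 * c₂) := by ring
      _ ≤ κ * (H u v x r / r ^ 2) := by gcongr
      _ = (κ * H u v x r) ^ 2 := by rw [sq, h7, ← h7]; field_simp; nlinarith
  calc 4 * c₀ * √c₂ * √κ = c₀ * (4 * √c₂ * √κ) := by ring
    _ ≤ c₀ * (κ * H u v x r) := by gcongr
    _ = κ * (c₀ * H u v x r) := by ring
    _ ≤ _ := by gcongr

lemma reg_zero (n : ℕ) : Reg n 0 := by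
  obtain ⟨ε, K, c, hε, hK, hc, hnd⟩ := pointwise_nondegenerate n
  obtain ⟨L, hL, hlip⟩ := lipschitz_of_bounded n K
  obtain ⟨C₁, hC₁, hsup⟩ := Sol.sup_le n
  obtain ⟨C₂, hC₂, hdec⟩ := Sol.decay n
  obtain ⟨C₃, hC₃, hlip'⟩ := lipschitz_estimate n
  set Q := C₂ * C₁ / (c / 2 * (1 / 16) ^ 2) ^ 2 with hQ
  have hQ0 : 0 < Q := by positivity
  set L' := C₃ * (C₁ / (1 / 64) + 1 / 64 * (Q * C₁ ^ 2)) with hL'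
  have hL'0 : 0 < L' := by positivity
  refine ⟨ε, 1 / 128, max L (2 * L'), hε, by norm_num, by norm_num, by positivity, ?_⟩
  intro κ u v S hH hD y hy
  rw [zero_add] at hD
  rcases le_or_gt κ K with hκ | hκ
  · refine (hlip κ u v S hκ hH.le y (ball_subset_ball (by norm_num) hy)).trans ?_
    gcongr
    exact le_max_left _ _
  have hκ0 := S.hκ
  have main : ∀ {u v : E n → ℝ}, Sol κ u v 0 1 → H u v 0 1 = 1 →
      (∀ x ∈ ball (0 : E n) (1 / 16), c * √κ ≤ κ * (u x ^ 2 + v x ^ 2)) →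
      (∀ x ∈ ball (0 : E n) (1 / 16), v x ≤ u x) →
      |u y - u 0| + |v y - v 0| ≤ 2 * L' * ‖y‖ := by
    intro u v S hH hb huv
    have hsub : ball (0 : E n) (1 / 16) ⊆ ball 0 1 := ball_subset_ball (by norm_num)
    have hb1 : ∀ z ∈ ball (0 : E n) (1 / 16), u z ≤ C₁ ∧ v z ≤ C₁ := by
      intro z hz
      have h := hsup κ u v 0 1 S one_pos z (ball_subset_closedBall (ball_subset_ball (by norm_num) hz))
      rwa [hH, Real.sqrt_one, mul_one] at h
    have hv : ∀ z ∈ ball (0 : E n) (1 / 64), κ * v z ≤ Q := by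
      intro z hz
      have h := hdec κ u v 0 (1 / 16) C₁ (c / 2 * √κ) (S.mono hsub) (by norm_num) (by positivity)
        (fun z hz => (hb1 z hz).2) (by
          intro z hz
          have h1 := hb z hz
          have h2 := pow_le_pow_left₀ (S.v_pos z (hsub hz)).le (huv z hz) 2
          nlinarith) z (ball_subset_ball (by norm_num) hz)
      have h3 : C₂ * C₁ / (c / 2 * √κ * (1 / 16) ^ 2) ^ 2 = Q / κ := by
        rw [hQ, show (c / 2 * √κ * (1 / 16) ^ 2) ^ 2 = (c / 2 * (1 / 16) ^ 2) ^ 2 * √κ ^ 2 by ring,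
          Real.sq_sqrt hκ0.le, div_div]
      rw [h3, le_div_iff₀ hκ0] at h
      linarith
    have hsub' : ball (0 : E n) (1 / 64) ⊆ ball 0 (1 / 16) := ball_subset_ball (by norm_num)
    have hu' := hlip' u S.hu 0 (1 / 64) C₁ (Q * C₁ ^ 2) (by norm_num) (by
      intro z hz
      rw [abs_of_pos (S.u_pos z (hsub (hsub' hz)))]
      exact (hb1 z (hsub' hz)).1) (by
      intro z hz
      have h1 := S.u_pos z (hsub (hsub' hz))
      have h2 := S.v_pos z (hsub (hsub' hz))
      have h3 := hb1 z (hsub' hz)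
      rw [S.lap_u z (hsub (hsub' hz)), abs_of_pos (by positivity)]
      calc κ * (u z * v z ^ 2) = κ * v z * (u z * v z) := by ring
        _ ≤ Q * (C₁ * C₁) := by
          gcongr
          · exact hv z hz
          · exact h3.1
          · exact h3.2
        _ = _ := by ring) y (by norm_num; simpa using hy) 0 (by norm_num)
    have hv' := hlip' v S.hv 0 (1 / 64) C₁ (Q * C₁ ^ 2) (by norm_num) (by
      intro z hz
      rw [abs_of_pos (S.v_pos z (hsub (hsub' hz)))]
      exact (hb1 z (hsub' hz)).2) (by
      intro z hz
      have h1 := S.u_pos z (hsub (hsub' hz))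
      have h2 := S.v_pos z (hsub (hsub' hz))
      have h3 := hb1 z (hsub' hz)
      rw [S.lap_v z (hsub (hsub' hz)), abs_of_pos (by positivity)]
      calc κ * (v z * u z ^ 2) = κ * v z * u z ^ 2 := by ring
        _ ≤ Q * C₁ ^ 2 := by
          gcongr
          · exact hv z hz
          · exact h3.1) y (by norm_num; simpa using hy) 0 (by norm_num)
    rw [sub_zero, ← hL'] at hu' hv'
    linarith
  have hnd' := fun x (hx : x ∈ ball (0 : E n) (1 / 16)) =>
    hnd κ u v S hH hD hκ x (ball_subset_closedBall hx)
  have hsign : (∀ x ∈ ball (0 : E n) (1 / 16), v x ≤ u x) ∨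
      (∀ x ∈ ball (0 : E n) (1 / 16), u x ≤ v x) := by
    by_contra! hcon
    obtain ⟨⟨x₁, hx₁, h1⟩, ⟨x₂, hx₂, h2⟩⟩ := hcon
    have hpre := (convex_ball (0 : E n) (1 / 16)).isPreconnected
    obtain ⟨z, hz, hze⟩ := hpre.intermediate_value₂ hx₁ hx₂ S.hu.continuous.continuousOn
      S.hv.continuous.continuousOn h1.le h2.le
    exact (hnd' z hz).1 hze
  have : 2 * L' * ‖y‖ ≤ max L (2 * L') * ‖y‖ := by gcongr; exact le_max_right _ _
  rcases hsign with h | h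
  · exact (main S hH (fun x hx => (hnd' x hx).2) h).trans this
  · have := (main S.symm (by rwa [H_symm]) (fun x hx => by
      rw [add_comm (v x ^ 2)]; exact (hnd' x hx).2) h).trans this
    linarith

end

/-! ### Limits of sequences of solutions -/

section

/-- A sequence of solutions with coupling tending to infinity, converging uniformly on a ball. -/
structure LimSeq (κ : ℕ → ℝ) (u v : ℕ → E n → ℝ) (U V : E n → ℝ) (x : E n) (R M : ℝ) : Prop where
  R_pos : 0 < R
  M_pos : 0 < M
  tendsto_κ : Tendsto κ atTop atTop
  sol : ∀ k, Sol (κ k) (u k) (v k) x R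
  bdd : ∀ k, ∀ z ∈ ball x R, u k z ≤ M ∧ v k z ≤ M
  cU : Continuous U
  cV : Continuous V
  unif_u : ∀ η > 0, ∀ᶠ k in atTop, ∀ z ∈ ball x R, |u k z - U z| ≤ η
  unif_v : ∀ η > 0, ∀ᶠ k in atTop, ∀ z ∈ ball x R, |v k z - V z| ≤ η

variable {κ : ℕ → ℝ} {u v : ℕ → E n → ℝ} {U V : E n → ℝ} {x : E n} {R M : ℝ}

lemma LimSeq.symm (L : LimSeq κ u v U V x R M) : LimSeq κ v u V U x R M :=
  ⟨L.R_pos, L.M_pos, L.tendsto_κ, fun k => (L.sol k).symm, fun k z hz => (L.bdd k z hz).symm,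
    L.cV, L.cU, L.unif_v, L.unif_u⟩

lemma LimSeq.subseq (L : LimSeq κ u v U V x R M) {φ : ℕ → ℕ} (hφ : StrictMono φ) :
    LimSeq (κ ∘ φ) (u ∘ φ) (v ∘ φ) U V x R M :=
  ⟨L.R_pos, L.M_pos, L.tendsto_κ.comp hφ.tendsto_atTop, fun _ => L.sol _, fun _ => L.bdd _,
    L.cU, L.cV, fun η hη => hφ.tendsto_atTop.eventually (L.unif_u η hη),
    fun η hη => hφ.tendsto_atTop.eventually (L.unif_v η hη)⟩

lemma LimSeq.mono (L : LimSeq κ u v U V x R M) {z : E n} {s : ℝ} (hs : 0 < s)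
    (h : ball z s ⊆ ball x R) : LimSeq κ u v U V z s M :=
  ⟨hs, L.M_pos, L.tendsto_κ, fun k => (L.sol k).mono h, fun k w hw => L.bdd k w (h hw),
    L.cU, L.cV, fun η hη => (L.unif_u η hη).mono fun _ hk w hw => hk w (h hw),
    fun η hη => (L.unif_v η hη).mono fun _ hk w hw => hk w (h hw)⟩

lemma LimSeq.affine (L : LimSeq κ u v U V x R M) {c r : ℝ} (hc : 0 < c) (hr : 0 < r) {z w : E n}
    {s : ℝ} (hs : 0 < s) (h : dist (z + r • w) x + r * s ≤ R) :
    LimSeq (fun k => κ k * r ^ 2 / c ^ 2) (fun k y => c * u k (z + r • y))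
      (fun k y => c * v k (z + r • y)) (fun y => c * U (z + r • y)) (fun y => c * V (z + r • y))
      w s (c * M) := by
  have hmem : ∀ y ∈ ball w s, z + r • y ∈ ball x R := by
    intro y hy
    rw [mem_ball] at hy ⊢
    have h1 : dist (z + r • y) (z + r • w) = r * dist y w := by
      rw [dist_add_left, dist_smul₀, Real.norm_of_nonneg hr.le]
    have h2 := dist_triangle (z + r • y) (z + r • w) x
    nlinarith
  have cU := L.cU
  have cV := L.cV
  have key : ∀ (f : ℕ → E n → ℝ) (F : E n → ℝ),
      (∀ η > 0, ∀ᶠ k in atTop, ∀ z ∈ ball x R, |f k z - F z| ≤ η) →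
      ∀ η > 0, ∀ᶠ k in atTop, ∀ y ∈ ball w s, |c * f k (z + r • y) - c * F (z + r • y)| ≤ η := by
    intro f F hf η hη
    filter_upwards [hf (η / c) (by positivity)] with k hk y hy
    rw [← mul_sub, abs_mul, abs_of_pos hc]
    have := hk _ (hmem y hy)
    rwa [le_div_iff₀ hc, mul_comm] at this
  refine ⟨hs, mul_pos hc L.M_pos, ?_, fun k => (L.sol k).affine hc hr h, ?_, by fun_prop,
    by fun_prop, key u U L.unif_u, key v V L.unif_v⟩
  · have := L.tendsto_κ.atTop_mul_const (show 0 < r ^ 2 / c ^ 2 by positivity)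
    simpa only [mul_div_assoc] using this
  · intro k y hy
    have := L.bdd k _ (hmem y hy)
    exact ⟨by gcongr; exact this.1, by gcongr; exact this.2⟩

lemma LimSeq.tendsto_u (L : LimSeq κ u v U V x R M) {z : E n} (hz : z ∈ ball x R) :
    Tendsto (fun k => u k z) atTop (𝓝 (U z)) := by
  rw [Metric.tendsto_nhds]
  intro ε hε
  filter_upwards [L.unif_u (ε / 2) (by positivity)] with k hk
  rw [Real.dist_eq]
  linarith [hk z hz]

lemma LimSeq.tendsto_v (L : LimSeq κ u v U V x R M) {z : E n} (hz : z ∈ ball x R) :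
    Tendsto (fun k => v k z) atTop (𝓝 (V z)) := L.symm.tendsto_u hz

lemma LimSeq.U_nonneg (L : LimSeq κ u v U V x R M) {z : E n} (hz : z ∈ ball x R) : 0 ≤ U z :=
  ge_of_tendsto' (L.tendsto_u hz) fun k => ((L.sol k).u_pos z hz).le

lemma LimSeq.V_nonneg (L : LimSeq κ u v U V x R M) {z : E n} (hz : z ∈ ball x R) : 0 ≤ V z :=
  L.symm.U_nonneg hz

lemma tendsto_J {m : ℕ} (hm : m ≠ 0) {F : ℕ → E n → ℝ} {G : E n → ℝ} {M : ℝ}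
    (hF : ∀ k, Continuous (F k)) (hM : ∀ k, ∀ y ∈ ball (0 : E n) 1, |F k y| ≤ M)
    (h : ∀ y ∈ ball (0 : E n) 1, Tendsto (fun k => F k y) atTop (𝓝 (G y))) :
    Tendsto (fun k => J m (F k)) atTop (𝓝 (J m G)) := by
  unfold J
  apply tendsto_integral_of_dominated_convergence (fun y => M * q m y)
  · intro k
    exact (integrable_mul_q hm (hF k)).aestronglyMeasurable
  · exact integrable_mul_q hm continuous_const
  · intro k
    filter_upwards with y
    by_cases hy : y ∈ ball (0 : E n) 1
    · rw [norm_mul, Real.norm_of_nonneg (q_nonneg m y)]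
      exact mul_le_mul_of_nonneg_right (hM k y hy) (q_nonneg m y)
    · simp [q_eq_zero hm hy]
  · filter_upwards with y
    by_cases hy : y ∈ ball (0 : E n) 1
    · exact (h y hy).mul_const _
    · simp [q_eq_zero hm hy]

/-- A continuous nonnegative function with vanishing weighted integral vanishes on the ball. -/
lemma eq_zero_of_J {m : ℕ} (hm : m ≠ 0) {F : E n → ℝ} (hF : Continuous F)
    (h0 : ∀ y ∈ ball (0 : E n) 1, 0 ≤ F y) (hJ : J m F = 0) : ∀ y ∈ ball (0 : E n) 1, F y = 0 := by
  intro y hy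
  by_contra hne
  have hpos : 0 < J m F := by
    unfold J
    apply Continuous.integral_pos_of_hasCompactSupport_nonneg_nonzero (x := y)
    · exact hF.mul (continuous_q m)
    · exact (hasCompactSupport_q hm).mul_left
    · intro z
      by_cases hz : z ∈ ball (0 : E n) 1
      · exact mul_nonneg (h0 z hz) (q_nonneg m z)
      · simp [q_eq_zero hm hz]
    · exact mul_ne_zero hne (q_pos m hy).ne'
  exact hpos.ne' hJ

lemma LimSeq.abs_u_le (L : LimSeq κ u v U V x R M) {r : ℝ} (hr : 0 ≤ r) (hrR : r ≤ R) (k : ℕ)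
    {y : E n} (hy : y ∈ ball (0 : E n) 1) : |u k (x + r • y)| ≤ M := by
  have hm := add_smul_mem_ball (x := x) hr L.R_pos hrR hy
  rw [abs_of_pos ((L.sol k).u_pos _ hm)]
  exact (L.bdd k _ hm).1

lemma LimSeq.tendsto_H (L : LimSeq κ u v U V x R M) {r : ℝ} (hr : 0 ≤ r) (hrR : r ≤ R) :
    Tendsto (fun k => H (u k) (v k) x r) atTop (𝓝 (H U V x r)) := by
  unfold H
  apply Tendsto.const_mul
  apply tendsto_J two_ne_zero (M := M ^ 2 + M ^ 2)
  · intro k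
    have := (L.sol k).hu.continuous
    have := (L.sol k).hv.continuous
    fun_prop
  · intro k y hy
    rw [abs_of_nonneg (by positivity)]
    have h1 := sq_le_sq' (abs_le.1 (L.abs_u_le hr hrR k hy)).1 (abs_le.1 (L.abs_u_le hr hrR k hy)).2
    have h2 := sq_le_sq' (abs_le.1 (L.symm.abs_u_le hr hrR k hy)).1
      (abs_le.1 (L.symm.abs_u_le hr hrR k hy)).2
    linarith
  · intro y hy
    have hm := add_smul_mem_ball (x := x) hr L.R_pos hrR hy
    exact ((L.tendsto_u hm).pow 2).add ((L.tendsto_v hm).pow 2)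

lemma LimSeq.tendsto_X (L : LimSeq κ u v U V x R M) (a : ℝ) {r₁ r₂ : ℝ} (hr₁ : 0 < r₁)
    (hr₂ : 0 < r₂) (h1 : r₁ ≤ R) (h2 : r₂ ≤ R) :
    Tendsto (fun k => X (u k) (v k) x a r₁ r₂) atTop (𝓝 (X U V x a r₁ r₂)) := by
  unfold X
  apply Tendsto.const_mul
  have hM := L.M_pos
  have p1 : 0 < r₁ ^ (-a) := Real.rpow_pos_of_pos hr₁ _
  have p2 : 0 < r₂ ^ (-a) := Real.rpow_pos_of_pos hr₂ _
  set A := r₂ ^ (-a) * M + r₁ ^ (-a) * M with hA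
  have key : ∀ {s t : ℝ}, |s| ≤ M → |t| ≤ M → (r₂ ^ (-a) * s - r₁ ^ (-a) * t) ^ 2 ≤ A ^ 2 := by
    intro s t hs ht
    rw [abs_le] at hs ht
    apply sq_le_sq' <;> nlinarith
  apply tendsto_J two_ne_zero (M := A ^ 2 + A ^ 2)
  · intro k
    have := (L.sol k).hu.continuous
    have := (L.sol k).hv.continuous
    fun_prop
  · intro k y hy
    rw [abs_of_nonneg (by positivity)]
    exact add_le_add (key (L.abs_u_le hr₂.le h2 k hy) (L.abs_u_le hr₁.le h1 k hy))
      (key (L.symm.abs_u_le hr₂.le h2 k hy) (L.symm.abs_u_le hr₁.le h1 k hy))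
  · intro y hy
    have hm1 := add_smul_mem_ball (x := x) hr₁.le L.R_pos h1 hy
    have hm2 := add_smul_mem_ball (x := x) hr₂.le L.R_pos h2 hy
    exact ((((L.tendsto_u hm2).const_mul _).sub ((L.tendsto_u hm1).const_mul _)).pow 2).add
      ((((L.tendsto_v hm2).const_mul _).sub ((L.tendsto_v hm1).const_mul _)).pow 2)

lemma LimSeq.sup_sq_le (n : ℕ) : ∃ C : ℝ, 0 < C ∧ ∀ (κ : ℕ → ℝ) (u v : ℕ → E n → ℝ)
    (U V : E n → ℝ) (x : E n) (R M : ℝ), LimSeq κ u v U V x R M →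
      ∀ z ∈ closedBall x (R / 2), U z ^ 2 ≤ C * H U V x R ∧ V z ^ 2 ≤ C * H U V x R := by
  obtain ⟨C, hC, h⟩ := Sol.sup_sq_le n
  refine ⟨C, hC, fun κ u v U V x R M L z hz => ?_⟩
  have hz' : z ∈ ball x R := closedBall_subset_ball (by linarith [L.R_pos]) hz
  have hH := (L.tendsto_H L.R_pos.le le_rfl).const_mul C
  exact ⟨le_of_tendsto_of_tendsto' ((L.tendsto_u hz').pow 2) hH fun k =>
      (h _ _ _ _ _ (L.sol k) L.R_pos z hz).1,
    le_of_tendsto_of_tendsto' ((L.tendsto_v hz').pow 2) hH fun k =>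
      (h _ _ _ _ _ (L.sol k) L.R_pos z hz).2⟩

lemma LimSeq.H_le (L : LimSeq κ u v U V x R M) {r A : ℝ} (hr : 0 < r) (hrR : r ≤ R)
    (hA : ∀ z ∈ ball x r, U z ≤ A ∧ V z ≤ A) : H U V x r ≤ 12 * cw n 2 * A ^ 2 := by
  have cU := L.cU
  have cV := L.cV
  have : J 2 (fun y => U (x + r • y) ^ 2 + V (x + r • y) ^ 2) ≤ 2 * A ^ 2 * cw n 2 := by
    apply J_le two_ne_zero (by fun_prop)
    intro y hy
    have hm := add_smul_mem_ball (x := x) hr.le L.R_pos hrR hy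
    have h1 := hA _ (add_smul_mem_ball (x := x) hr.le hr le_rfl hy)
    have h2 := L.U_nonneg hm
    have h3 := L.V_nonneg hm
    nlinarith
  unfold H
  linarith

end

/-! ### Segregation and harmonicity of limits -/

section

variable {κ : ℕ → ℝ} {u v : ℕ → E n → ℝ} {U V : E n → ℝ} {x : E n} {R M : ℝ}

lemma pd_coord (i : Fin n) (y : E n) : pd i (fun y : E n => y i) y = 1 := by
  unfold pd
  have : HasFDerivAt (fun y : E n => y i) (EuclideanSpace.proj i : E n →L[ℝ] ℝ) y :=
    (EuclideanSpace.proj i : E n →L[ℝ] ℝ).hasFDerivAt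
  rw [this.fderiv]
  simp

/-- Weighted integrals of the Laplacian of a bounded nonnegative function are bounded. -/
lemma sq_mul_J_lap_le {f : E n → ℝ} (hf : ContDiff ℝ ∞ f) {x : E n} {r R M : ℝ} (hr : 0 ≤ r)
    (hR : 0 < R) (hrR : r ≤ R) (h0 : ∀ z ∈ ball x R, 0 ≤ f z) (hM : ∀ z ∈ ball x R, f z ≤ M) :
    r ^ 2 * J 3 (fun y => lap f (x + r • y)) ≤ 24 * M * cw n 1 := by
  have cf := hf.continuous
  have hg : ContDiff ℝ ∞ (fun y => f (x + r • y)) := contDiff_affine' hf x r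
  have hmem := fun y (hy : y ∈ ball (0 : E n) 1) => add_smul_mem_ball (x := x) hr hR hrR hy
  have hG : ∀ i : Fin n, ContDiff ℝ ∞ (fun y : E n => f (x + r • y) * y i) := fun i => by
    apply hg.mul
    exact (EuclideanSpace.proj i : E n →L[ℝ] ℝ).contDiff
  have h1 : r ^ 2 * J 3 (fun y => lap f (x + r • y)) =
      6 * J 2 (fun y => r * fderiv ℝ f (x + r • y) y) := by
    rw [J_const_mul, J_fderiv one_le_two hf x r]
    norm_num
    ring
  have h2 : ∀ y ∈ ball (0 : E n) 1, r * fderiv ℝ f (x + r • y) y ≤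
      ∑ i, pd i (fun y : E n => f (x + r • y) * y i) y := by
    intro y hy
    rw [fderiv_eq_sum, Finset.mul_sum]
    apply Finset.sum_le_sum
    intro i _
    have hp : DifferentiableAt ℝ (fun y : E n => y i) y :=
      (EuclideanSpace.proj i : E n →L[ℝ] ℝ).differentiableAt
    rw [pd_mul i (diff_of_smooth hg y) hp, pd_affine (diff_of_smooth hf), pd_coord]
    have := h0 _ (hmem y hy)
    linarith
  have h3 : J 2 (fun y => r * fderiv ℝ f (x + r • y) y) ≤
      J 2 (fun y => ∑ i, pd i (fun y : E n => f (x + r • y) * y i) y) := by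
    apply J_mono two_ne_zero _ _ h2
    · exact continuous_const.mul (continuous_fderiv_apply hf x r)
    · exact continuous_finsetSum _ fun i _ => (contDiff_pd (hG i) i).continuous
  have h4 : J 2 (fun y => ∑ i, pd i (fun y : E n => f (x + r • y) * y i) y) =
      4 * J 1 (fun y => ∑ i, f (x + r • y) * y i * y i) := by
    rw [J_sum two_ne_zero fun i => (contDiff_pd (hG i) i).continuous,
      J_sum one_ne_zero fun i => by fun_prop, Finset.mul_sum]
    apply Finset.sum_congr rfl
    intro i _
    have := J_div le_rfl i ((hG i).of_le (m := 1) (by exact_mod_cast le_top))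
    norm_num at this
    rw [this]
  have h5 : J 1 (fun y => ∑ i, f (x + r • y) * y i * y i) ≤ M * cw n 1 := by
    apply J_le one_ne_zero (by fun_prop)
    intro y hy
    have e : ∑ i, f (x + r • y) * y i * y i = f (x + r • y) * ‖y‖ ^ 2 := by
      rw [EuclideanSpace.norm_sq_eq, Finset.mul_sum]
      simp [mul_assoc, sq]
    rw [e]
    have a1 := h0 _ (hmem y hy)
    have a2 := hM _ (hmem y hy)
    have a3 : ‖y‖ < 1 := by simpa using hy
    have a4 : ‖y‖ ^ 2 ≤ 1 := by nlinarith [norm_nonneg y]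
    nlinarith [norm_nonneg y]
  linarith

lemma exists_ball_gt {F : E n → ℝ} (hF : Continuous F) {z : E n} (hz : z ∈ ball x R)
    {m : ℝ} (hm : m < F z) : ∃ s > 0, ball z s ⊆ ball x R ∧ ∀ w ∈ ball z s, m < F w := by
  have h1 : ∀ᶠ w in 𝓝 z, w ∈ ball x R ∧ m < F w :=
    Filter.Eventually.and (isOpen_ball.mem_nhds hz) (hF.continuousAt.eventually (lt_mem_nhds hm))
  obtain ⟨s, hs, h⟩ := Metric.eventually_nhds_iff_ball.1 h1
  exact ⟨s, hs, fun w hw => (h w hw).1, fun w hw => (h w hw).2⟩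

lemma LimSeq.eventually_ge (L : LimSeq κ u v U V x R M) {z : E n} (hz : z ∈ ball x R)
    (h : 0 < U z) : ∃ s > 0, ∃ m > 0, ball z s ⊆ ball x R ∧
      ∀ᶠ k in atTop, ∀ w ∈ ball z s, m ≤ u k w := by
  obtain ⟨s, hs, hsub, hw⟩ := exists_ball_gt L.cU hz (half_lt_self h)
  refine ⟨s, hs, U z / 4, by positivity, hsub, ?_⟩
  filter_upwards [L.unif_u (U z / 4) (by positivity)] with k hk w hw'
  have := abs_le.1 (hk w (hsub hw'))
  linarith [hw w hw']

lemma LimSeq.segregated (L : LimSeq κ u v U V x R M) {z : E n} (hz : z ∈ ball x R) :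
    U z = 0 ∨ V z = 0 := by
  by_contra! hcon
  have hU := lt_of_le_of_ne (L.U_nonneg hz) hcon.1.symm
  have hV := lt_of_le_of_ne (L.V_nonneg hz) hcon.2.symm
  obtain ⟨s, hs, m, hm, hsub, h1⟩ := L.eventually_ge hz hU
  obtain ⟨s', hs', m', hm', hsub', h2⟩ := L.symm.eventually_ge hz hV
  set t := min s s'
  have ht : 0 < t := lt_min hs hs'
  have c2 := cw_pos (n := n) two_ne_zero
  have htend : Tendsto (fun k => κ k * (m * m' ^ 2) * cw n 2 * t ^ 2 / 8) atTop atTop := by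
    have := L.tendsto_κ.atTop_mul_const (show 0 < (m * m' ^ 2) * cw n 2 * t ^ 2 / 8 by positivity)
    refine this.congr fun k => ?_
    ring
  obtain ⟨k, hk1, hk2, hk3⟩ := (h1.and (h2.and
    (htend.eventually (eventually_gt_atTop (M * cw n 1))))).exists
  have S := L.sol k
  have hκ := S.hκ
  have hmv := mean_value (m := 1) le_rfl S.hu (x := z) (R := t) (L := κ k * (m * m' ^ 2)) ht.le (by
    intro w hw
    have w1 := ball_subset_ball (min_le_left s s') hw
    have w2 := ball_subset_ball (min_le_right s s') hw
    rw [S.lap_u w (hsub w1)]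
    have := hk1 w w1
    have := hk2 w w2
    have := S.u_pos w (hsub w1)
    gcongr)
  have hle : J 1 (fun y => u k (z + t • y)) ≤ M * cw n 1 := by
    have := S.hu.continuous
    apply J_le one_ne_zero (by fun_prop)
    intro y hy
    have := add_smul_mem_ball (x := z) ht.le ht le_rfl hy
    exact (L.bdd k _ (hsub (ball_subset_ball (min_le_left s s') this))).1
  have h0 : 0 < u k z * cw n 1 := mul_pos (S.u_pos z hz) (cw_pos one_ne_zero)
  norm_num at hmv
  linarith

lemma LimSeq.lap_small_of_pos (L : LimSeq κ u v U V x R M) {z : E n} (hz : z ∈ ball x R)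
    (h : 0 < U z) : ∃ s > 0, ball z s ⊆ ball x R ∧ ∀ η > 0, ∀ᶠ k in atTop, ∀ w ∈ ball z s,
      |lap (u k) w| ≤ η ∧ |lap (v k) w| ≤ η := by
  obtain ⟨s, hs, m, hm, hsub, h1⟩ := L.eventually_ge hz h
  obtain ⟨C, hC, hdec⟩ := Sol.decay n
  have hM := L.M_pos
  refine ⟨s / 4, by positivity, (ball_subset_ball (by linarith)).trans hsub, fun η hη => ?_⟩
  set Q := C * M / (m ^ 2 * s ^ 2) ^ 2
  have hQ : 0 < Q := by positivity
  have hb : ∀ B : ℝ, 0 < B → ∀ᶠ k in atTop, B / κ k ≤ η := by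
    intro B hB
    filter_upwards [L.tendsto_κ.eventually (eventually_ge_atTop (B / η)),
      L.tendsto_κ.eventually (eventually_gt_atTop 0)] with k hk hk0
    rw [div_le_iff₀ hk0]
    rw [div_le_iff₀ hη] at hk
    linarith
  filter_upwards [h1, hb (M * Q ^ 2) (by positivity), hb (Q * M ^ 2) (by positivity),
    L.tendsto_κ.eventually (eventually_ge_atTop 1)] with k hk hk1 hk2 hk3 w hw
  have S := L.sol k
  have hκ := S.hκ
  have hv := hdec (κ k) (u k) (v k) z s M (κ k * m ^ 2) (S.mono hsub) hs (by positivity)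
    (fun y hy => (L.bdd k y (hsub hy)).2) (fun y hy => by gcongr; exact hk y hy) w hw
  have e : C * M / (κ k * m ^ 2 * s ^ 2) ^ 2 = Q / κ k ^ 2 := by
    simp only [Q]
    rw [div_div]
    congr 1
    ring
  rw [e] at hv
  have hw' := hsub (ball_subset_ball (by linarith : s / 4 ≤ s) hw)
  have u0 := S.u_pos w hw'
  have v0 := S.v_pos w hw'
  have uM := (L.bdd k w hw').1
  rw [S.lap_u w hw', S.lap_v w hw', abs_of_pos (by positivity), abs_of_pos (by positivity)]
  constructor
  · calc κ k * (u k w * v k w ^ 2) ≤ κ k * (M * (Q / κ k ^ 2) ^ 2) := by gcongr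
      _ = M * Q ^ 2 / κ k / κ k ^ 2 := by field_simp
      _ ≤ M * Q ^ 2 / κ k := div_le_self (by positivity) (one_le_pow₀ hk3)
      _ ≤ η := hk1
  · calc κ k * (v k w * u k w ^ 2) ≤ κ k * (Q / κ k ^ 2 * M ^ 2) := by gcongr
      _ = Q * M ^ 2 / κ k := by field_simp
      _ ≤ η := hk2

lemma LimSeq.lap_small (L : LimSeq κ u v U V x R M) {z : E n} (hz : z ∈ ball x R)
    (h : U z ≠ 0 ∨ V z ≠ 0) : ∃ s > 0, ball z s ⊆ ball x R ∧ ∀ η > 0, ∀ᶠ k in atTop,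
      ∀ w ∈ ball z s, |lap (u k) w| ≤ η ∧ |lap (v k) w| ≤ η := by
  rcases h with h | h
  · exact L.lap_small_of_pos hz (lt_of_le_of_ne (L.U_nonneg hz) h.symm)
  · obtain ⟨s, hs, hsub, hh⟩ := L.symm.lap_small_of_pos hz (lt_of_le_of_ne (L.V_nonneg hz) h.symm)
    exact ⟨s, hs, hsub, fun η hη => (hh η hη).mono fun _ hk w hw => (hk w hw).symm⟩

lemma LimSeq.P_small (L : LimSeq κ u v U V x R M) {η : ℝ} (hη : 0 < η) :
    ∀ᶠ k in atTop, ∀ r ∈ Ioc 0 R, P (κ k) (u k) (v k) x r ≤ η := by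
  have c1 := cw_pos (n := n) one_ne_zero
  have hM := L.M_pos
  set δ := η / (48 * M * cw n 1) with hδ
  have hδ0 : 0 < δ := by positivity
  filter_upwards [L.unif_u δ hδ0, L.unif_v δ hδ0] with k hk1 hk2 r hr
  have S := L.sol k
  have hκ := S.hκ
  have cu := (contDiff_lap S.hu).continuous
  have cv := (contDiff_lap S.hv).continuous
  have cu' := S.hu.continuous
  have cv' := S.hv.continuous
  have hmem := fun y (hy : y ∈ ball (0 : E n) 1) =>
    add_smul_mem_ball (x := x) hr.1.le L.R_pos hr.2 hy
  have h1 := sq_mul_J_lap_le S.hu hr.1.le L.R_pos hr.2 (fun z hz => (S.u_pos z hz).le)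
    (fun z hz => (L.bdd k z hz).1)
  have h2 := sq_mul_J_lap_le S.hv hr.1.le L.R_pos hr.2 (fun z hz => (S.v_pos z hz).le)
    (fun z hz => (L.bdd k z hz).2)
  have h3 : J 3 (fun y => κ k * (u k (x + r • y) ^ 2 * v k (x + r • y) ^ 2)) ≤
      J 3 (fun y => δ * (lap (u k) (x + r • y) + lap (v k) (x + r • y))) := by
    apply J_mono three_ne_zero (by fun_prop) (by fun_prop)
    intro y hy
    have hz := hmem y hy
    set z := x + r • y
    have u0 := S.u_pos z hz
    have v0 := S.v_pos z hz
    rw [S.lap_u z hz, S.lap_v z hz]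
    rcases L.segregated hz with h | h
    · have : u k z ≤ δ := by
        have := abs_le.1 (hk1 z hz)
        linarith
      calc κ k * (u k z ^ 2 * v k z ^ 2) = u k z * (κ k * (u k z * v k z ^ 2)) := by ring
        _ ≤ δ * (κ k * (u k z * v k z ^ 2)) := by gcongr
        _ ≤ _ := by gcongr; exact le_add_of_nonneg_right (by positivity)
    · have : v k z ≤ δ := by
        have := abs_le.1 (hk2 z hz)
        linarith
      calc κ k * (u k z ^ 2 * v k z ^ 2) = v k z * (κ k * (v k z * u k z ^ 2)) := by ring
        _ ≤ δ * (κ k * (v k z * u k z ^ 2)) := by gcongr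
        _ ≤ _ := by gcongr; exact le_add_of_nonneg_left (by positivity)
  rw [J_const_mul 3 δ, J_add three_ne_zero (by fun_prop) (by fun_prop)] at h3
  unfold P
  calc r ^ 2 * J 3 (fun y => κ k * (u k (x + r • y) ^ 2 * v k (x + r • y) ^ 2))
      ≤ r ^ 2 * (δ * (J 3 (fun y => lap (u k) (x + r • y)) +
        J 3 (fun y => lap (v k) (x + r • y)))) := by gcongr
    _ = δ * (r ^ 2 * J 3 (fun y => lap (u k) (x + r • y)) +
        r ^ 2 * J 3 (fun y => lap (v k) (x + r • y))) := by ring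
    _ ≤ δ * (24 * M * cw n 1 + 24 * M * cw n 1) := by gcongr
    _ = η := by rw [hδ]; field_simp; norm_num

end

/-! ### Frequency of limits and homogeneity -/

section

variable {κ : ℕ → ℝ} {u v : ℕ → E n → ℝ} {U V : E n → ℝ} {x : E n} {R M : ℝ}

lemma tendsto_base_rpow {ι : Type*} {l : Filter ι} {c b : ℝ} (hc : 0 < c) {f : ι → ℝ}
    (h : Tendsto f l (𝓝 b)) : Tendsto (fun i => c ^ f i) l (𝓝 (c ^ b)) :=
  (Real.continuousAt_const_rpow hc.ne').tendsto.comp h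

lemma LimSeq.exists_freq (L : LimSeq κ u v U V x R M) {s : ℝ} (hs : 0 < s) (hsR : s < R)
    (h0 : 0 < H U V x s) : ∃ ν : ℝ, 0 ≤ ν ∧ ∃ φ : ℕ → ℕ, StrictMono φ ∧
      Tendsto (fun k => D (κ (φ k)) (u (φ k)) (v (φ k)) x s / H (u (φ k)) (v (φ k)) x s)
        atTop (𝓝 ν) := by
  set N : ℕ → ℝ := fun k => D (κ k) (u k) (v k) x s / H (u k) (v k) x s with hN
  have hlog : 0 < Real.log (R / s) := Real.log_pos ((one_lt_div hs).2 hsR)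
  have c2 := cw_pos (n := n) two_ne_zero
  set A := 12 * cw n 2 * M ^ 2 with hA
  set B := A / (H U V x s / 2) / (Real.log (R / s) * 2) with hB
  have hev : ∀ᶠ k in atTop, N k ∈ Icc 0 B := by
    filter_upwards [(L.tendsto_H hs.le hsR.le).eventually (lt_mem_nhds (half_lt_self h0))] with k hk
    have alm := (L.sol k).alm
    have hs' : s ∈ Ioc 0 R := ⟨hs, hsR.le⟩
    refine ⟨alm.freq_nonneg hs', ?_⟩
    have h1 := alm.h_lower hs hsR.le le_rfl
    have h2 := (L.sol k).H_le L.R_pos (L.bdd k) L.R_pos.le le_rfl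
    have hpos : 0 < R / s := div_pos L.R_pos hs
    have h3 : Real.log (R / s) * (2 * N k) + 1 ≤ (R / s) ^ (2 * N k) := by
      rw [Real.rpow_def_of_pos hpos]
      exact Real.add_one_le_exp _
    have h4 : (R / s) ^ (2 * N k) ≤ A / (H U V x s / 2) := by
      rw [le_div_iff₀ (by positivity)]
      have : 0 ≤ (R / s) ^ (2 * N k) := by positivity
      have : (R / s) ^ (2 * N k) * (H U V x s / 2) ≤ (R / s) ^ (2 * N k) * H (u k) (v k) x s := by
        gcongr
      linarith
    rw [hB, le_div_iff₀ (by positivity)]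
    linarith
  obtain ⟨ν, hν, φ, hφ, hlim⟩ := isCompact_Icc.tendsto_subseq' hev.frequently
  exact ⟨ν, hν.1, φ, hφ, hlim⟩

lemma LimSeq.lower_of_tendsto (L : LimSeq κ u v U V x R M) {s ν : ℝ} (hs : 0 < s) (hsR : s ≤ R)
    (h0 : 0 < H U V x s)
    (hN : Tendsto (fun k => D (κ k) (u k) (v k) x s / H (u k) (v k) x s) atTop (𝓝 ν)) :
    ∀ t ∈ Ioc 0 R, H U V x s * (t / s) ^ (2 * ν) ≤ H U V x t := by
  intro t ht
  have hHs := L.tendsto_H hs.le hsR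
  have hHt := L.tendsto_H ht.1.le ht.2
  rcases le_total s t with hst | hst
  · have hpos : 0 < t / s := div_pos ht.1 hs
    refine le_of_tendsto_of_tendsto' (hHs.mul (tendsto_base_rpow hpos (hN.const_mul 2))) hHt
      fun k => ?_
    exact (L.sol k).alm.h_lower hs hst ht.2
  · have hpos : 0 < s / t := div_pos hs ht.1
    have h1 : H U V x s ≤ H U V x t * (s / t) ^ (4 * ν) := by
      refine le_of_tendsto_of_tendsto' hHs
        (hHt.mul (tendsto_base_rpow hpos (hN.const_mul 4))) fun k => ?_
      exact (L.sol k).alm.h_upper ht.1 hst hsR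
    have h2 : 0 < H U V x t := by
      by_contra! hcon
      have : H U V x t * (s / t) ^ (4 * ν) ≤ 0 := mul_nonpos_of_nonpos_of_nonneg hcon (by positivity)
      linarith
    have h3 : ∀ ε > 0, H U V x s ≤ H U V x t * (s / t) ^ (2 * (ν + ε / H U V x t)) := by
      intro ε hε
      refine le_of_tendsto_of_tendsto hHs (hHt.mul (tendsto_base_rpow hpos ((hN.add
        ((tendsto_const_nhds (x := ε)).div hHt h2.ne')).const_mul 2))) ?_
      filter_upwards [L.P_small hε] with k hk
      exact (L.sol k).alm.h_upper_of_p_le ht.1 hst hsR fun ρ hρ => hk ρ ⟨ht.1.trans_le hρ.1, hρ.2.trans hsR⟩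
    have h4 : H U V x s ≤ H U V x t * (s / t) ^ (2 * ν) := by
      have hc : Tendsto (fun ε : ℝ => H U V x t * (s / t) ^ (2 * (ν + ε / H U V x t))) (𝓝[>] 0)
          (𝓝 (H U V x t * (s / t) ^ (2 * (ν + 0 / H U V x t)))) := by
        apply Tendsto.const_mul
        apply tendsto_base_rpow hpos
        apply Tendsto.const_mul
        apply Tendsto.const_add
        apply Tendsto.div_const
        exact tendsto_id.mono_left nhdsWithin_le_nhds
      rw [zero_div, add_zero] at hc
      exact ge_of_tendsto hc (eventually_mem_nhdsWithin.mono fun ε hε => h3 ε hε)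
    have e : (t / s) ^ (2 * ν) = ((s / t) ^ (2 * ν))⁻¹ := by
      rw [← Real.inv_rpow hpos.le, inv_div]
    rw [e, ← div_eq_mul_inv, div_le_iff₀ (by positivity)]
    exact h4

lemma LimSeq.holder (L : LimSeq κ u v U V x R M) (hU : U x = 0) (hV : V x = 0) {β : ℝ}
    (hP : HolderP n β) : ∃ C > 0, ∀ y ∈ ball x R, U y + V y ≤ C * ‖y - x‖ ^ β := by
  obtain ⟨C, hC, h⟩ := hP.scaled
  have hM := L.M_pos
  have hR := L.R_pos
  refine ⟨C * M / R ^ β, by positivity, fun y hy => ?_⟩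
  have hx : x ∈ ball x R := mem_ball_self hR
  have key : ∀ k, u k y - u k x + (v k y - v k x) ≤ C * M / R ^ β * ‖y - x‖ ^ β := by
    intro k
    have := h _ _ _ _ _ _ (L.sol k) hR hM (L.bdd k) y hy
    rw [Real.div_rpow (norm_nonneg _) hR.le] at this
    have e : C * M / R ^ β * ‖y - x‖ ^ β = C * M * (‖y - x‖ ^ β / R ^ β) := by ring
    rw [e]
    linarith [le_abs_self (u k y - u k x), le_abs_self (v k y - v k x)]
  have hlim := ((L.tendsto_u hy).sub (L.tendsto_u hx)).add ((L.tendsto_v hy).sub (L.tendsto_v hx))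
  have := le_of_tendsto' hlim key
  rw [hU, hV] at this
  linarith

/-- At a zero of the limit, the frequency is at least the available Hölder exponent. -/
lemma LimSeq.le_freq (L : LimSeq κ u v U V x R M) (hU : U x = 0) (hV : V x = 0) {a : ℝ}
    (hP : ∀ β : ℝ, 0 ≤ β → β < a → HolderP n β) {s ν c : ℝ} (hs : 0 < s) (hν : 0 ≤ ν)
    (hc : 0 < c) (h : ∀ t ∈ Ioc 0 R, c * (t / s) ^ (2 * ν) ≤ H U V x t) : a ≤ ν := by
  by_contra! hlt
  obtain ⟨β, hβ1, hβ2⟩ := exists_between hlt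
  obtain ⟨C, hC, hh⟩ := L.holder hU hV (hP β (hν.trans hβ1.le) hβ2)
  have c2 := cw_pos (n := n) two_ne_zero
  have hR := L.R_pos
  have key : ∀ t ∈ Ioc 0 R, c / s ^ (2 * ν) ≤ 12 * cw n 2 * C ^ 2 * t ^ (2 * (β - ν)) := by
    intro t ht
    have h1 := h t ht
    have h2 := L.H_le (A := C * t ^ β) ht.1 ht.2 (by
      intro z hz
      have hz' := ball_subset_ball ht.2 hz
      have h3 := hh z hz'
      have h4 := L.U_nonneg hz'
      have h5 := L.V_nonneg hz'
      have h6 : ‖z - x‖ ^ β ≤ t ^ β := by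
        apply Real.rpow_le_rpow (norm_nonneg _) _ (by linarith)
        rw [mem_ball, dist_eq_norm] at hz
        exact hz.le
      have h7 : C * ‖z - x‖ ^ β ≤ C * t ^ β := by gcongr
      constructor <;> linarith)
    have e1 : (t / s) ^ (2 * ν) = t ^ (2 * ν) / s ^ (2 * ν) := Real.div_rpow ht.1.le hs.le _
    have e2 : (C * t ^ β) ^ 2 = C ^ 2 * (t ^ (2 * (β - ν)) * t ^ (2 * ν)) := by
      rw [mul_pow, ← Real.rpow_add ht.1, ← Real.rpow_natCast, ← Real.rpow_natCast,
        ← Real.rpow_mul ht.1.le]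
      congr 2
      push_cast
      ring
    have hp : 0 < t ^ (2 * ν) := Real.rpow_pos_of_pos ht.1 _
    rw [e1] at h1
    rw [e2] at h2
    refine le_of_mul_le_mul_right ?_ hp
    calc c / s ^ (2 * ν) * t ^ (2 * ν) = c * (t ^ (2 * ν) / s ^ (2 * ν)) := by ring
      _ ≤ _ := h1.trans h2
      _ = _ := by ring
  have hlim : Tendsto (fun t : ℝ => 12 * cw n 2 * C ^ 2 * t ^ (2 * (β - ν))) (𝓝[>] 0)
      (𝓝 (12 * cw n 2 * C ^ 2 * 0)) := by
    apply Tendsto.const_mul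
    have hp : 0 < 2 * (β - ν) := by linarith
    have := (Real.continuousAt_rpow_const 0 (2 * (β - ν)) (Or.inr hp.le)).tendsto
    rw [Real.zero_rpow hp.ne'] at this
    exact this.mono_left nhdsWithin_le_nhds
  have := ge_of_tendsto hlim (Filter.Eventually.mono (Ioc_mem_nhdsGT hR) key)
  rw [mul_zero] at this
  have : 0 < c / s ^ (2 * ν) := by positivity
  linarith

/-- A two-sided growth bound turns into an exact power law. -/
lemma power_law {h : ℝ → ℝ} {a R : ℝ}
    (hh : ∀ s ∈ Ioo 0 R, ∀ t ∈ Ioo 0 R, h s * (t / s) ^ (2 * a) ≤ h t) :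
    ∀ s ∈ Ioo 0 R, ∀ t ∈ Ioo 0 R, h t = h s * (t / s) ^ (2 * a) := by
  intro s hs t ht
  apply le_antisymm _ (hh s hs t ht)
  have h1 := hh t ht s hs
  have hpos : 0 < t / s := div_pos ht.1 hs.1
  have e : (s / t) ^ (2 * a) = ((t / s) ^ (2 * a))⁻¹ := by
    rw [← Real.inv_rpow hpos.le, inv_div]
  rwa [e, ← div_eq_mul_inv, div_le_iff₀ (by positivity)] at h1

lemma freq_eq_of_power {h : ℝ → ℝ} {a ν R : ℝ} {s : ℝ} (hs : s ∈ Ioo 0 R) (h0 : 0 < h s)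
    (hh : ∀ t ∈ Ioo 0 R, h t = h s * (t / s) ^ (2 * a))
    (hν : ∀ t ∈ Ioc 0 R, h s * (t / s) ^ (2 * ν) ≤ h t) : ν = a := by
  have key : ∀ t ∈ Ioo 0 R, (t / s) ^ (2 * ν) ≤ (t / s) ^ (2 * a) := by
    intro t ht
    have := hν t ⟨ht.1, ht.2.le⟩
    rw [hh t ht] at this
    exact le_of_mul_le_mul_left this h0
  apply le_antisymm
  · obtain ⟨t, ht1, ht2⟩ := exists_between hs.2
    have := key t ⟨hs.1.trans ht1, ht2⟩
    rw [Real.rpow_le_rpow_left_iff ((one_lt_div hs.1).2 ht1)] at this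
    linarith
  · have ht : s / 2 ∈ Ioo 0 R := ⟨half_pos hs.1, (half_lt_self hs.1).trans hs.2⟩
    have := key (s / 2) ht
    rw [Real.rpow_le_rpow_left_iff_of_base_lt_one (div_pos ht.1 hs.1)
      ((div_lt_one hs.1).2 (half_lt_self hs.1))] at this
    linarith

lemma LimSeq.homogeneous (L : LimSeq κ u v U V x R M) {a : ℝ} (ha : 0 ≤ a)
    (hh : ∀ s ∈ Ioo 0 R, ∀ t ∈ Ioo 0 R, H U V x t = H U V x s * (t / s) ^ (2 * a))
    (h0 : ∀ s ∈ Ioo 0 R, 0 < H U V x s) {r₁ r₂ : ℝ} (hr₁ : 0 < r₁) (h12 : r₁ ≤ r₂) (hr₂ : r₂ < R) :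
    ∀ y ∈ ball (0 : E n) 1, r₂ ^ (-a) * U (x + r₂ • y) = r₁ ^ (-a) * U (x + r₁ • y) ∧
      r₂ ^ (-a) * V (x + r₂ • y) = r₁ ^ (-a) * V (x + r₁ • y) := by
  have hr₂0 := hr₁.trans_le h12
  have m1 : r₁ ∈ Ioo 0 R := ⟨hr₁, h12.trans_lt hr₂⟩
  have m2 : r₂ ∈ Ioo 0 R := ⟨hr₂0, hr₂⟩
  have cU := L.cU
  have cV := L.cV
  obtain ⟨ν₁, -, φ₁, hφ₁, hl₁⟩ := L.exists_freq hr₁ m1.2 (h0 r₁ m1)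
  have L₁ := L.subseq hφ₁
  have e₁ := freq_eq_of_power m1 (h0 r₁ m1) (hh r₁ m1)
    (L₁.lower_of_tendsto hr₁ m1.2.le (h0 r₁ m1) hl₁)
  obtain ⟨ν₂, -, φ₂, hφ₂, hl₂⟩ := L₁.exists_freq hr₂0 hr₂ (h0 r₂ m2)
  have L₂ := L₁.subseq hφ₂
  have e₂ := freq_eq_of_power m2 (h0 r₂ m2) (hh r₂ m2)
    (L₂.lower_of_tendsto hr₂0 hr₂.le (h0 r₂ m2) hl₂)
  subst e₁
  have hW : ∀ r ∈ Ioo 0 R, Tendsto (fun k => D ((κ ∘ φ₁) (φ₂ k)) ((u ∘ φ₁) (φ₂ k)) ((v ∘ φ₁) (φ₂ k)) x r /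
      H ((u ∘ φ₁) (φ₂ k)) ((v ∘ φ₁) (φ₂ k)) x r) atTop (𝓝 ν₁) →
      Tendsto (fun k => W ((κ ∘ φ₁) (φ₂ k)) ((u ∘ φ₁) (φ₂ k)) ((v ∘ φ₁) (φ₂ k)) x ν₁ r) atTop (𝓝 0) := by
    intro r hr hN
    have h1 := ((hN.sub_const ν₁).mul (L₂.tendsto_H hr.1.le hr.2.le)).const_mul (r ^ (-(2 * ν₁)))
    rw [sub_self, zero_mul, mul_zero] at h1
    refine h1.congr fun k => ?_
    have hp := (L₂.sol k).H_pos L.R_pos r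
    simp only [Function.comp_apply] at hp ⊢
    unfold W
    field_simp
  have w1 := hW r₁ m1 (hl₁.comp hφ₂.tendsto_atTop)
  have w2 := hW r₂ m2 (by rw [e₂] at hl₂; exact hl₂)
  have hX := L₂.tendsto_X ν₁ hr₁ hr₂0 m1.2.le hr₂.le
  have hle : X U V x ν₁ r₁ r₂ ≤ 0 := by
    have h2 := ((w2.sub w1).div_const (2 * r₁)).const_mul (Real.exp r₂)
    rw [sub_zero, zero_div, mul_zero] at h2
    exact le_of_tendsto_of_tendsto' hX h2 fun k => (L₂.sol k).X_le ha hr₁ h12 hr₂.le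
  have hnn : ∀ y ∈ ball (0 : E n) 1, 0 ≤ (r₂ ^ (-ν₁) * U (x + r₂ • y) - r₁ ^ (-ν₁) * U (x + r₁ • y)) ^ 2 +
      (r₂ ^ (-ν₁) * V (x + r₂ • y) - r₁ ^ (-ν₁) * V (x + r₁ • y)) ^ 2 := fun y _ => by positivity
  have hJ := J_nonneg (m := 2) two_ne_zero hnn
  unfold X at hle
  intro y hy
  have := eq_zero_of_J two_ne_zero (by fun_prop) hnn (by linarith) y hy
  constructor <;> nlinarith [sq_nonneg (r₂ ^ (-ν₁) * U (x + r₂ • y) - r₁ ^ (-ν₁) * U (x + r₁ • y)),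
    sq_nonneg (r₂ ^ (-ν₁) * V (x + r₂ • y) - r₁ ^ (-ν₁) * V (x + r₁ • y))]

end

/-! ### Blow-up sequences -/

section

lemma exists_uniform_limit {K : Set (E n)} (hK : IsCompact K) {f : ℕ → E n → ℝ} {M C β : ℝ}
    (hβ : 0 < β) (hf : ∀ k, Continuous (f k)) (hM : ∀ k, ∀ y ∈ K, |f k y| ≤ M)
    (hC : ∀ k, ∀ y ∈ K, ∀ z ∈ K, |f k y - f k z| ≤ C * ‖y - z‖ ^ β) :
    ∃ (φ : ℕ → ℕ) (F : E n → ℝ), StrictMono φ ∧ Continuous F ∧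
      ∀ η > 0, ∀ᶠ k in atTop, ∀ z ∈ K, |f (φ k) z - F z| ≤ η := by
  have : CompactSpace K := isCompact_iff_compactSpace.1 hK
  let g : ℕ → BoundedContinuousFunction K ℝ := fun k =>
    BoundedContinuousFunction.mkOfCompact ⟨fun y : K => f k y, (hf k).comp continuous_subtype_val⟩
  have hcomp := BoundedContinuousFunction.arzela_ascoli (Icc (-M) M) isCompact_Icc (range g) (by
    rintro _ y ⟨k, rfl⟩
    exact abs_le.1 (hM k y y.2)) (by
    apply Metric.equicontinuous_of_continuity_modulus (fun t => C * t ^ β)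
    · have := ((Real.continuousAt_rpow_const 0 β (Or.inr hβ.le)).tendsto).const_mul C
      rwa [Real.zero_rpow hβ.ne', mul_zero] at this
    · rintro y z ⟨_, k, rfl⟩
      rw [Real.dist_eq, Subtype.dist_eq, dist_eq_norm]
      exact hC k y y.2 z z.2)
  obtain ⟨G, -, φ, hφ, hlim⟩ := hcomp.tendsto_subseq (x := g)
    fun k => subset_closure (mem_range_self k)
  obtain ⟨F, hF⟩ := ContinuousMap.exists_restrict_eq hK.isClosed G.toContinuousMap
  refine ⟨φ, F, hφ, F.continuous, fun η hη => ?_⟩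
  filter_upwards [(Metric.tendsto_nhds.1 hlim) η hη] with k hk z hz
  have h1 : F z = G ⟨z, hz⟩ := by
    have := congrArg (fun h : C(K, ℝ) => h ⟨z, hz⟩) hF
    simpa using this
  rw [h1, ← Real.dist_eq]
  exact (BoundedContinuousFunction.dist_coe_le_dist (f := g (φ k)) (g := G) ⟨z, hz⟩).trans hk.le

variable {κ : ℕ → ℝ} {u v : ℕ → E n → ℝ}

lemma exists_limSeq {β : ℝ} (hβ : 0 < β) (hP : HolderP n β) (hκ : Tendsto κ atTop atTop)
    (S : ∀ k, Sol (κ k) (u k) (v k) 0 1) (hH : ∀ k, H (u k) (v k) 0 1 = 1) :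
    ∃ (φ : ℕ → ℕ) (U V : E n → ℝ) (M : ℝ), StrictMono φ ∧
      LimSeq (κ ∘ φ) (u ∘ φ) (v ∘ φ) U V 0 (1 / 16) M := by
  obtain ⟨C₁, hC₁, hsup⟩ := Sol.sup_le n
  obtain ⟨C, hC, hh⟩ := hP.scaled
  have hb : ∀ k, ∀ z ∈ ball (0 : E n) (1 / 2), u k z ≤ C₁ ∧ v k z ≤ C₁ := by
    intro k z hz
    have := hsup _ _ _ _ _ (S k) one_pos z (ball_subset_closedBall hz)
    rwa [hH, Real.sqrt_one, mul_one] at this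
  have hK : closedBall (0 : E n) (1 / 16) ⊆ ball 0 (1 / 2) := closedBall_subset_ball (by norm_num)
  have hhalf : ball (0 : E n) (1 / 2) ⊆ ball 0 1 := ball_subset_ball (by norm_num)
  have hosc : ∀ k, ∀ y ∈ closedBall (0 : E n) (1 / 16), ∀ z ∈ closedBall (0 : E n) (1 / 16),
      |u k y - u k z| + |v k y - v k z| ≤ C * C₁ / (1 / 4) ^ β * ‖y - z‖ ^ β := by
    intro k y hy z hz
    rw [mem_closedBall] at hy hz
    have hsub : ball z (1 / 4) ⊆ ball (0 : E n) (1 / 2) := ball_subset_ball' (by linarith)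
    have hd : dist y z ≤ 1 / 8 := by linarith [dist_triangle_right y z 0]
    have := hh _ _ _ z (1 / 4) C₁ ((S k).mono (hsub.trans hhalf)) (by norm_num) hC₁
      (fun w hw => hb k w (hsub hw)) y (by rw [mem_ball]; linarith)
    rw [Real.div_rpow (norm_nonneg _) (by norm_num)] at this
    calc _ ≤ _ := this
      _ = _ := by ring
  obtain ⟨φ, U, hφ, cU, hU⟩ := exists_uniform_limit (isCompact_closedBall (0 : E n) (1 / 16))
    (f := u) (M := C₁) (C := C * C₁ / (1 / 4) ^ β) hβ (fun k => (S k).hu.continuous)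
    (fun k y hy => by
      rw [abs_of_pos ((S k).u_pos y (hhalf (hK hy)))]
      exact (hb k y (hK hy)).1)
    (fun k y hy z hz => by linarith [hosc k y hy z hz, abs_nonneg (v k y - v k z)])
  obtain ⟨ψ, V, hψ, cV, hV⟩ := exists_uniform_limit (isCompact_closedBall (0 : E n) (1 / 16))
    (f := v ∘ φ) (M := C₁) (C := C * C₁ / (1 / 4) ^ β) hβ (fun k => (S _).hv.continuous)
    (fun k y hy => by
      rw [Function.comp_apply, abs_of_pos ((S _).v_pos y (hhalf (hK hy)))]
      exact (hb _ y (hK hy)).2)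
    (fun k y hy z hz => by
      have := hosc (φ k) y hy z hz
      have := abs_nonneg (u (φ k) y - u (φ k) z)
      simp only [Function.comp_apply]
      linarith)
  refine ⟨φ ∘ ψ, U, V, C₁, hφ.comp hψ, by norm_num, hC₁,
    hκ.comp (hφ.comp hψ).tendsto_atTop, fun k => (S _).mono (ball_subset_ball (by norm_num)),
    fun k z hz => hb _ z (hK (ball_subset_closedBall hz)), cU, cV, fun η hη => ?_, fun η hη => ?_⟩
  · exact (hψ.tendsto_atTop.eventually (hU η hη)).mono
      fun k hk z hz => hk z (ball_subset_closedBall hz)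
  · exact (hV η hη).mono fun k hk z hz => hk z (ball_subset_closedBall hz)

/-- If the base regularity step fails at frequency `a`, a blow-up limit with exact
homogeneous growth exists. -/
lemma exists_blowup {a : ℝ} (ha : 0 < a) (hP : ∀ β : ℝ, 0 ≤ β → β < a → HolderP n β)
    (hn : ¬ Reg n a) : ∃ (κ : ℕ → ℝ) (u v : ℕ → E n → ℝ) (U V : E n → ℝ) (M : ℝ),
      LimSeq κ u v U V 0 (1 / 16) M ∧ U 0 = 0 ∧ V 0 = 0 ∧ (∀ s ∈ Ioo (0 : ℝ) (1 / 16), 0 < H U V 0 s) ∧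
      ∀ s ∈ Ioo (0 : ℝ) (1 / 16), ∀ t ∈ Ioo (0 : ℝ) (1 / 16),
        H U V 0 t = H U V 0 s * (t / s) ^ (2 * a) := by
  have hseq : ∀ k : ℕ, ∃ (κ : ℝ) (u v : E n → ℝ), Sol κ u v 0 1 ∧ H u v 0 1 = 1 ∧
      D κ u v 0 1 ≤ a + 1 / ((k : ℝ) + 2) ∧ ∃ y ∈ ball (0 : E n) (1 / ((k : ℝ) + 2)),
        ((k : ℝ) + 1) * ‖y‖ < |u y - u 0| + |v y - v 0| := by
    intro k
    by_contra! hcon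
    have h2 : (1 : ℝ) / ((k : ℝ) + 2) ≤ 1 / 2 := by
      apply one_div_le_one_div_of_le two_pos
      linarith [(Nat.cast_nonneg k : (0 : ℝ) ≤ k)]
    exact hn ⟨1 / ((k : ℝ) + 2), 1 / ((k : ℝ) + 2), (k : ℝ) + 1, by positivity, by positivity, h2,
      by positivity, hcon⟩
  choose κ₀ u₀ v₀ S₀ hH₀ hD₀ y₀ hy₀ hosc₀ using hseq
  have hcast : Tendsto (fun k : ℕ => (k : ℝ)) atTop atTop := tendsto_natCast_atTop_atTop
  have hinv : Tendsto (fun k : ℕ => 1 / ((k : ℝ) + 2)) atTop (𝓝 0) :=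
    tendsto_const_nhds.div_atTop (tendsto_atTop_add_const_right _ _ hcast)
  have hκ₀ : Tendsto κ₀ atTop atTop := by
    rw [Filter.tendsto_atTop]
    intro K
    obtain ⟨C, hC, hl⟩ := lipschitz_of_bounded n K
    filter_upwards [hcast.eventually (eventually_ge_atTop C),
      hinv.eventually (gt_mem_nhds (show (0 : ℝ) < 1 / 4 by norm_num))] with k hk1 hk2
    by_contra! hlt
    have h1 := hl _ _ _ (S₀ k) hlt.le (hH₀ k).le (y₀ k) (ball_subset_ball hk2.le (hy₀ k))
    have h2 := hosc₀ k
    nlinarith [norm_nonneg (y₀ k)]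
  obtain ⟨φ, U, V, M, hφ, L⟩ := exists_limSeq (half_pos ha) (hP _ (half_pos ha).le
    (half_lt_self ha)) hκ₀ S₀ hH₀
  have hφt := hφ.tendsto_atTop
  have hzero : U 0 = 0 ∧ V 0 = 0 := by
    by_contra hcon
    rw [not_and_or] at hcon
    obtain ⟨s, hs, hsub, hlap⟩ := L.lap_small (mem_ball_self L.R_pos) hcon
    obtain ⟨C, hC, hlip⟩ := lipschitz_estimate n
    have hM := L.M_pos
    obtain ⟨k, hk1, hk2, hk3⟩ := ((hlap 1 one_pos).and ((hφt.eventually (hcast.eventually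
      (eventually_ge_atTop (2 * (C * (M / s + s * 1)))))).and (hφt.eventually
        (hinv.eventually (gt_mem_nhds (half_pos hs)))))).exists
    have hy : y₀ (φ k) ∈ ball (0 : E n) (s / 2) := ball_subset_ball hk3.le (hy₀ (φ k))
    have h0 : (0 : E n) ∈ ball (0 : E n) (s / 2) := mem_ball_self (half_pos hs)
    have S := L.sol k
    have h1 := hlip _ S.hu 0 s M 1 hs (fun z hz => by
      rw [abs_of_pos (S.u_pos z (hsub hz))]; exact (L.bdd k z (hsub hz)).1)
      (fun z hz => (hk1 z hz).1) _ hy 0 h0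
    have h2 := hlip _ S.hv 0 s M 1 hs (fun z hz => by
      rw [abs_of_pos (S.v_pos z (hsub hz))]; exact (L.bdd k z (hsub hz)).2)
      (fun z hz => (hk1 z hz).2) _ hy 0 h0
    have h3 := hosc₀ (φ k)
    rw [sub_zero] at h1 h2
    simp only [Function.comp_apply] at h1 h2
    nlinarith [norm_nonneg (y₀ (φ k))]
  have hfreq : ∀ k, ∀ s ∈ Ioc (0 : ℝ) 1, D (κ₀ k) (u₀ k) (v₀ k) 0 s / H (u₀ k) (v₀ k) 0 s ≤
      a + 1 / ((k : ℝ) + 2) := by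
    intro k s hs
    have := (S₀ k).alm.freq_mono hs.1 hs.2 le_rfl
    rw [hH₀, div_one] at this
    exact this.trans (hD₀ k)
  have hpos : ∀ s ∈ Ioo (0 : ℝ) (1 / 16), 0 < H U V 0 s := by
    intro s hs
    have hs1 : s ≤ 1 := by linarith [hs.2]
    have h1 : (1 : ℝ) ≤ 1 / s := (one_le_div hs.1).2 hs1
    have hle : 1 ≤ H U V 0 s * (1 / s) ^ (4 * (a + 1)) := by
      refine ge_of_tendsto' ((L.tendsto_H hs.1.le hs.2.le).mul_const _) fun k => ?_
      have h2 := (S₀ (φ k)).alm.h_upper hs.1 hs1 le_rfl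
      have h3 := hfreq (φ k) 1 ⟨one_pos, le_rfl⟩
      have h4 : (1 : ℝ) / ((φ k : ℝ) + 2) ≤ 1 := by
        rw [div_le_one (by positivity)]
        linarith [(Nat.cast_nonneg (φ k) : (0 : ℝ) ≤ φ k)]
      have h5 := ((S₀ (φ k)).H_pos one_pos s).le
      rw [hH₀] at h2 h3
      refine h2.trans ?_
      simp only [Function.comp_apply]
      have h6 := Real.rpow_le_rpow_of_exponent_le h1 (show 4 * (D (κ₀ (φ k)) (u₀ (φ k)) (v₀ (φ k)) 0 1 /
        1) ≤ 4 * (a + 1) by linarith)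
      exact mul_le_mul_of_nonneg_left h6 h5
    by_contra! hcon
    have : H U V 0 s * (1 / s) ^ (4 * (a + 1)) ≤ 0 :=
      mul_nonpos_of_nonpos_of_nonneg hcon (by have := hs.1; positivity)
    linarith
  refine ⟨_, _, _, U, V, M, L, hzero.1, hzero.2, hpos, power_law fun s hs t ht => ?_⟩
  obtain ⟨ν, hν0, ψ, hψ, hlim⟩ := L.exists_freq hs.1 hs.2 (hpos s hs)
  have L' := L.subseq hψ
  have hlow := L'.lower_of_tendsto hs.1 hs.2.le (hpos s hs) hlim
  have h1 := L'.le_freq hzero.1 hzero.2 hP hs.1 hν0 (hpos s hs) hlow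
  have h2 : ν ≤ a := by
    have hr : Tendsto (fun k => a + 1 / ((φ (ψ k) : ℝ) + 2)) atTop (𝓝 (a + 0)) :=
      (hinv.comp (hφt.comp hψ.tendsto_atTop)).const_add a
    rw [add_zero] at hr
    exact le_of_tendsto_of_tendsto' hlim hr fun k =>
      hfreq _ s ⟨hs.1, by linarith [hs.2]⟩
  obtain rfl := le_antisymm h2 h1
  exact hlow t ⟨ht.1, ht.2.le⟩

end

/-! ### Homogeneous limits on the whole space -/

section

variable {κ : ℕ → ℝ} {u v : ℕ → E n → ℝ} {U V : E n → ℝ} {x : E n} {R M : ℝ}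

lemma LimSeq.congr (L : LimSeq κ u v U V x R M) {U' V' : E n → ℝ} (cU : Continuous U')
    (cV : Continuous V') (hU : ∀ z ∈ ball x R, U' z = U z) (hV : ∀ z ∈ ball x R, V' z = V z) :
    LimSeq κ u v U' V' x R M :=
  ⟨L.R_pos, L.M_pos, L.tendsto_κ, L.sol, L.bdd, cU, cV,
    fun η hη => (L.unif_u η hη).mono fun k hk z hz => by rw [hU z hz]; exact hk z hz,
    fun η hη => (L.unif_v η hη).mono fun k hk z hz => by rw [hV z hz]; exact hk z hz⟩

lemma LimSeq.homogeneous_all (L : LimSeq κ u v U V x R M) {a : ℝ} (ha : 0 ≤ a)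
    (hh : ∀ s ∈ Ioo 0 R, ∀ t ∈ Ioo 0 R, H U V x t = H U V x s * (t / s) ^ (2 * a))
    (h0 : ∀ s ∈ Ioo 0 R, 0 < H U V x s) (y : E n) {s t : ℝ} (hs : 0 < s) (ht : 0 < t)
    (hs' : s * (1 + ‖y‖) < R) (ht' : t * (1 + ‖y‖) < R) :
    s ^ (-a) * U (x + s • y) = t ^ (-a) * U (x + t • y) ∧
      s ^ (-a) * V (x + s • y) = t ^ (-a) * V (x + t • y) := by
  wlog hst : t ≤ s generalizing s t
  · have := this ht hs ht' hs' (le_of_not_ge hst)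
    exact ⟨this.1.symm, this.2.symm⟩
  set l := 1 + ‖y‖ with hl
  have hl0 : 0 < l := by positivity
  have hy : l⁻¹ • y ∈ ball (0 : E n) 1 := by
    rw [mem_ball_zero_iff, norm_smul, norm_inv, Real.norm_of_nonneg hl0.le, inv_mul_lt_iff₀ hl0]
    linarith
  have key := L.homogeneous ha hh h0 (r₁ := t * l) (r₂ := s * l) (by positivity)
    (by gcongr) hs' _ hy
  have e : ∀ r : ℝ, (r * l) • l⁻¹ • y = r • y := fun r => by
    rw [smul_smul, mul_assoc, mul_inv_cancel₀ hl0.ne', mul_one]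
  rw [e, e, Real.mul_rpow hs.le hl0.le, Real.mul_rpow ht.le hl0.le] at key
  have hp : l ^ (-a) ≠ 0 := (Real.rpow_pos_of_pos hl0 _).ne'
  constructor
  · apply mul_left_cancel₀ hp
    linarith [key.1]
  · apply mul_left_cancel₀ hp
    linarith [key.2]

/-- A nontrivial homogeneous pair which is a limit of solutions on every ball. -/
structure Cone (U V : E n → ℝ) (a : ℝ) : Prop where
  cU : Continuous U
  cV : Continuous V
  lim : ∀ S > 0, ∃ (κ : ℕ → ℝ) (u v : ℕ → E n → ℝ) (M : ℝ), LimSeq κ u v U V 0 S M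
  hom : ∀ t > 0, ∀ x, U (t • x) = t ^ a * U x ∧ V (t • x) = t ^ a * V x
  zero : U 0 = 0 ∧ V 0 = 0
  ne : ∃ x, U x ≠ 0 ∨ V x ≠ 0

lemma LimSeq.exists_cone (L : LimSeq κ u v U V 0 R M) {a : ℝ} (ha : 0 ≤ a)
    (hU0 : U 0 = 0) (hV0 : V 0 = 0)
    (h0 : ∀ s ∈ Ioo 0 R, 0 < H U V 0 s)
    (hh : ∀ s ∈ Ioo 0 R, ∀ t ∈ Ioo 0 R, H U V 0 t = H U V 0 s * (t / s) ^ (2 * a)) :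
    ∃ U' V' : E n → ℝ, Cone U' V' a := by
  have hR := L.R_pos
  have cU := L.cU
  have cV := L.cV
  set ρ : E n → ℝ := fun x => R / (2 * (1 + ‖x‖)) with hρ
  have hρ0 : ∀ x, 0 < ρ x := fun x => by positivity
  have hρR : ∀ x, ρ x * (1 + ‖x‖) < R := fun x => by
    have : 0 < 1 + ‖x‖ := by positivity
    have e : ρ x * (1 + ‖x‖) = R / 2 := by simp only [hρ]; field_simp
    linarith
  set U' : E n → ℝ := fun x => ρ x ^ (-a) * U (ρ x • x) with hU'
  set V' : E n → ℝ := fun x => ρ x ^ (-a) * V (ρ x • x) with hV'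
  have key : ∀ x t, 0 < t → t * (1 + ‖x‖) < R →
      U' x = t ^ (-a) * U (0 + t • x) ∧ V' x = t ^ (-a) * V (0 + t • x) := by
    intro x t ht htR
    have := L.homogeneous_all ha hh h0 x (hρ0 x) ht (hρR x) htR
    simpa only [zero_add, hU', hV'] using this
  have hloc : ∀ S > 0, ∃ t > 0, t * (1 + S) < R ∧ ∀ x ∈ ball (0 : E n) S,
      U' x = t ^ (-a) * U (0 + t • x) ∧ V' x = t ^ (-a) * V (0 + t • x) := by
    intro S hS
    have hS1 : R / (2 * (1 + S)) * (1 + S) < R := by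
      have e : R / (2 * (1 + S)) * (1 + S) = R / 2 := by field_simp
      linarith
    have ht0 : 0 < R / (2 * (1 + S)) := by positivity
    refine ⟨R / (2 * (1 + S)), ht0, hS1, fun x hx => key x _ ht0 ?_⟩
    have : ‖x‖ < S := by simpa using hx
    refine lt_of_le_of_lt ?_ hS1
    gcongr
  have hc : Continuous U' ∧ Continuous V' := by
    constructor <;>
    · rw [continuous_iff_continuousAt]
      intro x
      obtain ⟨t, -, -, h⟩ := hloc (‖x‖ + 1) (by positivity)
      have hmem : ball (0 : E n) (‖x‖ + 1) ∈ 𝓝 x := isOpen_ball.mem_nhds (by simp)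
      first
      | have hc : Continuous fun x => t ^ (-a) * U (0 + t • x) := by fun_prop
        refine hc.continuousAt.congr ?_
        filter_upwards [hmem] with y hy
        exact (h y hy).1.symm
      | have hc : Continuous fun x => t ^ (-a) * V (0 + t • x) := by fun_prop
        refine hc.continuousAt.congr ?_
        filter_upwards [hmem] with y hy
        exact (h y hy).2.symm
  refine ⟨U', V', hc.1, hc.2, ?_, ?_, ?_, ?_⟩
  · intro S hS
    obtain ⟨t, ht, htR, h⟩ := hloc S hS
    have hp : 0 < t ^ (-a) := Real.rpow_pos_of_pos ht _
    refine ⟨_, _, _, _, (L.affine (c := t ^ (-a)) (r := t) (z := 0) (w := 0) (s := S) hp ht hS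
      (by simp; linarith)).congr hc.1 hc.2 (fun z hz => (h z hz).1) (fun z hz => (h z hz).2)⟩
  · intro t ht x
    set s := R / (2 * (1 + t) * (1 + ‖x‖)) with hs
    have hs0 : 0 < s := by positivity
    have e : s * ((1 + t) * (1 + ‖x‖)) = R / 2 := by rw [hs]; field_simp
    have h1 := key (t • x) s hs0 (by
      rw [norm_smul, Real.norm_of_nonneg ht.le]
      nlinarith [norm_nonneg x, mul_pos hs0 ht, mul_nonneg hs0.le (norm_nonneg x)])
    have h2 := key x (s * t) (by positivity) (by
      nlinarith [norm_nonneg x, mul_pos hs0 ht, mul_nonneg hs0.le (norm_nonneg x)])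
    have h3 : t ^ a * (s * t) ^ (-a) = s ^ (-a) := by
      rw [Real.mul_rpow hs0.le ht.le, mul_left_comm, ← Real.rpow_add ht, add_neg_cancel,
        Real.rpow_zero, mul_one]
    rw [h1.1, h1.2, h2.1, h2.2, ← mul_assoc, ← mul_assoc, h3, smul_smul]
    exact ⟨rfl, rfl⟩
  · simp [hU', hV', hU0, hV0]
  · by_contra! hcon
    have hR4 : R / 4 ∈ Ioo 0 R := ⟨by linarith, by linarith⟩
    have : H U V 0 (R / 4) = 0 := by
      unfold H
      have e : J 2 (fun y : E n => U (0 + (R / 4) • y) ^ 2 + V (0 + (R / 4) • y) ^ 2) =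
          J 2 (fun _ : E n => (0:ℝ)) := by
        apply J_congr two_ne_zero
        intro y hy
        have hy1 : ‖y‖ < 1 := by simpa using hy
        have h1 := key y (R / 4) hR4.1 (by nlinarith)
        have hp : (R / 4) ^ (-a) ≠ 0 := (Real.rpow_pos_of_pos hR4.1 _).ne'
        rw [(hcon y).1, (hcon y).2] at h1
        have hu := (mul_eq_zero.1 h1.1.symm).resolve_left hp
        have hv := (mul_eq_zero.1 h1.2.symm).resolve_left hp
        simp only [hu, hv]; norm_num
      rw [e, J_const', zero_mul, mul_zero]
    exact (h0 _ hR4).ne' this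

end

/-! ### Translation invariance along the zero set -/

section

variable {U V : E n → ℝ} {a : ℝ}

lemma Cone.lim_at (C : Cone U V a) (z : E n) {R : ℝ} (hR : 0 < R) :
    ∃ (κ : ℕ → ℝ) (u v : ℕ → E n → ℝ) (M : ℝ), LimSeq κ u v U V z R M := by
  obtain ⟨κ, u, v, M, L⟩ := C.lim (R + ‖z‖) (by positivity)
  exact ⟨κ, u, v, M, L.mono hR (ball_subset_ball' (by rw [dist_zero_right]))⟩

lemma Cone.nonneg (C : Cone U V a) (z : E n) : 0 ≤ U z ∧ 0 ≤ V z := by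
  obtain ⟨κ, u, v, M, L⟩ := C.lim_at z one_pos
  exact ⟨L.U_nonneg (mem_ball_self one_pos), L.V_nonneg (mem_ball_self one_pos)⟩

lemma Cone.exists_bound (C : Cone U V a) : ∃ B > 0, ∀ R > 0, ∀ x ∈ ball (0 : E n) R,
    U x ≤ B * R ^ a ∧ V x ≤ B * R ^ a := by
  obtain ⟨B₁, h₁⟩ := (isCompact_closedBall (0 : E n) 1).exists_bound_of_continuousOn
    C.cU.continuousOn
  obtain ⟨B₂, h₂⟩ := (isCompact_closedBall (0 : E n) 1).exists_bound_of_continuousOn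
    C.cV.continuousOn
  refine ⟨max 1 (max B₁ B₂), by positivity, fun R hR x hx => ?_⟩
  have hx1 : R⁻¹ • x ∈ closedBall (0 : E n) 1 := by
    have : ‖x‖ < R := by simpa using hx
    rw [mem_closedBall, dist_zero_right, norm_smul, norm_inv, Real.norm_of_nonneg hR.le,
      inv_mul_le_iff₀ hR]
    linarith
  have e : x = R • R⁻¹ • x := by rw [smul_inv_smul₀ hR.ne']
  have hp : 0 < R ^ a := Real.rpow_pos_of_pos hR _
  have h := C.hom R hR (R⁻¹ • x)
  rw [← e] at h
  rw [h.1, h.2, mul_comm (R ^ a), mul_comm (R ^ a)]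
  constructor
  · gcongr
    exact ((le_abs_self _).trans (h₁ _ hx1)).trans ((le_max_left _ _).trans (le_max_right _ _))
  · gcongr
    exact ((le_abs_self _).trans (h₂ _ hx1)).trans ((le_max_right _ _).trans (le_max_right _ _))

lemma Cone.exists_H_le (C : Cone U V a) (z : E n) :
    ∃ C₁ > 0, ∀ t ≥ 1, H U V z t ≤ C₁ * t ^ (2 * a) := by
  obtain ⟨B, hB, h⟩ := C.exists_bound
  refine ⟨12 * cw n 2 * (B * (1 + ‖z‖) ^ a) ^ 2, ?_, fun t ht => ?_⟩
  · have := cw_pos (n := n) (m := 2) two_ne_zero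
    positivity
  · have ht0 : 0 < t := by linarith
    obtain ⟨κ, u, v, M, L⟩ := C.lim_at z ht0
    have h1 := L.H_le (A := B * ((1 + ‖z‖) * t) ^ a) ht0 le_rfl fun y hy =>
      h ((1 + ‖z‖) * t) (by positivity) y (by
        rw [mem_ball] at hy ⊢
        have := dist_triangle y z 0
        rw [dist_zero_right z] at this
        nlinarith [norm_nonneg z])
    refine h1.trans (le_of_eq ?_)
    rw [Real.mul_rpow (by positivity) ht0.le, mul_comm 2 a, Real.rpow_mul ht0.le, Real.rpow_two]
    ring

lemma Cone.exists_H_pos (C : Cone U V a) (z : E n) : ∃ s > 0, 0 < H U V z s := by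
  obtain ⟨x, hx⟩ := C.ne
  obtain ⟨κ, u, v, M, L⟩ := C.lim_at z (R := 2 * ‖x - z‖ + 1) (by positivity)
  obtain ⟨C₀, hC₀, h⟩ := LimSeq.sup_sq_le n
  have h1 := h _ _ _ _ _ _ _ _ L x (by rw [mem_closedBall, dist_eq_norm]; linarith)
  refine ⟨_, L.R_pos, pos_of_mul_pos_right (a := C₀) ?_ hC₀.le⟩
  rcases hx with hx | hx
  · exact (sq_pos_of_ne_zero hx).trans_le h1.1
  · exact (sq_pos_of_ne_zero hx).trans_le h1.2

lemma Cone.exists_freq (C : Cone U V a) (hP : ∀ β : ℝ, 0 ≤ β → β < a → HolderP n β)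
    {z : E n} (hU : U z = 0) (hV : V z = 0) {s t η : ℝ} (hs : 0 < s) (ht : 0 < t)
    (hη : 0 < η) (h0 : 0 < H U V z s) :
    ∃ ν, a ≤ ν ∧ ν ≤ a + η ∧ H U V z s * (t / s) ^ (2 * ν) ≤ H U V z t := by
  obtain ⟨C₁, hC₁, hle⟩ := C.exists_H_le z
  have hlim : Tendsto (fun R : ℝ => (R / s) ^ (2 * η)) atTop atTop :=
    (tendsto_rpow_atTop (by positivity)).comp (tendsto_id.atTop_div_const hs)
  obtain ⟨R, hR1, hRt, hRs, hR⟩ := ((eventually_ge_atTop 1).and ((eventually_ge_atTop t).and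
    ((eventually_gt_atTop s).and (hlim.eventually_gt_atTop (C₁ * s ^ (2 * a) / H U V z s))))).exists
  have hR0 : 0 < R := by linarith
  obtain ⟨κ, u, v, M, L⟩ := C.lim_at z hR0
  obtain ⟨ν, hν, φ, hφ, hN⟩ := L.exists_freq hs hRs h0
  have hlow := (L.subseq hφ).lower_of_tendsto hs hRs.le h0 hN
  refine ⟨ν, L.le_freq hU hV hP hs hν h0 hlow, ?_, hlow t ⟨ht, hRt⟩⟩
  by_contra! hcon
  have h1 := (hlow R ⟨hR0, le_rfl⟩).trans (hle R hR1)
  have h2 : (R / s) ^ (2 * a + 2 * η) ≤ (R / s) ^ (2 * ν) :=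
    Real.rpow_le_rpow_of_exponent_le ((one_le_div hs).2 hRs.le) (by linarith)
  have hRs0 : 0 < R / s := by positivity
  rw [Real.rpow_add hRs0] at h2
  have h3 : R ^ (2 * a) = s ^ (2 * a) * (R / s) ^ (2 * a) := by
    rw [← Real.mul_rpow hs.le hRs0.le, mul_div_cancel₀ _ hs.ne']
  rw [div_lt_iff₀ h0] at hR
  have hp : 0 < (R / s) ^ (2 * a) := Real.rpow_pos_of_pos hRs0 _
  have h4 := mul_le_mul_of_nonneg_left h2 h0.le
  rw [h3] at h1
  have h5 := mul_lt_mul_of_pos_left hR hp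
  linarith

lemma Cone.H_lower (C : Cone U V a) (hP : ∀ β : ℝ, 0 ≤ β → β < a → HolderP n β)
    {z : E n} (hU : U z = 0) (hV : V z = 0) {s t : ℝ} (hs : 0 < s) (ht : 0 < t)
    (h0 : 0 < H U V z s) : H U V z s * (t / s) ^ (2 * a) ≤ H U V z t := by
  choose ν h1 h2 h3 using fun j : ℕ => C.exists_freq hP hU hV hs ht
    (Nat.one_div_pos_of_nat (α := ℝ) (n := j)) h0
  have hν : Tendsto ν atTop (𝓝 a) := by
    refine tendsto_of_tendsto_of_tendsto_of_le_of_le tendsto_const_nhds ?_ h1 h2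
    simpa using tendsto_const_nhds.add (tendsto_one_div_add_atTop_nhds_zero_nat (𝕜 := ℝ))
  exact le_of_tendsto' ((tendsto_base_rpow (div_pos ht hs) (hν.const_mul 2)).const_mul _) h3

lemma Cone.translate (C : Cone U V a) (ha : 0 ≤ a)
    (hP : ∀ β : ℝ, 0 ≤ β → β < a → HolderP n β)
    {z : E n} (hU : U z = 0) (hV : V z = 0) (w : E n) : U (z + w) = U w ∧ V (z + w) = V w := by
  obtain ⟨s₀, hs₀, h₀⟩ := C.exists_H_pos z
  have hpos : ∀ t > 0, 0 < H U V z t := fun t ht =>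
    lt_of_lt_of_le (by positivity) (C.H_lower hP hU hV hs₀ ht h₀)
  have key : ∀ t > 0, U (z + t • w) = t ^ a * U (z + w) ∧ V (z + t • w) = t ^ a * V (z + w) := by
    intro t ht
    obtain ⟨κ, u, v, M, L⟩ := C.lim_at z (R := (1 + t) * (1 + ‖w‖)) (by positivity)
    have hpl := power_law (h := H U V z) (a := a) (R := (1 + t) * (1 + ‖w‖))
      fun s hs r hr => C.H_lower hP hU hV hs.1 hr.1 (hpos s hs.1)
    have h := L.homogeneous_all ha hpl (fun s hs => hpos s hs.1) w ht one_pos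
      (by nlinarith [norm_nonneg w]) (by nlinarith [norm_nonneg w])
    have hp : 0 < t ^ a := Real.rpow_pos_of_pos ht _
    rw [Real.one_rpow, one_mul, one_smul, one_mul, Real.rpow_neg ht.le] at h
    exact ⟨by rw [← h.1, mul_inv_cancel_left₀ hp.ne'], by rw [← h.2, mul_inv_cancel_left₀ hp.ne']⟩
  have key2 : ∀ t > (0 : ℝ), U (t • z + w) = U (z + w) ∧ V (t • z + w) = V (z + w) := by
    intro t ht
    have h1 := key t⁻¹ (by positivity)
    have h2 := C.hom t ht (z + t⁻¹ • w)
    rw [smul_add, smul_inv_smul₀ ht.ne', h1.1, h1.2, ← mul_assoc, ← mul_assoc,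
      ← Real.mul_rpow ht.le (by positivity), mul_inv_cancel₀ ht.ne', Real.one_rpow, one_mul,
      one_mul] at h2
    exact h2
  have cU := C.cU
  have cV := C.cV
  have lim : ∀ {F : E n → ℝ}, Continuous F → (∀ t > (0 : ℝ), F (t • z + w) = F (z + w)) →
      F (z + w) = F w := by
    intro F hF h
    have h1 : Tendsto (fun t : ℝ => F (t • z + w)) (𝓝[>] 0) (𝓝 (F ((0 : ℝ) • z + w))) :=
      (Continuous.tendsto (by fun_prop) (0 : ℝ)).mono_left nhdsWithin_le_nhds
    rw [zero_smul, zero_add] at h1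
    refine tendsto_nhds_unique ?_ h1
    refine tendsto_const_nhds.congr' ?_
    filter_upwards [self_mem_nhdsWithin] with t ht
    exact (h t ht).symm
  exact ⟨lim cU fun t ht => (key2 t ht).1, lim cV fun t ht => (key2 t ht).2⟩

/-- The common zero set of a cone limit is a linear subspace. -/
lemma Cone.exists_zero_space (C : Cone U V a) (ha : 0 ≤ a)
    (hP : ∀ β : ℝ, 0 ≤ β → β < a → HolderP n β) :
    ∃ Z : Submodule ℝ (E n), ∀ z, z ∈ Z ↔ U z = 0 ∧ V z = 0 := by
  have hneg : ∀ z : E n, U z = 0 ∧ V z = 0 → U (-z) = 0 ∧ V (-z) = 0 := by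
    intro z hz
    have h := C.translate ha hP hz.1 hz.2 (-z)
    rw [add_neg_cancel, C.zero.1, C.zero.2] at h
    exact ⟨h.1.symm, h.2.symm⟩
  refine ⟨{ carrier := {z | U z = 0 ∧ V z = 0}, add_mem' := ?_, zero_mem' := C.zero,
            smul_mem' := ?_ }, fun z => Iff.rfl⟩
  · rintro z w hz hw
    have h := C.translate ha hP hz.1 hz.2 w
    exact ⟨h.1.trans hw.1, h.2.trans hw.2⟩
  · rintro c z hz
    rcases lt_trichotomy c 0 with hc | rfl | hc
    · have h := C.hom (-c) (by linarith) z
      have := hneg ((-c) • z) ⟨by rw [h.1, hz.1, mul_zero], by rw [h.2, hz.2, mul_zero]⟩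
      rwa [neg_smul, neg_neg] at this
    · simpa using C.zero
    · have h := C.hom c hc z
      exact ⟨by rw [h.1, hz.1, mul_zero], by rw [h.2, hz.2, mul_zero]⟩

end

/-! ### Homogeneous limits have degree at least one -/

section

section Touch

variable {κ : ℕ → ℝ} {u v : ℕ → E n → ℝ} {U V : E n → ℝ} {x : E n} {R M : ℝ}

/-- A limit has no touching test function with the wrong sign of the Laplacian at a point where
it does not vanish. -/
lemma LimSeq.touch (L : LimSeq κ u v U V x R M) {z : E n} (hz : z ∈ ball x R)
    (h0 : U z ≠ 0 ∨ V z ≠ 0) {σ : ℝ} (hσ : |σ| = 1) {φ : E n → ℝ} (hφ : ContDiff ℝ ∞ φ)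
    (hle : ∀ᶠ y in 𝓝 z, σ * φ y ≤ σ * (U y + V y)) (he : φ z = U z + V z) :
    σ * lap φ z ≤ 0 := by
  by_contra! hpos
  obtain ⟨s, hs, hsub, hlap⟩ := L.lap_small hz h0
  have hφc := (contDiff_lap hφ).continuous
  have hev : ∀ᶠ y in 𝓝 z, σ * lap φ z / 2 < σ * lap φ y :=
    Continuous.continuousAt (by fun_prop) |>.eventually_const_lt (by linarith)
  obtain ⟨δ, hδ, hball⟩ := Metric.eventually_nhds_iff_ball.1 (hle.and hev)
  set r := min s δ with hr
  have hr0 : 0 < r := lt_min hs hδ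
  set ℓ := σ * lap φ z with hℓ
  have c2 := cw_pos (n := n) (m := 2) two_ne_zero
  have c3 := cw_pos (n := n) (m := 3) three_ne_zero
  set A := ℓ / 4 * cw n 3 * r ^ 2 / 12 with hA
  have hA0 : 0 < A := by positivity
  set η := min (ℓ / 8) (A / (8 * cw n 2)) with hη
  have hη0 : 0 < η := lt_min (by positivity) (by positivity)
  have hη1 : η ≤ ℓ / 8 := min_le_left _ _
  have hη2 : η * (8 * cw n 2) ≤ A := (le_div_iff₀ (by positivity)).1 (min_le_right _ _)
  obtain ⟨k, ⟨hk1, hk2⟩, hk3⟩ :=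
    (((L.unif_u η hη0).and (L.unif_v η hη0)).and (hlap η hη0)).exists
  have hu := (L.sol k).hu
  have hv := (L.sol k).hv
  have hσ' : ∀ t : ℝ, |σ * t| = |t| := fun t => by rw [abs_mul, hσ, one_mul]
  have hg : ContDiff ℝ ∞ fun y => σ * (φ y - (u k y + v k y)) := by fun_prop
  have hlg : ∀ y, lap (fun y => σ * (φ y - (u k y + v k y))) y =
      σ * lap φ y - σ * (lap (u k) y) - σ * lap (v k) y := by
    intro y
    rw [lap_const_mul (hφ.sub (hu.add hv)), lap_sub hφ (hu.add hv), lap_add hu hv]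
    ring
  have hrs : ball z r ⊆ ball z s := ball_subset_ball (min_le_left _ _)
  have hrδ : ball z r ⊆ ball z δ := ball_subset_ball (min_le_right _ _)
  have mv := mean_value (m := 2) one_le_two hg hr0.le (x := z) (L := ℓ / 4) fun y hy => by
    rw [hlg y]
    have h1 := hk3 y (hrs hy)
    have h2 := (hball y (hrδ hy)).2
    have h3 := (le_abs_self _).trans ((hσ' _).le.trans h1.1)
    have h4 := (le_abs_self _).trans ((hσ' _).le.trans h1.2)
    linarith
  have up : J 2 (fun y => σ * (φ (z + r • y) - (u k (z + r • y) + v k (z + r • y)))) ≤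
      2 * η * cw n 2 := by
    refine J_le two_ne_zero (continuous_affine hg.continuous z r) fun y hy => ?_
    have hy' := add_smul_mem_ball (x := z) hr0.le hr0 le_rfl hy
    have h1 := hk1 _ (hsub (hrs hy'))
    have h2 := hk2 _ (hsub (hrs hy'))
    have h3 := (hball _ (hrδ hy')).1
    have h4 := (neg_abs_le _).trans' (neg_le_neg ((hσ' _).le.trans h1))
    have h5 := (neg_abs_le _).trans' (neg_le_neg ((hσ' _).le.trans h2))
    linarith
  have low : -(2 * η) ≤ σ * (φ z - (u k z + v k z)) := by
    have h4 := (le_abs_self _).trans ((hσ' _).le.trans (hk1 z hz))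
    have h5 := (le_abs_self _).trans ((hσ' _).le.trans (hk2 z hz))
    rw [he]
    linarith
  have h6 := mul_le_mul_of_nonneg_right low c2.le
  have h7 : ℓ / 4 * cw n (2 + 1) * r ^ 2 / (4 * ((2 : ℕ) + 1)) = A := by
    rw [hA]; norm_num
  rw [h7] at mv
  nlinarith

end Touch

lemma deriv_rpow_sub_taylor (p c : ℝ) :
    deriv (fun s : ℝ => s ^ p - (1 + p * (s - 1) - c * (s - 1) ^ 2)) 1 = 0 ∧
      deriv (deriv fun s : ℝ => s ^ p - (1 + p * (s - 1) - c * (s - 1) ^ 2)) 1 =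
        p * (p - 1) + 2 * c ∧
      ContinuousAt (fun s : ℝ => s ^ p - (1 + p * (s - 1) - c * (s - 1) ^ 2)) 1 := by
  have h1 : ∀ s : ℝ, s ≠ 0 → HasDerivAt
      (fun s : ℝ => s ^ p - (1 + p * (s - 1) - c * (s - 1) ^ 2))
      (p * s ^ (p - 1) - (p - 2 * c * (s - 1))) s := by
    intro s hs
    have h := (Real.hasDerivAt_rpow_const (p := p) (Or.inl hs)).fun_sub
      (((((hasDerivAt_id' s).sub_const 1).const_mul p).const_add 1).fun_sub
        ((((hasDerivAt_id' s).sub_const 1).fun_pow 2).const_mul c))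
    refine h.congr_deriv ?_
    norm_num
    ring
  have h2 : deriv (fun s : ℝ => s ^ p - (1 + p * (s - 1) - c * (s - 1) ^ 2)) =ᶠ[𝓝 1]
      fun s => p * s ^ (p - 1) - (p - 2 * c * (s - 1)) := by
    filter_upwards [isOpen_ne.mem_nhds (one_ne_zero (α := ℝ))] with s hs
    exact (h1 s hs).deriv
  have h3 : HasDerivAt (fun s : ℝ => p * s ^ (p - 1) - (p - 2 * c * (s - 1)))
      (p * (p - 1) + 2 * c) 1 := by
    have h := ((Real.hasDerivAt_rpow_const (x := 1) (p := p - 1) (Or.inl one_ne_zero)).const_mul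
      p).fun_sub ((((hasDerivAt_id' (1 : ℝ)).sub_const 1).const_mul (2 * c)).const_sub p)
    refine h.congr_deriv ?_
    norm_num
  refine ⟨?_, ?_, (h1 1 one_ne_zero).continuousAt⟩
  · rw [(h1 1 one_ne_zero).deriv]; simp
  · rw [h2.deriv_eq, h3.deriv]

lemma taylor_le_rpow {p c : ℝ} (h : 0 < p * (p - 1) + 2 * c) :
    ∀ᶠ s in 𝓝 (1 : ℝ), 1 + p * (s - 1) - c * (s - 1) ^ 2 ≤ s ^ p := by
  obtain ⟨h1, h2, h3⟩ := deriv_rpow_sub_taylor p c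
  filter_upwards [isLocalMin_of_deriv_deriv_pos (h2 ▸ h) h1 h3] with s hs
  norm_num at hs
  linarith

lemma rpow_le_taylor {p c : ℝ} (h : p * (p - 1) + 2 * c < 0) :
    ∀ᶠ s in 𝓝 (1 : ℝ), s ^ p ≤ 1 + p * (s - 1) - c * (s - 1) ^ 2 := by
  obtain ⟨h1, h2, h3⟩ := deriv_rpow_sub_taylor p c
  filter_upwards [isLocalMax_of_deriv_deriv_neg (h2 ▸ h) h1 h3] with s hs
  norm_num at hs
  linarith

lemma contDiff_inner_left (w : E n) : ContDiff ℝ ∞ fun y : E n => ⟪w, y⟫ :=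
  (innerSL ℝ w).contDiff

lemma pd_inner (w : E n) (i : Fin n) (y : E n) : pd i (fun y : E n => ⟪w, y⟫) y = w i := by
  have : HasFDerivAt (fun y : E n => ⟪w, y⟫) (innerSL ℝ w) y := (innerSL ℝ w).hasFDerivAt
  rw [pd, this.fderiv, innerSL_apply_apply, EuclideanSpace.inner_single_right]
  simp

lemma lap_inner (w y : E n) : lap (fun y : E n => ⟪w, y⟫) y = 0 := by
  rw [lap_eq' (contDiff_inner_left w)]
  refine Finset.sum_eq_zero fun i _ => ?_
  rw [show pd i (fun y : E n => ⟪w, y⟫) = fun _ => w i from funext (pd_inner w i)]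
  simp [pd]

lemma gs_inner (w y : E n) : gs (fun y : E n => ⟪w, y⟫) y = ‖w‖ ^ 2 := by
  simp [gs, pd_inner, EuclideanSpace.norm_sq_eq]

lemma lap_taylor {s : E n → ℝ} (hs : ContDiff ℝ ∞ s) (m p c : ℝ) {z : E n} (hz : s z = 1) :
    lap (fun y => m * (1 + p * (s y - 1) - c * (s y - 1) ^ 2)) z =
      m * (p * lap s z - 2 * c * gs s z) := by
  have e : (fun y => m * (1 + p * (s y - 1) - c * (s y - 1) ^ 2)) =
      fun y => m * (((1 - p - c) + (p + 2 * c) * s y) - c * s y ^ 2) := by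
    funext y; ring
  have h1 : ContDiff ℝ ∞ fun y => (p + 2 * c) * s y := by fun_prop
  have h2 : ContDiff ℝ ∞ fun y => c * s y ^ 2 := by fun_prop
  have h0 : ContDiff ℝ ∞ fun _ : E n => (1 - p - c) := contDiff_const
  have hl0 : lap (fun _ : E n => (1 - p - c)) z = 0 := by
    have e2 : ∀ i : Fin n, pd i (fun _ : E n => (1 - p - c)) = fun _ => 0 := fun i => by
      funext y; simp [pd]
    rw [lap_eq' h0]
    exact Finset.sum_eq_zero fun i _ => by rw [e2]; simp [pd]
  rw [e, lap_const_mul ((h0.add h1).sub h2), lap_sub (h0.add h1) h2, lap_add h0 h1,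
    lap_const_mul hs, lap_const_mul (hs.pow 2), lap_sq hs, hz, hl0]
  ring

lemma lap_inner_sq_add {w w' : E n} (hw : ‖w‖ = 1) (hw' : ‖w'‖ = 1) (y : E n) :
    lap (fun y : E n => ⟪w, y⟫ ^ 2 + ⟪w', y⟫ ^ 2) y = 4 := by
  have h := contDiff_inner_left w
  have h' := contDiff_inner_left w'
  rw [lap_add (h.pow 2) (h'.pow 2), lap_sq h, lap_sq h', lap_inner, lap_inner, gs_inner, gs_inner,
    hw, hw']
  norm_num

lemma gs_inner_sq_add {w w' : E n} (hw : ‖w‖ = 1) (hww : ⟪w', w⟫ = 0) :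
    gs (fun y : E n => ⟪w, y⟫ ^ 2 + ⟪w', y⟫ ^ 2) w = 4 := by
  have h := diff_of_smooth (contDiff_inner_left w)
  have h' := diff_of_smooth (contDiff_inner_left w')
  have e : ∀ i, pd i (fun y : E n => ⟪w, y⟫ ^ 2 + ⟪w', y⟫ ^ 2) w = 2 * w i := by
    intro i
    rw [pd_add i ((h w).fun_pow 2) ((h' w).fun_pow 2), pd_sq i (h w), pd_sq i (h' w), pd_inner, pd_inner,
      hww, real_inner_self_eq_norm_sq, hw]
    ring
  have hn := EuclideanSpace.norm_sq_eq w
  simp only [hw, Real.norm_eq_abs, sq_abs] at hn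
  simp only [gs, e, mul_pow]
  rw [← Finset.mul_sum, ← hn]
  norm_num

lemma inner_sq_add_le {w w' : E n} (hw : ‖w‖ = 1) (hw' : ‖w'‖ = 1) (hww : ⟪w', w⟫ = 0) (y : E n) :
    ⟪w, y⟫ ^ 2 + ⟪w', y⟫ ^ 2 ≤ ‖y‖ ^ 2 := by
  have h := real_inner_self_nonneg (x := y - ⟪w, y⟫ • w - ⟪w', y⟫ • w')
  have hww' : ⟪w, w'⟫ = 0 := by rw [real_inner_comm]; exact hww
  simp only [inner_sub_left, inner_sub_right, real_inner_smul_left, real_inner_smul_right,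
    real_inner_self_eq_norm_sq, hw, hw', hww, hww', real_inner_comm w y, real_inner_comm w' y,
    norm_smul, mul_pow, Real.norm_eq_abs, sq_abs] at h
  nlinarith

lemma Cone.not_lt_one {U V : E n → ℝ} {a : ℝ} (C : Cone U V a) (ha : 0 < a)
    (hP : ∀ β : ℝ, 0 ≤ β → β < a → HolderP n β) (ha1 : a < 1) : False := by
  obtain ⟨Z, hZ⟩ := C.exists_zero_space ha.le hP
  have cU := C.cU
  have cV := C.cV
  have hdec : ∀ y : E n, ∃ k ∈ Zᗮ, U y = U k ∧ V y = V k ∧ ∀ w ∈ Zᗮ, ⟪w, y⟫ = ⟪w, k⟫ := by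
    intro y
    obtain ⟨z, hz, k, hk, rfl⟩ := Z.exists_add_mem_mem_orthogonal y
    have h := C.translate ha.le hP ((hZ z).1 hz).1 ((hZ z).1 hz).2 k
    refine ⟨k, hk, h.1, h.2, fun w hw => ?_⟩
    rw [inner_add_right, Submodule.inner_left_of_mem_orthogonal hz hw, zero_add]
  have hcpt : IsCompact (sphere (0 : E n) 1 ∩ (Zᗮ : Set (E n))) :=
    (isCompact_sphere 0 1).inter_right Z.isClosed_orthogonal
  have hne : (sphere (0 : E n) 1 ∩ (Zᗮ : Set (E n))).Nonempty := by
    obtain ⟨x, hx⟩ := C.ne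
    obtain ⟨k, hk, h1, h2, -⟩ := hdec x
    have hk0 : k ≠ 0 := by
      rintro rfl
      rw [h1, h2, C.zero.1, C.zero.2] at hx
      simp at hx
    refine ⟨‖k‖⁻¹ • k, ?_, Zᗮ.smul_mem _ hk⟩
    simp [norm_smul, hk0]
  obtain ⟨e, ⟨he1, heK⟩, hmin⟩ := hcpt.exists_isMinOn hne
    (f := fun y => U y + V y) (Continuous.continuousOn (by fun_prop))
  have he : ‖e‖ = 1 := by simpa using he1
  set m := U e + V e with hm
  have he0 : U e ≠ 0 ∨ V e ≠ 0 := by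
    by_contra! hcon
    have := Submodule.inner_right_of_mem_orthogonal ((hZ e).2 hcon) heK
    rw [real_inner_self_eq_norm_sq, he] at this
    norm_num at this
  have hm0 : 0 < m := by
    have h := C.nonneg e
    rcases he0 with h' | h'
    · linarith [h.1.lt_of_ne' h']
    · linarith [h.2.lt_of_ne' h']
  have hlow : ∀ k ∈ Zᗮ, m * ‖k‖ ^ a ≤ U k + V k := by
    intro k hk
    rcases eq_or_ne k 0 with rfl | hk0
    · rw [norm_zero, Real.zero_rpow ha.ne', mul_zero]
      exact add_nonneg (C.nonneg 0).1 (C.nonneg 0).2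
    · have hk' : 0 < ‖k‖ := norm_pos_iff.2 hk0
      have h := C.hom ‖k‖ hk' (‖k‖⁻¹ • k)
      rw [smul_inv_smul₀ hk'.ne'] at h
      have h2 : m ≤ U (‖k‖⁻¹ • k) + V (‖k‖⁻¹ • k) :=
        hmin ⟨by simp [norm_smul, hk0], Zᗮ.smul_mem _ hk⟩
      have hp : 0 < ‖k‖ ^ a := Real.rpow_pos_of_pos hk' _
      rw [h.1, h.2]
      nlinarith
  obtain ⟨κ, u, v, M, L⟩ := C.lim_at e one_pos
  by_cases hK : ∃ e' ∈ Zᗮ, ‖e'‖ = 1 ∧ ⟪e', e⟫ = 0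
  · obtain ⟨e', he'K, he', horth⟩ := hK
    set s : E n → ℝ := fun y => ⟪e, y⟫ ^ 2 + ⟪e', y⟫ ^ 2 with hs
    have hsm : ContDiff ℝ ∞ s :=
      ((contDiff_inner_left e).pow 2).add ((contDiff_inner_left e').pow 2)
    have hse : s e = 1 := by simp [hs, horth, he]
    have hT := taylor_le_rpow (p := a / 2) (c := a / 2 * (2 - a / 2) / 4) (by nlinarith)
    have hlim : Tendsto s (𝓝 e) (𝓝 1) := hse ▸ hsm.continuous.tendsto e
    have hev := hlim.eventually hT
    have h := L.touch (mem_ball_self one_pos) he0 (σ := 1) (by simp)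
      (φ := fun y => m * (1 + a / 2 * (s y - 1) - a / 2 * (2 - a / 2) / 4 * (s y - 1) ^ 2))
      (by fun_prop) (by
        filter_upwards [hev] with y hy
        obtain ⟨k, hk, h1, h2, h3⟩ := hdec y
        have hsk : s y ≤ ‖k‖ ^ 2 := by
          simp only [hs, h3 e heK, h3 e' he'K]
          exact inner_sq_add_le he he' horth k
        have hs0 : 0 ≤ s y := by positivity
        have h4 : s y ^ (a / 2) ≤ ‖k‖ ^ a := by
          refine (Real.rpow_le_rpow hs0 hsk (by positivity)).trans (le_of_eq ?_)
          rw [← Real.rpow_natCast, ← Real.rpow_mul (norm_nonneg _)]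
          congr 1; push_cast; ring
        rw [one_mul, one_mul, h1, h2]
        exact (mul_le_mul_of_nonneg_left (hy.trans h4) hm0.le).trans (hlow k hk))
      (by simp [hse, hm])
    rw [lap_taylor hsm _ _ _ hse, lap_inner_sq_add he he', gs_inner_sq_add he horth] at h
    nlinarith [mul_pos hm0 (mul_pos ha ha)]
  · have hspan : ∀ k ∈ Zᗮ, k = ⟪e, k⟫ • e := by
      intro k hk
      by_contra hne
      have hd0 : k - ⟪e, k⟫ • e ≠ 0 := sub_ne_zero.2 hne
      refine hK ⟨‖k - ⟪e, k⟫ • e‖⁻¹ • (k - ⟪e, k⟫ • e),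
        Zᗮ.smul_mem _ (Zᗮ.sub_mem hk (Zᗮ.smul_mem _ heK)), ?_, ?_⟩
      · rw [norm_smul, norm_inv, norm_norm, inv_mul_cancel₀ (norm_ne_zero_iff.2 hd0)]
      · rw [real_inner_smul_left, inner_sub_left, real_inner_smul_left,
          real_inner_self_eq_norm_sq, he, real_inner_comm]
        ring
    have hsm := contDiff_inner_left e
    have hse : ⟪e, e⟫ = 1 := by rw [real_inner_self_eq_norm_sq, he, one_pow]
    have hT := (rpow_le_taylor (p := a) (c := a * (1 - a) / 4) (by nlinarith)).and
      (lt_mem_nhds (one_pos (α := ℝ)))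
    have hlim : Tendsto (fun y => ⟪e, y⟫) (𝓝 e) (𝓝 1) := hse ▸ hsm.continuous.tendsto e
    have hev := hlim.eventually hT
    have h := L.touch (mem_ball_self one_pos) he0 (σ := -1) (by simp)
      (φ := fun y => m * (1 + a * (⟪e, y⟫ - 1) - a * (1 - a) / 4 * (⟪e, y⟫ - 1) ^ 2))
      (by fun_prop) (by
        filter_upwards [hev] with y hy
        obtain ⟨k, hk, h1, h2, h3⟩ := hdec y
        have h4 := C.hom ⟪e, y⟫ hy.2 e
        rw [h3 e heK, ← hspan k hk, ← h3 e heK] at h4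
        rw [h1, h2, h4.1, h4.2]
        nlinarith [mul_le_mul_of_nonneg_left hy.1 hm0.le])
      (by simp only [hse, hm]; ring)
    rw [lap_taylor hsm _ _ _ hse, lap_inner, gs_inner, he] at h
    nlinarith [mul_pos hm0 (mul_pos ha (sub_pos.2 ha1))]

lemma reg {a : ℝ} (ha : 0 ≤ a) (ha1 : a < 1) (hP : ∀ β : ℝ, 0 ≤ β → β < a → HolderP n β) :
    Reg n a := by
  rcases ha.eq_or_lt with rfl | ha0
  · exact reg_zero n
  by_contra hn
  obtain ⟨κ, u, v, U, V, M, L, hU0, hV0, h0, hh⟩ := exists_blowup ha0 hP hn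
  obtain ⟨U', V', C⟩ := L.exists_cone ha hU0 hV0 h0 hh
  exact C.not_lt_one ha0 hP ha1

lemma holderP (n : ℕ) {α : ℝ} (h0 : 0 ≤ α) (h1 : α < 1) : HolderP n α :=
  holderP_of_reg (fun _ ha ha1 hP => reg ha ha1 hP) h0 h1

end

/-! ### Localisation -/

section

/-- A function smooth on an open ball agrees with a globally smooth one on smaller balls. -/
lemma exists_smooth_extension {f : E n → ℝ} {x : E n} {r R : ℝ} (hr : 0 < r) (hrR : r < R)
    (hf : ContDiffOn ℝ ∞ f (ball x R)) :
    ∃ g : E n → ℝ, ContDiff ℝ ∞ g ∧ ∀ y ∈ ball x r, g y = f y := by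
  let b : ContDiffBump x := ⟨r, (r + R) / 2, hr, by linarith⟩
  refine ⟨fun y => b y * f y, ?_, fun y hy => ?_⟩
  · rw [contDiff_iff_contDiffAt]
    intro y
    rcases lt_or_ge (dist y x) R with h | h
    · exact (b.contDiff.contDiffAt).mul (hf.contDiffAt (isOpen_ball.mem_nhds h))
    · have hev : (fun y => b y * f y) =ᶠ[𝓝 y] fun _ => 0 := by
        have : ∀ᶠ z in 𝓝 y, (r + R) / 2 < dist z x :=
          (Continuous.continuousAt (by fun_prop)).eventually_const_lt (by linarith)
        filter_upwards [this] with z hz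
        rw [b.zero_of_le_dist hz.le, zero_mul]
      exact contDiffAt_const.congr_of_eventuallyEq hev
  · simp [b.one_of_mem_closedBall (ball_subset_closedBall hy)]

lemma lap_congr {f g : E n → ℝ} {x : E n} (h : f =ᶠ[𝓝 x] g) : lap f x = lap g x := by
  unfold lap
  rw [(h.iteratedFDeriv ℝ 2).eq_of_nhds]

/-- Hölder bounds from balls of radius `1 / 2` combine with the trivial bound at larger scales. -/
lemma bound_of_far {u v : E n → ℝ} {A α : ℝ} (hA : 0 < A) (hα : α ∈ Ioo (0 : ℝ) 1) {x y : E n}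
    (hu : 0 < u x ∧ 0 < u y) (hv : 0 < v x ∧ 0 < v y) (hx : u x + v x ≤ A) (hy : u y + v y ≤ A)
    (hxy : 1 / 2 ≤ ‖x - y‖) : |u x - u y| + |v x - v y| ≤ 4 * A * ‖x - y‖ ^ α := by
  have h1 : |u x - u y| ≤ A := abs_sub_le_iff.2 ⟨by linarith, by linarith⟩
  have h2 : |v x - v y| ≤ A := abs_sub_le_iff.2 ⟨by linarith, by linarith⟩
  have h3 : (1 / 2 : ℝ) ≤ ‖x - y‖ ^ α := by
    refine le_trans ?_ (Real.rpow_le_rpow (by norm_num) hxy hα.1.le)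
    simpa using Real.rpow_le_rpow_of_exponent_ge (x := 1 / 2) (by norm_num) (by norm_num) hα.2.le
  nlinarith

end

end UniformHolder

/-- Uniform interior Hölder estimate for the scaled system Δu = κuv², Δv = κvu²:
the C^α seminorm on B₁(0) is bounded independently of the parameter κ. -/
theorem uniform_interior_holder {n : ℕ} (hn : 2 ≤ n) (A : ℝ) (hA : 0 < A)
    (α : ℝ) (hα : α ∈ Set.Ioo (0 : ℝ) 1) :
    ∃ C : ℝ, ∀ κ : ℝ, 0 < κ → ∀ u v : EuclideanSpace ℝ (Fin n) → ℝ,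
      ContDiffOn ℝ (⊤ : ℕ∞) u (ball (0 : EuclideanSpace ℝ (Fin n)) 2) →
      ContDiffOn ℝ (⊤ : ℕ∞) v (ball (0 : EuclideanSpace ℝ (Fin n)) 2) →
      (∀ x ∈ ball (0 : EuclideanSpace ℝ (Fin n)) 2, 0 < u x) →
      (∀ x ∈ ball (0 : EuclideanSpace ℝ (Fin n)) 2, 0 < v x) →
      (∀ x ∈ ball (0 : EuclideanSpace ℝ (Fin n)) 2, u x + v x ≤ A) →
      (∀ x ∈ ball (0 : EuclideanSpace ℝ (Fin n)) 2, lap u x = κ * (u x * v x ^ 2)) →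
      (∀ x ∈ ball (0 : EuclideanSpace ℝ (Fin n)) 2, lap v x = κ * (v x * u x ^ 2)) →
      ∀ x ∈ ball (0 : EuclideanSpace ℝ (Fin n)) 1,
        ∀ y ∈ ball (0 : EuclideanSpace ℝ (Fin n)) 1,
          |u x - u y| + |v x - v y| ≤ C * ‖x - y‖ ^ α := by
  open UniformHolder in
  obtain ⟨C, hC, h⟩ := (holderP n hα.1.le hα.2).scaled
  refine ⟨max (C * A * 2 ^ α) (4 * A), fun κ hκ u v hu hv hu0 hv0 hA' hlu hlv x hx y hy => ?_⟩
  have h12 : ball (0 : EuclideanSpace ℝ (Fin n)) 1 ⊆ ball 0 2 := ball_subset_ball one_le_two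
  rcases le_or_gt (1 / 2) ‖x - y‖ with hxy | hxy
  · refine (bound_of_far hA hα ⟨hu0 x (h12 hx), hu0 y (h12 hy)⟩ ⟨hv0 x (h12 hx), hv0 y (h12 hy)⟩
      (hA' x (h12 hx)) (hA' y (h12 hy)) hxy).trans ?_
    gcongr
    exact le_max_right _ _
  obtain ⟨f, hf, hfu⟩ := exists_smooth_extension (r := 3 / 2) (by norm_num) (by norm_num) hu
  obtain ⟨g, hg, hgv⟩ := exists_smooth_extension (r := 3 / 2) (by norm_num) (by norm_num) hv
  have hsub : ball x (1 / 2) ⊆ ball 0 (3 / 2) :=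
    ball_subset_ball' (by rw [mem_ball] at hx; linarith)
  have hsub2 : ball x (1 / 2) ⊆ ball 0 2 := hsub.trans (ball_subset_ball (by norm_num))
  have hlap : ∀ {f u : EuclideanSpace ℝ (Fin n) → ℝ}, (∀ y ∈ ball 0 (3 / 2), f y = u y) →
      ∀ z ∈ ball x (1 / 2), lap f z = lap u z := fun hfu z hz =>
    lap_congr (Filter.eventuallyEq_of_mem (isOpen_ball.mem_nhds (hsub hz)) hfu)
  have S : Sol κ f g x (1 / 2) :=
    { hu := hf
      hv := hg
      hκ := hκ
      u_pos := fun z hz => by rw [hfu z (hsub hz)]; exact hu0 z (hsub2 hz)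
      v_pos := fun z hz => by rw [hgv z (hsub hz)]; exact hv0 z (hsub2 hz)
      lap_u := fun z hz => by
        rw [hlap hfu z hz, hfu z (hsub hz), hgv z (hsub hz)]; exact hlu z (hsub2 hz)
      lap_v := fun z hz => by
        rw [hlap hgv z hz, hfu z (hsub hz), hgv z (hsub hz)]; exact hlv z (hsub2 hz) }
  have hxm : x ∈ ball x (1 / 2) := mem_ball_self (by norm_num)
  have hym : y ∈ ball x (1 / 2) := by rwa [mem_ball, dist_comm, dist_eq_norm]
  have key := h κ f g x (1 / 2) A S (by norm_num) hA (fun z hz => by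
    rw [hfu z (hsub hz), hgv z (hsub hz)]
    have h1 := hu0 z (hsub2 hz)
    have h2 := hv0 z (hsub2 hz)
    have h3 := hA' z (hsub2 hz)
    exact ⟨by linarith, by linarith⟩) y hym
  rw [hfu y (hsub hym), hfu x (hsub hxm), hgv y (hsub hym), hgv x (hsub hxm), norm_sub_rev,
    abs_sub_comm, abs_sub_comm (v y)] at key
  refine key.trans ?_
  rw [div_div_eq_mul_div, div_one, Real.mul_rpow (norm_nonneg _) two_pos.le, mul_comm (_ ^ α),
    ← mul_assoc]
  gcongr
  exact le_max_left _ _
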